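/- The class of λ-flat graphs and the class of ξ-nearly planar graphs are parametrically equivalent: there exist functions g, h : ℕ → ℕ such that every ξ-nearly planar graph is g(ξ)-flat, and every λ-flat graph is h(λ)-nearly planar. -/

import Mathlib

/-!
Definitions for wall-by-wall distance, λ-flat graphs and ξ-nearly planar graphs,
following Grigoriev, Koutsonas and Thilikos, "Nearly Planar Graphs and λ-flat Graphs".

A plane graph is modelled combinatorially as a simple graph equipped with a rotation
system (a cyclic order of the edges incident to each vertex) that is planar, i.e.
satisfies Euler's formula (with faces counted as orbits of the face-tracing successor
on darts, corrected for isolated vertices and the number of connected components).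

A graph embedding in the sphere (where edges may cross, but only at points that are
not vertices) is modelled topologically by a `Drawing`: an injective placement of the
vertices on the unit sphere of `ℝ³` together with, for each edge, a simple arc joining
the images of its endpoints whose interior avoids all vertices.
-/

namespace WBW

/-- The set of edges of `G` incident to the vertex `v`. -/
def incidentSet {V : Type*} (G : SimpleGraph V) (v : V) : Set (Sym2 V) :=
  {e | e ∈ G.edgeSet ∧ v ∈ e}

/-- A simple graph together with a rotation system: for every vertex `v`, a
permutation of `Sym2 V` which fixes every non-incident edge and is a single cycle on
the set of edges incident to `v` (the cyclic order `σ_v` of the drawing). -/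
structure RotationSystem (V : Type*) where
  G : SimpleGraph V
  rot : V → Equiv.Perm (Sym2 V)
  rot_cycleOn : ∀ v, (rot v).IsCycleOn (incidentSet G v)
  rot_fixed : ∀ v, ∀ e ∉ incidentSet G v, rot v e = e

variable {V : Type*}

/-- The face-tracing successor on darts: the dart `(u,v)` is followed by the dart
leaving `v` along the edge succeeding `s(u,v)` in the cyclic order around `v`. -/
noncomputable def RotationSystem.faceNext (R : RotationSystem V) (d : R.G.Dart) :
    R.G.Dart :=
  have hmem : d.edge ∈ incidentSet R.G d.toProd.2 :=
    ⟨d.edge_mem, by rcases d with ⟨⟨a, b⟩, h⟩; simp [SimpleGraph.Dart.edge]⟩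
  have hmem' : R.rot d.toProd.2 d.edge ∈ incidentSet R.G d.toProd.2 :=
    (R.rot_cycleOn d.toProd.2).1.mapsTo hmem
  ⟨(d.toProd.2, Sym2.Mem.other hmem'.2), by
    have h := Sym2.other_spec hmem'.2
    have h2 : R.rot d.toProd.2 d.edge ∈ R.G.edgeSet := hmem'.1
    rw [← h] at h2
    exact h2⟩

/-- The number of faces of a rotation system: the number of orbits of the
face-tracing successor on darts. -/
noncomputable def RotationSystem.numFaces (R : RotationSystem V) : ℕ :=
  Nat.card (Quot (fun a b : R.G.Dart => R.faceNext a = b))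

/-- A rotation system is plane (it is an embedding of the graph in the sphere without
crossings) iff it satisfies Euler's formula, componentwise; isolated vertices are
accounted for separately, since they carry no dart. -/
def RotationSystem.IsPlane (R : RotationSystem V) : Prop :=
  Nat.card V + R.numFaces + Nat.card {v : V | ∀ w, ¬ R.G.Adj v w} =
    Nat.card R.G.edgeSet + 2 * Nat.card R.G.ConnectedComponent

/-- Two edges are attached if they share a vertex `v` and appear consecutively in the
cyclic order `σ_v` or its inverse. -/
def Attached (R : RotationSystem V) (e e' : Sym2 V) : Prop :=
  ∃ v : V, e ∈ incidentSet R.G v ∧ e' ∈ incidentSet R.G v ∧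
    (R.rot v e = e' ∨ R.rot v e' = e)

/-- A wall-by-wall walk: a nonempty sequence of distinct edges of `R.G` in which
every two consecutive edges are attached. -/
def IsWbwWalk (R : RotationSystem V) (L : List (Sym2 V)) : Prop :=
  L ≠ [] ∧ L.Nodup ∧ (∀ e ∈ L, e ∈ R.G.edgeSet) ∧ L.Chain' (Attached R)

/-- An `(x,y)`-wall-by-wall walk: a wall-by-wall walk whose first edge is incident to
`x` and whose last edge is incident to `y`. -/
def IsWbwWalkFromTo (R : RotationSystem V) (x y : V) (L : List (Sym2 V)) : Prop :=
  IsWbwWalk R L ∧ (∃ e, L.head? = some e ∧ x ∈ e) ∧ (∃ e, L.getLast? = some e ∧ y ∈ e)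

/-- The wall-by-wall distance between `x` and `y`: the least number of edges of an
`(x,y)`-wall-by-wall walk (`⊤` if there is no such walk). -/
noncomputable def wbwDist (R : RotationSystem V) (x y : V) : ℕ∞ :=
  sInf {n : ℕ∞ | ∃ L, IsWbwWalkFromTo R x y L ∧ (L.length : ℕ∞) = n}

/-- The `λ`-power of a plane graph: keep all edges and make adjacent all pairs of
vertices at wall-by-wall distance at most `λ`. -/
def RotationSystem.power (R : RotationSystem V) (l : ℕ) : SimpleGraph V :=
  R.G ⊔ SimpleGraph.fromRel (fun x y => wbwDist R x y ≤ (l : ℕ∞))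

/-- `H` is a subgraph of `G` via the injection `τ`. -/
def SubgraphVia {U V : Type*} (H : SimpleGraph U) (G : SimpleGraph V) (τ : U → V) :
    Prop :=
  Function.Injective τ ∧ ∀ x y, H.Adj x y → G.Adj (τ x) (τ y)

/-- A graph is `λ`-flat if it is a subgraph of the `λ`-power of some plane graph. -/
def IsFlat (l : ℕ) {V : Type*} (G : SimpleGraph V) : Prop :=
  ∃ (W : Type) (_ : Finite W) (R : RotationSystem W) (τ : V → W),
    R.IsPlane ∧ SubgraphVia G (R.power l) τ

/-- The unit sphere in `ℝ³`. -/
def unitSphere : Set (EuclideanSpace ℝ (Fin 3)) := Metric.sphere 0 1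

/-- A drawing (embedding) of a graph in the sphere: vertices are placed injectively,
every edge is drawn as a simple arc joining the images of its two endpoints, and the
interior of every arc avoids all vertex images (so edges may meet, away from their
endpoints, only at points that are not vertices). -/
structure Drawing {V : Type*} (G : SimpleGraph V) where
  vmap : V → unitSphere
  vmap_inj : Function.Injective vmap
  arc : Sym2 V → C(Set.Icc (0 : ℝ) 1, unitSphere)
  arc_inj : ∀ e ∈ G.edgeSet, Function.Injective (arc e)
  arc_ends : ∀ e ∈ G.edgeSet,
    Sym2.map vmap e =
      s(arc e ⟨0, Set.mem_Icc.mpr (by norm_num)⟩, arc e ⟨1, Set.mem_Icc.mpr (by norm_num)⟩)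
  interior_avoids : ∀ e ∈ G.edgeSet, ∀ t : Set.Icc (0 : ℝ) 1,
    (t : ℝ) ≠ 0 → (t : ℝ) ≠ 1 → arc e t ∉ Set.range vmap

/-- The crossings of the edge `e` in a drawing: pairs consisting of another edge `e'`
and a point, not a vertex, lying on the arcs of both `e` and `e'`. -/
def crossingSet {V : Type*} {G : SimpleGraph V} (D : Drawing G) (e : Sym2 V) :
    Set (Sym2 V × unitSphere) :=
  {q | q.1 ∈ G.edgeSet ∧ q.1 ≠ e ∧ q.2 ∈ Set.range (D.arc e) ∧
    q.2 ∈ Set.range (D.arc q.1) ∧ q.2 ∉ Set.range D.vmap}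

/-- A graph is `ξ`-nearly planar if it has a drawing in the sphere in which every
edge is crossed at most `ξ` times. -/
def IsNearlyPlanar (x : ℕ) {V : Type*} (G : SimpleGraph V) : Prop :=
  ∃ D : Drawing G, ∀ e ∈ G.edgeSet,
    (crossingSet D e).Finite ∧ (crossingSet D e).ncard ≤ x

/-- `λ(G)`: the least `λ` for which `G` is `λ`-flat. -/
noncomputable def flatNum {V : Type*} (G : SimpleGraph V) : ℕ :=
  sInf {l | IsFlat l G}

/-- `ξ(G)`: the least `ξ` for which `G` is `ξ`-nearly planar. -/
noncomputable def nearNum {V : Type*} (G : SimpleGraph V) : ℕ :=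
  sInf {x | IsNearlyPlanar x G}

/-- A graph is 3-connected if it has more than 3 vertices and removing any at most 2
vertices leaves it connected. -/
def ThreeConnected {V : Type*} (G : SimpleGraph V) : Prop :=
  3 < Nat.card V ∧ ∀ s : Set V, s.ncard ≤ 2 → (G.induce sᶜ).Connected

/-- A plane graph is triangulated if every face is bounded by a triangle, i.e. every
orbit of the face-tracing successor has length exactly 3. -/
def RotationSystem.Triangulated (R : RotationSystem V) : Prop :=
  ∀ d : R.G.Dart, R.faceNext (R.faceNext (R.faceNext d)) = d ∧ R.faceNext d ≠ d

/-- `H` is a topological minor of `G`: some subdivision of `H` is a subgraph of `G`,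
equivalently the branch vertices embed injectively into `G` and the edges of `H` are
realized by internally disjoint paths of `G` avoiding the branch vertices. -/
def IsTopMinor {U V : Type*} (H : SimpleGraph U) (G : SimpleGraph V) : Prop :=
  ∃ τ : U → V, Function.Injective τ ∧
    ∃ P : ∀ ⦃x y : U⦄, H.Adj x y → G.Walk (τ x) (τ y),
      (∀ ⦃x y : U⦄ (h : H.Adj x y), (P h).IsPath) ∧
      (∀ ⦃x y : U⦄ (h : H.Adj x y), ∀ v ∈ (P h).support,
        v ∈ Set.range τ → v = τ x ∨ v = τ y) ∧
      (∀ ⦃x y x' y' : U⦄ (h : H.Adj x y) (h' : H.Adj x' y'), s(x, y) ≠ s(x', y') →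
        ∀ v, v ∈ (P h).support → v ∈ (P h').support → v ∈ Set.range τ)

/-- `H` is a contraction of `G`: `H` is obtained from `G` by contracting edges,
equivalently there is a surjection `V(G) → V(H)` with connected fibres such that the
edges of `H` are exactly the pairs of distinct fibres joined by an edge of `G`. -/
def IsContractionOf {U V : Type*} (H : SimpleGraph U) (G : SimpleGraph V) : Prop :=
  ∃ f : V → U, Function.Surjective f ∧
    (∀ u : U, (G.induce (f ⁻¹' {u})).Connected) ∧
    (∀ a b : U, H.Adj a b ↔ a ≠ b ∧ ∃ x y, G.Adj x y ∧ f x = a ∧ f y = b)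

/-- The medial graph of a plane graph `G`: its vertices are the edges of `G`, two of
them being adjacent iff they are attached (this is the dual of the radial graph). -/
def medial (R : RotationSystem V) : SimpleGraph {e : Sym2 V // e ∈ R.G.edgeSet} :=
  SimpleGraph.fromRel (fun e f => Attached R e.1 f.1)

/-- The `(n × n)`-grid graph. -/
def gridGraph (n : ℕ) : SimpleGraph (Fin n × Fin n) :=
  SimpleGraph.fromRel (fun a b =>
    (a.1 = b.1 ∧ (a.2 : ℕ) + 1 = (b.2 : ℕ)) ∨ (a.2 = b.2 ∧ (a.1 : ℕ) + 1 = (b.1 : ℕ)))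

/-- The faces of a rotation system: orbits of the face-tracing successor on darts. -/
def RotationSystem.Face (R : RotationSystem V) : Type _ :=
  Quot (fun a b : R.G.Dart => R.faceNext a = b)

/-- The edge `e` lies on the boundary of the face `F`. -/
def EdgeOnFace (R : RotationSystem V) (e : Sym2 V) (F : R.Face) : Prop :=
  ∃ d : R.G.Dart, Quot.mk _ d = F ∧ d.edge = e

/-- A wall-by-wall walk passes through the face `F` if two consecutive edges of the
walk both lie on the boundary of `F`. -/
def WalkThroughFace (R : RotationSystem V) (L : List (Sym2 V)) (F : R.Face) : Prop :=
  ∃ (l₁ : List (Sym2 V)) (e₁ e₂ : Sym2 V) (l₂ : List (Sym2 V)),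
    L = l₁ ++ e₁ :: e₂ :: l₂ ∧ EdgeOnFace R e₁ F ∧ EdgeOnFace R e₂ F

end WBW

namespace WBW
open Equiv
set_option linter.unusedSectionVars false
set_option linter.style.haveILetI false

section Core

/-- number of classes of the equivalence relation generated by `r` -/
noncomputable def nq {D : Type*} (r : D → D → Prop) : ℕ := Nat.card (Quot r)

/-- the graph of a permutation as a relation -/
def prel {D : Type*} (p : Perm D) : D → D → Prop := fun a b => p a = b

/-- number of cycles of a permutation (fixed points included) -/
noncomputable def zc {D : Type*} (p : Perm D) : ℕ := nq (prel p)

/-- relation generating the components of a pair of permutations -/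
def crel {D : Type*} (s a : Perm D) : D → D → Prop := fun x y => s x = y ∨ a x = y

theorem qmk_iff {D : Type*} (p : Perm D) (x y : D) :
    Quot.mk (prel p) x = Quot.mk (prel p) y ↔ p.SameCycle x y := by
  constructor
  · intro h
    have h2 := Quot.eqvGen_exact h
    clear h
    induction h2 with
    | rel x y h => exact ⟨1, by simpa [prel] using h⟩
    | refl x => exact Perm.SameCycle.refl _ _
    | symm x y _ ih => exact ih.symm
    | trans x y z h1 h2 ih1 ih2 =>
      exact ih1.trans ih2
  · rintro ⟨i, rfl⟩
    have key : ∀ x, Quot.mk (prel p) x = Quot.mk (prel p) (p x) :=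
      fun x => Quot.sound rfl
    induction i using Int.induction_on with
    | zero => simp
    | succ n ih =>
      rw [ih, add_comm, zpow_add, zpow_one, Perm.mul_apply, ← key]
    | pred n ih =>
      rw [ih, key ((p ^ (-(n : ℤ) - 1)) x), ← Perm.mul_apply, ← zpow_one_add]
      simp

theorem sameCycle_map {D β : Type*} {p : Perm D} {f : D → β} (hf : ∀ x, f (p x) = f x)
    {x y : D} (h : p.SameCycle x y) : f x = f y := by
  rw [← qmk_iff] at h
  exact congrArg (Quot.lift f (by intro a b h; rw [← h, hf])) h

theorem sameCycle_forward {D : Type*} [Finite D] {p : Perm D} {S : D → Prop}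
    (hf : ∀ x, S x → S (p x)) {x y : D} (h : p.SameCycle x y) (hx : S x) : S y := by
  obtain ⟨i, rfl⟩ := h.exists_nat_pow_eq
  induction i with
  | zero => simpa
  | succ n ih =>
    rw [pow_succ', Perm.mul_apply]; exact hf _ (ih ⟨n, by simp⟩)

theorem nq_congr {D : Type*} {r s : D → D → Prop}
    (h1 : ∀ x y, r x y → Quot.mk s x = Quot.mk s y)
    (h2 : ∀ x y, s x y → Quot.mk r x = Quot.mk r y) : nq r = nq s := by
  refine Nat.card_congr ⟨Quot.lift (Quot.mk s) h1, Quot.lift (Quot.mk r) h2, ?_, ?_⟩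
  · rintro ⟨x⟩; rfl
  · rintro ⟨x⟩; rfl

theorem nq_le {D : Type*} [Finite D] {r s : D → D → Prop}
    (h1 : ∀ x y, r x y → Quot.mk s x = Quot.mk s y) : nq s ≤ nq r := by
  refine Nat.card_le_card_of_surjective (Quot.lift (Quot.mk s) h1) ?_
  rintro ⟨x⟩; exact ⟨Quot.mk _ x, rfl⟩

/-- adding a pair to a relation -/
def addp {D : Type*} (r : D → D → Prop) (a b : D) : D → D → Prop :=
  fun x y => r x y ∨ (x = a ∧ y = b)

theorem addp_mk {D : Type*} (r : D → D → Prop) (a b x y : D)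
    (h : Quot.mk (addp r a b) x = Quot.mk (addp r a b) y) :
    Quot.mk r x = Quot.mk r y ∨
      (Quot.mk r x = Quot.mk r a ∧ Quot.mk r y = Quot.mk r b) ∨
      (Quot.mk r x = Quot.mk r b ∧ Quot.mk r y = Quot.mk r a) := by
  have h2 := Quot.eqvGen_exact h
  clear h
  induction h2 with
  | rel x y h =>
    rcases h with h | ⟨rfl, rfl⟩
    · exact Or.inl (Quot.sound h)
    · right; left; exact ⟨rfl, rfl⟩
  | refl x => exact Or.inl rfl
  | symm x y _ ih => grind
  | trans x y z h1 h2 ih1 ih2 => grind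

theorem nq_addp {D : Type*} [Finite D] (r : D → D → Prop) (a b : D)
    (h : Quot.mk r a ≠ Quot.mk r b) : nq r = nq (addp r a b) + 1 := by
  classical
  have e : {q : Quot r // q ≠ Quot.mk r b} ≃ Quot (addp r a b) := by
    refine Equiv.ofBijective
      (fun q => Quot.lift (Quot.mk (addp r a b)) (fun x y hxy => Quot.sound (Or.inl hxy)) q.1) ?_
    constructor
    · rintro ⟨⟨x⟩, hx⟩ ⟨⟨y⟩, hy⟩ hxy
      have := addp_mk r a b x y hxy
      apply Subtype.ext
      change Quot.mk r x = Quot.mk r y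
      grind
    · rintro ⟨x⟩
      by_cases hx : Quot.mk r x = Quot.mk r b
      · refine ⟨⟨Quot.mk r a, h⟩, ?_⟩
        change Quot.mk (addp r a b) a = Quot.mk _ x
        have h1 : Quot.mk (addp r a b) a = Quot.mk _ b := Quot.sound (Or.inr ⟨rfl, rfl⟩)
        rw [h1]
        exact (congrArg (Quot.lift (Quot.mk (addp r a b))
          (fun x y hxy => Quot.sound (Or.inl hxy))) hx).symm
      · exact ⟨⟨Quot.mk r x, hx⟩, rfl⟩
  have h3 := Nat.card_congr e
  unfold nq
  rw [← h3]
  haveI : Fintype (Quot r) := Fintype.ofFinite _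
  rw [Nat.card_eq_fintype_card, Nat.card_eq_fintype_card, Fintype.card_subtype_compl]
  have : 0 < Fintype.card (Quot r) := Fintype.card_pos_iff.2 ⟨Quot.mk r a⟩
  simp; omega

theorem nq_le_addp {D : Type*} [Finite D] (r : D → D → Prop) (a b : D) :
    nq r ≤ nq (addp r a b) + 1 := by
  by_cases h : Quot.mk r a = Quot.mk r b
  · refine le_trans (le_of_eq ?_) (Nat.le_succ _)
    refine nq_congr (fun x y hxy => Quot.sound (Or.inl hxy)) ?_
    rintro x y (h1 | ⟨rfl, rfl⟩)
    · exact Quot.sound h1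
    · exact h
  · exact (nq_addp r a b h).le

variable {D : Type*} [Finite D] [DecidableEq D]

/-- merging: if `a`, `b` are in different cycles, multiplying by the swap merges them -/
theorem swap_merge_same {p : Perm D} {a b : D} (h : ¬ p.SameCycle a b) :
    (p * swap a b).SameCycle a b := by
  -- follow the cycle of `b`
  have hb : ∀ k : ℕ, (p * swap a b).SameCycle a ((p ^ (k + 1)) b) := by
    intro k
    induction k with
    | zero => exact ⟨1, by simp⟩
    | succ k ih =>
      by_cases hk : (p ^ (k + 1)) b = b
      · rw [pow_succ', Perm.mul_apply, hk]; exact ⟨1, by simp⟩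
      · have ha : (p ^ (k + 1)) b ≠ a := by
          intro h2; exact h (Perm.SameCycle.symm ⟨(k + 1 : ℕ), by exact_mod_cast h2⟩)
        have : (p ^ (k + 1 + 1)) b = (p * swap a b) ((p ^ (k + 1)) b) := by
          rw [pow_succ', Perm.mul_apply, Perm.mul_apply, swap_apply_of_ne_of_ne ha hk]
        rw [this]
        exact Perm.sameCycle_apply_right.2 ih
  obtain ⟨n, hn, hn2⟩ : ∃ n : ℕ, 0 < n ∧ p ^ n = 1 := by
    exact ⟨orderOf p, orderOf_pos p, pow_orderOf_eq_one p⟩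
  have := hb (n - 1)
  rwa [Nat.sub_add_cancel hn, hn2] at this

theorem sameCycle_mul_swap_of_merge {p : Perm D} {a b : D}
    (h : (p * swap a b).SameCycle a b) {x y : D} (hxy : p.SameCycle x y) :
    (p * swap a b).SameCycle x y := by
  rw [← qmk_iff] at hxy h ⊢
  have key : ∀ x, Quot.mk (prel (p * swap a b)) x = Quot.mk (prel (p * swap a b)) (p x) := by
    intro x
    have k2 : ∀ x, Quot.mk (prel (p * swap a b)) x =
      Quot.mk (prel (p * swap a b)) ((p * swap a b) x) := fun x => Quot.sound rfl
    by_cases hxa : x = a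
    · subst hxa; rw [h, k2 b]; simp
    by_cases hxb : x = b
    · subst hxb; rw [← h, k2 a]; simp
    rw [k2 x, Perm.mul_apply, swap_apply_of_ne_of_ne hxa hxb]
  rw [qmk_iff] at hxy
  exact sameCycle_map (fun x => (key x).symm) hxy

theorem sameCycle_mul_swap {p : Perm D} {a b : D} {x y : D}
    (hxy : (p * swap a b).SameCycle x y) :
    p.SameCycle x y ∨ (p.SameCycle x a ∧ p.SameCycle y b) ∨ (p.SameCycle x b ∧ p.SameCycle y a) := by
  simp only [← qmk_iff]
  apply addp_mk
  refine sameCycle_map (p := p * swap a b) (f := Quot.mk (addp (prel p) a b)) ?_ hxy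
  intro x
  have k2 : ∀ x, Quot.mk (addp (prel p) a b) (p x) = Quot.mk (addp (prel p) a b) x :=
    fun x => (Quot.sound (show addp (prel p) a b x (p x) from Or.inl rfl)).symm
  have h : Quot.mk (addp (prel p) a b) a = Quot.mk (addp (prel p) a b) b :=
    Quot.sound (Or.inr ⟨rfl, rfl⟩)
  rw [Perm.mul_apply, k2]
  by_cases hxa : x = a
  · subst hxa; rw [swap_apply_left, h]
  by_cases hxb : x = b
  · subst hxb; rw [swap_apply_right, h]
  rw [swap_apply_of_ne_of_ne hxa hxb]

theorem zc_merge {p : Perm D} {a b : D} (h : ¬ p.SameCycle a b) :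
    zc p = zc (p * swap a b) + 1 := by
  have h1 := nq_addp (prel p) a b (by rwa [Ne, qmk_iff])
  rw [zc, h1, zc]
  congr 1
  have hm := swap_merge_same h
  refine nq_congr ?_ ?_
  · rintro x y (h | ⟨rfl, rfl⟩)
    · rw [qmk_iff]; exact sameCycle_mul_swap_of_merge hm ⟨1, by simpa [prel] using h⟩
    · rwa [qmk_iff]
  · intro x y hxy
    have k2 : ∀ x, Quot.mk (addp (prel p) a b) (p x) = Quot.mk (addp (prel p) a b) x :=
      fun x => (Quot.sound (show addp (prel p) a b x (p x) from Or.inl rfl)).symm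
    have h : Quot.mk (addp (prel p) a b) a = Quot.mk (addp (prel p) a b) b :=
      Quot.sound (Or.inr ⟨rfl, rfl⟩)
    rw [← hxy, Perm.mul_apply, k2]
    by_cases hxa : x = a
    · subst hxa; rw [swap_apply_left, h]
    by_cases hxb : x = b
    · subst hxb; rw [swap_apply_right, h]
    rw [swap_apply_of_ne_of_ne hxa hxb]

theorem swap_split_not_same {p : Perm D} {a b : D} (hab : a ≠ b) (h : p.SameCycle a b) :
    ¬ (p * swap a b).SameCycle a b := by
  classical
  obtain ⟨i, hi⟩ := h.exists_nat_pow_eq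
  have hex : ∃ k : ℕ, (p ^ k) a = b := ⟨i, hi⟩
  obtain ⟨k, hk, hmin⟩ : ∃ k : ℕ, (p ^ k) a = b ∧ ∀ j < k, (p ^ j) a ≠ b :=
    ⟨Nat.find hex, Nat.find_spec hex, fun j hj => Nat.find_min hex hj⟩
  have hk0 : 0 < k := by
    rcases Nat.eq_zero_or_pos k with h0 | h0
    · subst h0; simp at hk; exact absurd hk hab
    · exact h0
  have hna : ∀ j, 0 < j → j ≤ k → (p ^ j) a ≠ a := by
    intro j hj hjk hja
    have : (p ^ (k - j)) a = b := by
      have h2 : (p ^ k) a = (p ^ (k - j)) ((p ^ j) a) := by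
        rw [← Perm.mul_apply, ← pow_add, Nat.sub_add_cancel hjk]
      rw [hja, hk] at h2; exact h2.symm
    exact hmin _ (by omega) this
  intro hs
  have hS := sameCycle_forward (p := p * swap a b)
    (S := fun x => ∃ j, 0 < j ∧ j ≤ k ∧ (p ^ j) a = x) (x := b) (y := a) ?_ hs.symm
    ⟨k, hk0, le_rfl, hk⟩
  · obtain ⟨j, h1, h2, h3⟩ := hS
    exact hna j h1 h2 h3
  · rintro x ⟨j, h1, h2, rfl⟩
    by_cases hjk : j = k
    · subst hjk; rw [hk]; refine ⟨1, by omega, by omega, by simp⟩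
    · refine ⟨j + 1, by omega, by omega, ?_⟩
      rw [Perm.mul_apply, swap_apply_of_ne_of_ne (hna j h1 h2) (hmin j (by omega)), pow_succ',
        Perm.mul_apply]

theorem zc_split {p : Perm D} {a b : D} (hab : a ≠ b) (h : p.SameCycle a b) :
    zc (p * swap a b) = zc p + 1 := by
  have := zc_merge (swap_split_not_same hab h)
  rwa [mul_assoc, swap_mul_self, mul_one] at this

theorem zc_swap_le (p : Perm D) (a b : D) : zc (p * swap a b) ≤ zc p + 1 := by
  by_cases hab : a = b
  · subst hab
    have : swap a a = (1 : Perm D) := by ext; simp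
    rw [this, mul_one]; omega
  by_cases h : p.SameCycle a b
  · exact (zc_split hab h).le
  · have := zc_merge h; omega

theorem zc_one : zc (1 : Perm D) = Nat.card D := by
  refine Nat.card_congr ⟨Quot.lift id (by intro a b h; exact h), Quot.mk _, ?_, ?_⟩
  · rintro ⟨x⟩; rfl
  · intro x; rfl

end Core
end WBW

namespace WBW
open Equiv
set_option linter.unusedSectionVars false
set_option linter.style.haveILetI false
set_option linter.unusedVariables false

section Invol

/-- involutions -/
def Inv {D : Type*} (m : Perm D) : Prop := ∀ x, m (m x) = x

variable {D : Type*} [Finite D] [DecidableEq D]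

theorem Inv.one : Inv (1 : Perm D) := fun _ => rfl

theorem peel_apply {m : Perm D} (hm : Inv m) (a x : D) :
    (m * swap a (m a)) x = if x = a ∨ x = m a then x else m x := by
  rw [Perm.mul_apply]
  by_cases h1 : x = a
  · subst h1; simp [hm x]
  by_cases h2 : x = m a
  · subst h2; simp
  rw [swap_apply_of_ne_of_ne h1 h2]; simp [h1, h2]

theorem peel_inv {m : Perm D} (hm : Inv m) (a : D) : Inv (m * swap a (m a)) := by
  intro x
  rw [peel_apply hm, peel_apply hm]
  have := hm x
  have := hm a
  have hi := m.injective
  grind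

theorem peel_comm {m : Perm D} (hm : Inv m) (a : D) :
    m * swap a (m a) = swap a (m a) * m := by
  have := Equiv.mul_swap_eq_swap_mul m a (m a)
  rw [hm a, swap_comm (m a) a] at this
  exact this

theorem peel_swap (m : Perm D) (a b : D) : (m * swap a b) * swap a b = m := by
  rw [mul_assoc, swap_mul_self, mul_one]

theorem peel_card {m : Perm D} (hm : Inv m) {a : D} (ha : m a ≠ a) :
    {x | (m * swap a (m a)) x ≠ x}.ncard + 2 = {x | m x ≠ x}.ncard := by
  have h : {x | m x ≠ x} = insert a (insert (m a) {x | (m * swap a (m a)) x ≠ x}) := by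
    ext x
    simp only [Set.mem_ofPred_eq, Set.mem_insert_iff, peel_apply hm]
    have := hm a
    grind
  rw [h, Set.ncard_insert_of_notMem, Set.ncard_insert_of_notMem]
  · simp [peel_apply hm]
  · simp [peel_apply hm, ha.symm]

theorem inv_ind {P : Perm D → Prop} (h1 : P 1)
    (hs : ∀ m a, Inv m → m a ≠ a → P (m * swap a (m a)) → P m) (m : Perm D) (hm : Inv m) : P m := by
  induction hk : {x | m x ≠ x}.ncard using Nat.strong_induction_on generalizing m with
  | _ k ih =>
    by_cases hex : ∃ a, m a ≠ a
    · obtain ⟨a, ha⟩ := hex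
      have := peel_card hm ha
      exact hs m a hm ha (ih _ (by omega) _ (peel_inv hm a) rfl)
    · push Not at hex
      have : m = 1 := Equiv.ext hex
      rw [this]; exact h1

theorem zc_peel {m : Perm D} (hm : Inv m) {a : D} (ha : m a ≠ a) :
    zc (m * swap a (m a)) = zc m + 1 :=
  zc_split ha.symm ⟨1, by simp⟩

theorem zc_inv (m : Perm D) (hm : Inv m) :
    2 * zc m + {x | m x ≠ x}.ncard = 2 * Nat.card D := by
  refine inv_ind (P := fun m => 2 * zc m + {x | m x ≠ x}.ncard = 2 * Nat.card D) ?_ ?_ m hm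
  · simp [zc_one]
  · intro m a hm ha ih
    have := peel_card hm ha
    have := zc_peel hm ha
    omega

theorem mul_peel {m : Perm D} (hm : Inv m) (p : Perm D) (a : D) :
    p * m = p * swap a (m a) * (m * swap a (m a)) := by
  rw [peel_comm hm, mul_assoc, ← mul_assoc (swap a (m a)), swap_mul_self, one_mul]

theorem inv_le (m : Perm D) (hm : Inv m) :
    ∀ p : Perm D, zc (p * m) + zc m ≤ zc p + Nat.card D := by
  refine inv_ind (P := fun m => ∀ p : Perm D, zc (p * m) + zc m ≤ zc p + Nat.card D) ?_ ?_ m hm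
  · intro p; simp [zc_one]
  · intro m a hm ha ih p
    have h1 := ih (p * swap a (m a))
    rw [← mul_peel hm] at h1
    have := zc_peel hm ha
    have := zc_swap_le p a (m a)
    omega

/-- the pair `(p, m)` is tight when every transposition of `m` splits a cycle -/
def Tight (p m : Perm D) : Prop := zc (p * m) + zc m = zc p + Nat.card D

theorem Tight.step {p m : Perm D} (hm : Inv m) (h : Tight p m) {a : D} (ha : m a ≠ a) :
    p.SameCycle a (m a) ∧ Tight (p * swap a (m a)) (m * swap a (m a)) := by
  have h1 := inv_le _ (peel_inv hm a) (p * swap a (m a))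
  rw [← mul_peel hm] at h1
  have h2 := zc_peel hm ha
  unfold Tight at h ⊢
  by_cases hs : p.SameCycle a (m a)
  · refine ⟨hs, ?_⟩
    have := zc_split ha.symm hs
    rw [← mul_peel hm]
    omega
  · have := zc_merge hs
    omega

/-- twice the genus of a hypermap -/
noncomputable def df (s a : Perm D) : ℤ :=
  (Nat.card D : ℤ) + 2 * nq (crel s a) - zc s - zc a - zc (s * a)

theorem crel_of_same {s a : Perm D} {x y : D} (h : (s * a).SameCycle x y) :
    Quot.mk (crel s a) x = Quot.mk (crel s a) y := by
  refine sameCycle_map (p := s * a) (f := Quot.mk (crel s a)) ?_ h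
  intro x
  have h1 : Quot.mk (crel s a) x = Quot.mk (crel s a) (a x) := Quot.sound (Or.inr rfl)
  have h2 : Quot.mk (crel s a) (a x) = Quot.mk (crel s a) (s (a x)) := Quot.sound (Or.inl rfl)
  rw [Perm.mul_apply, ← h2, ← h1]

theorem crel_of_same_left {s a : Perm D} {x y : D} (h : s.SameCycle x y) :
    Quot.mk (crel s a) x = Quot.mk (crel s a) y := by
  refine sameCycle_map (p := s) (f := Quot.mk (crel s a)) ?_ h
  intro x
  symm
  exact Quot.sound (Or.inl rfl)

theorem df_delete (s : Perm D) {m : Perm D} (hm : Inv m) {a : D} (ha : m a ≠ a) :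
    df s (m * swap a (m a)) ≤ df s m := by
  have h1 := zc_peel hm ha
  unfold df
  have hstep : ∀ x y, crel s m x y → crel s (m * swap a (m a)) x y ∨ (x = a ∧ y = m a) ∨
      (x = m a ∧ y = a) := by
    rintro x y (h | h)
    · exact Or.inl (Or.inl h)
    · unfold crel
      rw [peel_apply hm]
      have := hm a
      grind
  rw [← mul_assoc]
  by_cases hs : (s * m).SameCycle a (m a)
  · have h2 := zc_split ha.symm hs
    have h3 := nq_le_addp (crel s (m * swap a (m a))) a (m a)
    have h4 : nq (addp (crel s (m * swap a (m a))) a (m a)) ≤ nq (crel s m) := by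
      refine nq_le ?_
      intro x y h
      rcases hstep x y h with h | ⟨rfl, rfl⟩ | ⟨rfl, rfl⟩
      · exact Quot.sound (Or.inl h)
      · exact Quot.sound (Or.inr ⟨rfl, rfl⟩)
      · symm; exact Quot.sound (Or.inr ⟨rfl, rfl⟩)
    omega
  · have h2 := zc_merge hs
    have h3 := swap_merge_same hs
    rw [mul_assoc] at h3
    have h3 := crel_of_same h3
    have h4 : nq (crel s (m * swap a (m a))) ≤ nq (crel s m) := by
      refine nq_le ?_
      intro x y h
      rcases hstep x y h with h | ⟨rfl, rfl⟩ | ⟨rfl, rfl⟩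
      · exact Quot.sound h
      · exact h3
      · exact h3.symm
    omega

theorem df_contract {s m : Perm D} (hm : Inv m) {a : D} (ha : ¬ s.SameCycle a (m a)) :
    df (s * swap a (m a)) (m * swap a (m a)) ≤ df s m := by
  have hne : m a ≠ a := by intro h; rw [h] at ha; exact ha (Perm.SameCycle.refl _ _)
  have h1 := zc_peel hm hne
  have h2 := zc_merge ha
  unfold df
  rw [← mul_peel hm]
  have h3 := crel_of_same_left (a := m * swap a (m a)) (swap_merge_same ha)
  have h4 : nq (crel (s * swap a (m a)) (m * swap a (m a))) ≤ nq (crel s m) := by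
    refine nq_le ?_
    rintro x y (h | h)
    · exact crel_of_same_left (sameCycle_mul_swap_of_merge (swap_merge_same ha)
        ⟨1, by simpa using h⟩)
    · by_cases hx : x = a ∨ x = m a
      · have := hm a
        rcases hx with rfl | rfl
        · rw [← h]; exact h3
        · rw [← h, this]; exact h3.symm
      · refine Quot.sound (Or.inr ?_)
        rw [peel_apply hm, if_neg hx, h]
  omega

theorem df_dangle {s m : Perm D} (hm : Inv m) {d : D} (hd : m d = d) (hs : s d ≠ d) :
    df (s * swap d (s⁻¹ d)) m ≤ df s m := by
  have hne : d ≠ s⁻¹ d := by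
    intro h; apply hs; conv_lhs => rw [h]
    simp
  have h1 : zc (s * swap d (s⁻¹ d)) = zc s + 1 :=
    zc_split hne (Perm.SameCycle.symm ⟨1, by simp⟩)
  have h2 : s * swap d (s⁻¹ d) * m = (s * m) * swap d (m (s⁻¹ d)) := by
    rw [mul_assoc, mul_assoc, Equiv.mul_swap_eq_swap_mul, hm, hd]
  have h3 : zc ((s * m) * swap d (m (s⁻¹ d))) = zc (s * m) + 1 := by
    refine zc_split ?_ (Perm.SameCycle.symm ⟨1, ?_⟩)
    · intro h
      apply hne
      have := congrArg m h
      rwa [hm, hd] at this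
    · simp
      have := hm (s⁻¹ d)
      simp at this
      rw [this]; simp
  unfold df
  rw [h2, h1, h3]
  have h4 := nq_le_addp (crel (s * swap d (s⁻¹ d)) m) d (s⁻¹ d)
  have h5 : nq (addp (crel (s * swap d (s⁻¹ d)) m) d (s⁻¹ d)) ≤ nq (crel s m) := by
    refine nq_le ?_
    set r := addp (crel (s * swap d (s⁻¹ d)) m) d (s⁻¹ d) with hr
    have e0 : Quot.mk r d = Quot.mk r (s⁻¹ d) := Quot.sound (Or.inr ⟨rfl, rfl⟩)
    have e1 : ∀ x, Quot.mk r x = Quot.mk r ((s * swap d (s⁻¹ d)) x) :=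
      fun x => Quot.sound (Or.inl (Or.inl rfl))
    rintro x y (h | h)
    · rw [← h]
      by_cases hx : x = d
      · rw [hx, e0, e1 (s⁻¹ d)]; simp
      by_cases hx2 : x = s⁻¹ d
      · rw [hx2, ← e0, e1 d]; simp
      rw [e1 x, Perm.mul_apply, swap_apply_of_ne_of_ne hx hx2]
    · exact Quot.sound (Or.inl (Or.inr h))
  omega

theorem df_one (s : Perm D) : df s 1 = 0 := by
  unfold df
  have : nq (crel s 1) = zc s := by
    refine nq_congr ?_ ?_
    · rintro x y (h | h)
      · exact Quot.sound h
      · rw [← h]; rfl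
    · intro x y h; exact Quot.sound (Or.inl h)
  rw [this, mul_one, zc_one]; omega

theorem df_nonneg (s m : Perm D) (hm : Inv m) : 0 ≤ df s m := by
  refine inv_ind (P := fun m => 0 ≤ df s m) ?_ ?_ m hm
  · rw [df_one]
  · intro m a hm ha ih
    exact ih.trans (df_delete s hm ha)

end Invol
end WBW

namespace WBW
open Equiv
set_option linter.unusedSectionVars false
set_option linter.style.haveILetI false
set_option linter.unusedVariables false

section Rot
variable {W : Type*}

theorem dart_ext_edge {G : SimpleGraph W} {d d' : G.Dart} (h1 : d.fst = d'.fst)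
    (h2 : d.edge = d'.edge) : d = d' := by
  rcases (SimpleGraph.dart_edge_eq_iff d d').1 h2 with h | h
  · exact h
  · rw [h] at h1
    exact absurd h1 (SimpleGraph.Dart.snd_ne_fst d')

theorem dart_mem_incident {G : SimpleGraph W} (d : G.Dart) : d.edge ∈ incidentSet G d.fst :=
  ⟨d.edge_mem, by rcases d with ⟨⟨a, b⟩, h⟩; simp [SimpleGraph.Dart.edge]⟩

theorem dart_mem_incident_snd {G : SimpleGraph W} (d : G.Dart) : d.edge ∈ incidentSet G d.snd :=
  ⟨d.edge_mem, by rcases d with ⟨⟨a, b⟩, h⟩; simp [SimpleGraph.Dart.edge]⟩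

/-- the dart leaving `u` along the incident edge `e` -/
noncomputable def dartOf (G : SimpleGraph W) (u : W) (e : Sym2 W) (h : e ∈ incidentSet G u) :
    G.Dart :=
  ⟨(u, Sym2.Mem.other h.2), by
    have h1 := Sym2.other_spec h.2
    have h2 : e ∈ G.edgeSet := h.1
    rw [← h1] at h2
    exact h2⟩

theorem dartOf_fst (G : SimpleGraph W) (u : W) (e : Sym2 W) (h : e ∈ incidentSet G u) :
    (dartOf G u e h).fst = u := rfl

theorem dartOf_edge (G : SimpleGraph W) (u : W) (e : Sym2 W) (h : e ∈ incidentSet G u) :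
    (dartOf G u e h).edge = e := Sym2.other_spec h.2

theorem rot_mem (R : RotationSystem W) (v : W) {e : Sym2 W} (h : e ∈ incidentSet R.G v) :
    R.rot v e ∈ incidentSet R.G v := (R.rot_cycleOn v).1.mapsTo h

/-- next dart around the tail -/
noncomputable def sigFun (R : RotationSystem W) (d : R.G.Dart) : R.G.Dart :=
  dartOf R.G d.fst (R.rot d.fst d.edge) (rot_mem R _ (dart_mem_incident d))

theorem sigFun_fst (R : RotationSystem W) (d : R.G.Dart) : (sigFun R d).fst = d.fst := rfl

theorem sigFun_edge (R : RotationSystem W) (d : R.G.Dart) :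
    (sigFun R d).edge = R.rot d.fst d.edge := dartOf_edge _ _ _ _

instance dart_finite [Finite W] (G : SimpleGraph W) : Finite G.Dart :=
  Finite.of_injective (fun d : G.Dart => d.toProd) SimpleGraph.Dart.toProd_injective

theorem sigFun_inj (R : RotationSystem W) : Function.Injective (sigFun R) := by
  intro d d' h
  have h1 : d.fst = d'.fst := by rw [← sigFun_fst R d, h, sigFun_fst]
  refine dart_ext_edge h1 ?_
  have h2 : (sigFun R d).edge = (sigFun R d').edge := by rw [h]
  rw [sigFun_edge, sigFun_edge, h1] at h2
  exact (R.rot d'.fst).injective h2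

variable [Finite W]

noncomputable def sig (R : RotationSystem W) : Perm R.G.Dart :=
  Equiv.ofBijective (sigFun R) (Finite.injective_iff_bijective.1 (sigFun_inj R))

theorem sig_fst (R : RotationSystem W) (d : R.G.Dart) : (sig R d).fst = d.fst := rfl

theorem sig_edge (R : RotationSystem W) (d : R.G.Dart) :
    (sig R d).edge = R.rot d.fst d.edge := sigFun_edge R d

/-- dart reversal -/
def alp (G : SimpleGraph W) : Perm G.Dart :=
  ⟨SimpleGraph.Dart.symm, SimpleGraph.Dart.symm, SimpleGraph.Dart.symm_symm,
    SimpleGraph.Dart.symm_symm⟩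

theorem alp_apply (G : SimpleGraph W) (d : G.Dart) : alp G d = d.symm := rfl

theorem alp_inv (G : SimpleGraph W) : Inv (alp G) := SimpleGraph.Dart.symm_symm

theorem alp_ne (G : SimpleGraph W) (d : G.Dart) : alp G d ≠ d := SimpleGraph.Dart.symm_ne d

theorem faceNext_eq (R : RotationSystem W) (d : R.G.Dart) :
    R.faceNext d = (sig R * alp R.G) d := by
  refine dart_ext_edge rfl ?_
  rw [Perm.mul_apply, sig_edge, alp_apply, SimpleGraph.Dart.edge_symm]
  exact Sym2.other_spec _

theorem numFaces_eq (R : RotationSystem W) : R.numFaces = zc (sig R * alp R.G) := by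
  unfold RotationSystem.numFaces zc nq prel
  simp only [faceNext_eq]

theorem sig_same_iff (R : RotationSystem W) (d d' : R.G.Dart) :
    (sig R).SameCycle d d' ↔ d.fst = d'.fst := by
  constructor
  · intro h
    exact sameCycle_map (f := fun d : R.G.Dart => d.fst) (sig_fst R) h
  · intro h
    obtain ⟨n, hn⟩ := (R.rot_cycleOn d.fst).exists_pow_eq' (Set.toFinite _)
      (dart_mem_incident d) (h ▸ dart_mem_incident d')
    refine ⟨n, ?_⟩
    have key : ∀ n : ℕ, ((sig R ^ n) d).fst = d.fst ∧
        ((sig R ^ n) d).edge = (R.rot d.fst ^ n) d.edge := by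
      intro n
      induction n with
      | zero => simp
      | succ n ih =>
        rw [pow_succ', Perm.mul_apply, sig_fst, sig_edge, ih.1, ih.2, pow_succ', Perm.mul_apply]
        exact ⟨rfl, rfl⟩
    rw [zpow_natCast]
    refine dart_ext_edge ?_ ?_
    · rw [(key n).1, h]
    · rw [(key n).2, hn]

/-- the isolated vertices -/
def isol (G : SimpleGraph W) : Set W := {v : W | ∀ w, ¬ G.Adj v w}

theorem card_vert (R : RotationSystem W) : Nat.card W = zc (sig R) + Nat.card (isol R.G) := by
  classical
  have e : Quot (prel (sig R)) ≃ {w // ¬ w ∈ isol R.G} := by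
    refine Equiv.ofBijective (Quot.lift (fun d => ⟨d.fst, ?_⟩) ?_) ⟨?_, ?_⟩
    · intro h; exact h _ d.adj
    · intro d d' h
      have h : sig R d = d' := h
      apply Subtype.ext
      rw [← h]; exact (sig_fst R d).symm
    · rintro ⟨d⟩ ⟨d'⟩ h
      change Quot.mk (prel (sig R)) d = Quot.mk (prel (sig R)) d'
      rw [qmk_iff, sig_same_iff]
      exact congrArg Subtype.val h
    · rintro ⟨w, hw⟩
      simp only [isol, Set.mem_ofPred_eq, not_forall, not_not] at hw
      obtain ⟨v, hv⟩ := hw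
      exact ⟨Quot.mk _ ⟨(w, v), hv⟩, rfl⟩
  have h1 := Nat.card_congr e
  have h2 := Nat.card_congr (Equiv.sumCompl (fun w => w ∈ isol R.G))
  rw [Nat.card_sum] at h2
  unfold zc nq
  rw [h1, ← h2, add_comm]

theorem walk_crel (R : RotationSystem W) {u v : W} (p : R.G.Walk u v) :
    ∀ d d' : R.G.Dart, d.fst = u → d'.fst = v →
      Quot.mk (crel (sig R) (alp R.G)) d = Quot.mk (crel (sig R) (alp R.G)) d' := by
  classical
  induction p with
  | nil =>
    intro d d' h h'
    exact crel_of_same_left ((sig_same_iff R d d').2 (h.trans h'.symm))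
  | @cons u w v h p ih =>
    intro d d' h1 h2
    let d0 : R.G.Dart := ⟨(u, w), h⟩
    have e1 : Quot.mk (crel (sig R) (alp R.G)) d = Quot.mk (crel (sig R) (alp R.G)) d0 :=
      crel_of_same_left ((sig_same_iff R d d0).2 h1)
    have e2 : Quot.mk (crel (sig R) (alp R.G)) d0 = Quot.mk (crel (sig R) (alp R.G)) d0.symm :=
      Quot.sound (Or.inr rfl)
    rw [e1, e2]
    exact ih _ _ rfl h2

theorem isol_reach (G : SimpleGraph W) {u v : W} (hu : u ∈ isol G) (h : G.Reachable u v) :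
    u = v := by
  obtain ⟨p⟩ := h
  cases p with
  | nil => rfl
  | cons h p => exact absurd h (hu _)

theorem card_comp (R : RotationSystem W) :
    Nat.card R.G.ConnectedComponent = nq (crel (sig R) (alp R.G)) + Nat.card (isol R.G) := by
  have hw : ∀ d d' : R.G.Dart, crel (sig R) (alp R.G) d d' →
      R.G.connectedComponentMk d.fst = R.G.connectedComponentMk d'.fst := by
    rintro d d' (h | h)
    · rw [← h, sig_fst]
    · rw [← h, SimpleGraph.ConnectedComponent.eq]
      exact d.adj.reachable
  have e : Quot (crel (sig R) (alp R.G)) ⊕ isol R.G ≃ R.G.ConnectedComponent := by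
    refine Equiv.ofBijective (Sum.elim
      (Quot.lift (fun d => R.G.connectedComponentMk d.fst) hw)
      (fun v => R.G.connectedComponentMk v.1)) ⟨?_, ?_⟩
    · rintro (⟨⟨d⟩⟩ | ⟨v, hv⟩) (⟨⟨d'⟩⟩ | ⟨v', hv'⟩) h
      · obtain ⟨p⟩ := SimpleGraph.ConnectedComponent.eq.1 h
        exact congrArg Sum.inl (walk_crel R p d d' rfl rfl)
      · have := isol_reach R.G hv' (SimpleGraph.ConnectedComponent.eq.1 h).symm
        exact absurd d.adj (by change ¬ R.G.Adj d.fst _; rw [← this]; exact hv' _)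
      · have := isol_reach R.G hv (SimpleGraph.ConnectedComponent.eq.1 h)
        exact absurd d'.adj (by change ¬ R.G.Adj d'.fst _; rw [← this]; exact hv _)
      · have := isol_reach R.G hv (SimpleGraph.ConnectedComponent.eq.1 h)
        exact congrArg Sum.inr (Subtype.ext this)
    · intro c
      obtain ⟨v, rfl⟩ := c.exists_rep
      by_cases hv : v ∈ isol R.G
      · exact ⟨Sum.inr ⟨v, hv⟩, rfl⟩
      · simp only [isol, Set.mem_ofPred_eq, not_forall, not_not] at hv
        obtain ⟨w, hv⟩ := hv
        exact ⟨Sum.inl (Quot.mk _ ⟨(v, w), hv⟩), rfl⟩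
  rw [← Nat.card_congr e, Nat.card_sum]
  rfl

theorem card_edge (G : SimpleGraph W) : Nat.card G.edgeSet = zc (alp G) := by
  symm
  refine Nat.card_congr (Equiv.ofBijective
    (Quot.lift (fun d => ⟨d.edge, d.edge_mem⟩) ?_) ⟨?_, ?_⟩)
  · intro d d' h
    have h : d.symm = d' := h
    apply Subtype.ext
    rw [← h]; exact (SimpleGraph.Dart.edge_symm d).symm
  · rintro ⟨d⟩ ⟨d'⟩ h
    have h := congrArg Subtype.val h
    have h : d.edge = d'.edge := h
    rcases (SimpleGraph.dart_edge_eq_iff d d').1 h with h | h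
    · rw [h]
    · exact Quot.sound (by rw [h]; exact SimpleGraph.Dart.symm_symm d')
  · rintro ⟨e, he⟩
    induction e using Sym2.ind with
    | _ x y => exact ⟨Quot.mk _ ⟨(x, y), he⟩, rfl⟩

theorem card_dart (G : SimpleGraph W) : Nat.card G.Dart = 2 * zc (alp G) := by
  classical
  have h := zc_inv (alp G) (alp_inv G)
  have : {x | alp G x ≠ x} = Set.univ := by
    ext x; simp only [Set.mem_ofPred_eq, Set.mem_univ, iff_true]; exact alp_ne G x
  rw [this, Set.ncard_univ] at h
  omega

theorem isPlane_iff (R : RotationSystem W) : R.IsPlane ↔ df (sig R) (alp R.G) = 0 := by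
  unfold RotationSystem.IsPlane df
  have h1 := card_vert R
  have h2 := card_comp R
  have h3 := card_edge R.G
  have h4 := card_dart R.G
  have h5 := numFaces_eq R
  unfold isol at h1 h2
  omega

end Rot
end WBW

namespace WBW
open Equiv
set_option linter.unusedSectionVars false
set_option linter.style.haveILetI false
set_option linter.unusedVariables false

section Tree
variable {D : Type*} [Finite D] [DecidableEq D]

/-- A maximal sub-involution all of whose transpositions merge cycles. -/
theorem exists_tree (s a : Perm D) (ha : Inv a) (hne : ∀ d, a d ≠ d) :
    ∃ m : Perm D, Inv m ∧ (∀ d, m d = d ∨ m d = a d) ∧ Tight (s * m) m ∧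
      ∀ d, (s * m).SameCycle d (a d) := by
  let P : Perm D → Prop := fun m => Inv m ∧ (∀ d, m d = d ∨ m d = a d) ∧ Tight (s * m) m
  have hex : ∃ k, ∃ m, P m ∧ zc m = k := by
    refine ⟨_, 1, ⟨Inv.one, fun d => Or.inl rfl, ?_⟩, rfl⟩
    unfold Tight; rw [mul_one, mul_one, zc_one]
  classical
  obtain ⟨m, ⟨hm, hsub, ht⟩, hk⟩ := Nat.find_spec hex
  refine ⟨m, hm, hsub, ht, ?_⟩
  intro d
  by_contra hd
  have h1 : m d = d := by
    rcases hsub d with h | h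
    · exact h
    · exfalso
      have := (ht.step hm (a := d) (by rw [h]; exact hne d)).1
      rw [h] at this
      exact hd this
  have h2 : m (a d) = a d := by
    rcases hsub (a d) with h | h
    · exact h
    · rw [ha d] at h
      have := hm (a d)
      rw [h, h1] at this
      exact absurd this.symm (hne d)
  set m' := m * swap d (a d) with hm'
  have happ : ∀ x, m' x = if x = d then a d else if x = a d then d else m x := by
    intro x
    rw [hm', Perm.mul_apply, swap_apply_def]
    split_ifs with h3 h4
    · exact h2
    · exact h1
    · rfl
  have hInv : Inv m' := by
    intro x
    by_cases hx1 : x = d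
    · subst hx1; rw [happ x, if_pos rfl, happ, if_neg (hne x), if_pos rfl]
    · by_cases hx2 : x = a d
      · subst hx2
        rw [happ (a d), if_neg hx1, if_pos rfl, happ, if_pos rfl]
      · rw [happ x, if_neg hx1, if_neg hx2, happ, if_neg, if_neg]
        · exact hm x
        · intro h; apply hx2; rw [← hm x, h, h2]
        · intro h; apply hx1; rw [← hm x, h, h1]
  have hsub' : ∀ x, m' x = x ∨ m' x = a x := by
    intro x
    rw [happ]
    split_ifs with h3 h4
    · right; rw [h3]
    · right; rw [h4, ha]
    · exact hsub x
  have hmd : m' d = a d := by rw [happ, if_pos rfl]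
  have hz := zc_peel hInv (a := d) (by rw [hmd]; exact hne d)
  rw [hmd] at hz
  have hmm : m' * swap d (a d) = m := peel_swap m d (a d)
  rw [hmm] at hz
  have hz2 := zc_merge hd
  have hT : Tight (s * m') m' := by
    unfold Tight at ht ⊢
    have e1 : s * m * m = s := by
      rw [mul_assoc]; ext x; simp [hm x]
    have e2 : s * m' * m' = s := by
      rw [mul_assoc]; ext x; simp [hInv x]
    have e3 : s * m' = s * m * swap d (a d) := by rw [hm', mul_assoc]
    rw [e1] at ht
    rw [e2, e3]
    omega
  have hlt : zc m' < Nat.find hex := by omega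
  exact Nat.find_min hex hlt ⟨m', ⟨hInv, hsub', hT⟩, rfl⟩

/-- the complementary involution -/
theorem tree_compl {s a m : Perm D} (ha : Inv a) (hne : ∀ d, a d ≠ d) (hm : Inv m)
    (hsub : ∀ d, m d = d ∨ m d = a d) (ht : Tight (s * m) m)
    (hc : ∀ d, (s * m).SameCycle d (a d)) (hdf : df s a = 0) :
    Inv (m * a) ∧ (∀ d, m d = d → (m * a) d = a d) ∧ (∀ d, m d = a d → (m * a) d = d) ∧
      Tight (s * m) (m * a) := by
  have h1 : ∀ d, m d = d → (m * a) d = a d := by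
    intro d h
    rw [Perm.mul_apply]
    rcases hsub (a d) with h' | h'
    · exact h'
    · rw [ha d] at h'
      have := hm (a d)
      rw [h', h] at this
      exact absurd this.symm (hne d)
  have h2 : ∀ d, m d = a d → (m * a) d = d := by
    intro d h
    rw [Perm.mul_apply, ← h]; exact hm d
  have h3 : Inv (m * a) := by
    intro d
    rcases hsub d with h | h
    · rw [h1 d h, Perm.mul_apply, ha d, h]
    · rw [h2 d h, h2 d h]
  refine ⟨h3, h1, h2, ?_⟩
  have c1 := zc_inv m hm
  have c2 := zc_inv (m * a) h3
  have c3 := zc_inv a ha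
  have c4 : {x | a x ≠ x} = Set.univ := by
    ext x; simp only [Set.mem_ofPred_eq, Set.mem_univ, iff_true]; exact hne x
  have c5 : {x | (m * a) x ≠ x} = {x | m x ≠ x}ᶜ := by
    ext x
    simp only [Set.mem_ofPred_eq, Set.mem_compl_iff, not_not]
    constructor
    · intro h
      rcases hsub x with h' | h'
      · exact h'
      · exact absurd (h2 x h') h
    · intro h
      rw [h1 x h]; exact hne x
  have c6 := Set.ncard_add_ncard_compl {x | m x ≠ x}
  rw [c4, Set.ncard_univ] at c3
  rw [c5] at c2
  have e1 : s * m * m = s := by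
    rw [mul_assoc]; ext x; simp [hm x]
  have e2 : s * m * (m * a) = s * a := by rw [← mul_assoc, e1]
  have c7 : zc (s * m) = nq (crel s a) := by
    apply nq_congr
    · intro x y h
      have h : (s * m) x = y := h
      rw [← h, Perm.mul_apply]
      have : Quot.mk (crel s a) (m x) = Quot.mk (crel s a) (s (m x)) :=
        Quot.sound (Or.inl rfl)
      rw [← this]
      rcases hsub x with h' | h'
      · rw [h']
      · rw [h']; exact Quot.sound (Or.inr rfl)
    · intro x y h
      rw [qmk_iff]
      rcases h with h | h
      · have h4 : (s * m).SameCycle x (m x) := by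
          rcases hsub x with h' | h'
          · rw [h']
          · rw [h']; exact hc x
        have h5 : (s * m) (m x) = y := by rw [Perm.mul_apply, hm x, h]
        rw [← h5, Perm.sameCycle_apply_right]
        exact h4
      · rw [← h]; exact hc x
  unfold Tight at ht ⊢
  rw [e1] at ht
  rw [e2]
  unfold df at hdf
  omega

end Tree
end WBW

namespace WBW
open Equiv
set_option linter.unusedSectionVars false
set_option linter.style.haveILetI false
set_option linter.unusedVariables false

section Line
variable {D : Type*} [Finite D] [DecidableEq D]

theorem exists_line (th : Perm D) : ∃ p : D → ℕ, Function.Injective p ∧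
    (∀ d, p (th d) = p d + 1 ∨ ∀ c, th.SameCycle d c → p (th d) ≤ p c ∧ p c ≤ p d) ∧
    (∀ a b c, th.SameCycle a c → p a < p b → p b < p c → th.SameCycle a b) := by
  classical
  have hr : ∀ q : Quot (prel th), ∃ r, Quot.mk _ r = q := fun q => q.exists_rep
  choose r hr using hr
  have hsame : ∀ d, ∃ i : ℕ, (th ^ i) (r (Quot.mk _ d)) = d := by
    intro d
    have : th.SameCycle (r (Quot.mk _ d)) d := by rw [← qmk_iff, hr]
    exact this.exists_nat_pow_eq
  let f : D → ℕ := fun d => Nat.find (hsame d)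
  have hf : ∀ d, (th ^ f d) (r (Quot.mk _ d)) = d := fun d => Nat.find_spec (hsame d)
  have hmin : ∀ d i, (th ^ i) (r (Quot.mk _ d)) = d → f d ≤ i := fun d i h => Nat.find_min' (hsame d) h
  obtain ⟨N, hN⟩ : ∃ N, ∀ d, f d < N := by
    obtain ⟨M, hM⟩ := (Set.finite_range f).bddAbove
    exact ⟨M + 1, fun d => Nat.lt_succ_of_le (hM ⟨d, rfl⟩)⟩
  obtain ⟨k, ⟨e⟩⟩ := Finite.exists_equiv_fin (Quot (prel th))
  let b : D → ℕ := fun d => (e (Quot.mk _ d)).1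
  have hb : ∀ c d, b c = b d ↔ th.SameCycle c d := by
    intro c d
    rw [← qmk_iff]
    constructor
    · intro h; exact e.injective (Fin.ext h)
    · intro h; simp only [b, h]
  have hbl : ∀ c d, b c < b d → b c * N + f c < b d * N + f d := by
    intro c d h
    have h1 := hN c
    have h2 : (b c + 1) * N ≤ b d * N := Nat.mul_le_mul_right _ h
    rw [add_mul, one_mul] at h2
    omega
  have hq : ∀ c d, th.SameCycle c d → (Quot.mk (prel th) c) = Quot.mk _ d := fun c d h => (qmk_iff _ _ _).2 h
  refine ⟨fun d => b d * N + f d, ?_, ?_, ?_⟩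
  · intro c d h
    have h : b c * N + f c = b d * N + f d := h
    rcases lt_trichotomy (b c) (b d) with h1 | h1 | h1
    · have := hbl _ _ h1; omega
    · rw [h1] at h
      rw [← hf c, ← hf d, hq c d ((hb c d).1 h1)]
      congr 2; omega
    · have := hbl _ _ h1; omega
  · intro d
    have hs : th.SameCycle (th d) d := by rw [Perm.sameCycle_apply_left]
    have hb1 : b (th d) = b d := (hb _ _).2 hs
    by_cases h0 : f (th d) = 0
    · right
      intro c hc
      have hb2 : b d = b c := (hb _ _).2 hc
      have h1 := hf (th d)
      rw [h0, pow_zero, Perm.one_apply, hq _ _ hs] at h1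
      simp only [hb1, h0, ← hb2]
      refine ⟨by omega, ?_⟩
      have : f c ≤ f d := by
        by_contra hlt
        push Not at hlt
        have h2 : (th ^ (f d + 1)) (r (Quot.mk _ d)) = r (Quot.mk _ d) := by
          rw [pow_succ', Perm.mul_apply, hf d, ← h1]
        have h3 := hf c
        have h4 : f c = (f c - (f d + 1)) + (f d + 1) := by omega
        rw [h4, pow_add, Perm.mul_apply, ← hq d c hc, h2] at h3
        have := hmin c (f c - (f d + 1)) (by rw [← hq d c hc]; exact h3)
        omega
      omega
    · left
      have h1 := hf (th d)
      obtain ⟨j, hj⟩ := Nat.exists_eq_succ_of_ne_zero h0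
      rw [hj, hq _ _ hs, pow_succ', Perm.mul_apply] at h1
      have h2 := hmin d j (th.injective h1)
      have h3 := hmin (th d) (f d + 1) (by rw [hq _ _ hs, pow_succ', Perm.mul_apply, hf])
      simp only [hb1]
      omega
  · intro x y z hxz h1 h2
    rw [← hb] at hxz ⊢
    have h1 : b x * N + f x < b y * N + f y := h1
    have h2 : b y * N + f y < b z * N + f z := h2
    rcases lt_trichotomy (b x) (b y) with h3 | h3 | h3
    · have := hbl z y (by omega); omega
    · exact h3
    · have := hbl _ _ h3; omega

/-- `r` acts as the cyclic successor on each of its cycles, and its cycles are noncrossing. -/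
def Good (p : D → ℕ) (r : Perm D) : Prop :=
  (∀ d c, r.SameCycle d c → ¬ (p d < p c ∧ p c < p (r d)) ∧
    (p (r d) ≤ p d → p (r d) ≤ p c ∧ p c ≤ p d)) ∧
  (∀ a b c d, p a < p b → p b < p c → p c < p d → r.SameCycle a c → r.SameCycle b d →
    r.SameCycle a b)

theorem good_line {th : Perm D} {p : D → ℕ}
    (h1 : ∀ d, p (th d) = p d + 1 ∨ ∀ c, th.SameCycle d c → p (th d) ≤ p c ∧ p c ≤ p d)
    (h2 : ∀ a b c, th.SameCycle a c → p a < p b → p b < p c → th.SameCycle a b) :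
    Good p th := by
  refine ⟨?_, ?_⟩
  · intro d c hc
    rcases h1 d with h | h
    · omega
    · have := h c hc; omega
  · intro a b c d hab hbc hcd hac hbd
    exact h2 a b c hac hab hbc

theorem good_split {p : D → ℕ} (hp : Function.Injective p) {r : Perm D} (hg : Good p r) {a b : D}
    (hab : r.SameCycle a b) (hlt : p a < p b) :
    Good p (r * swap a b) ∧ (∀ x y, (r * swap a b).SameCycle x y → r.SameCycle x y) ∧
    (∀ x y, (r * swap a b).SameCycle x y → r.SameCycle a x →
      ((p a < p x ∧ p x ≤ p b) ↔ (p a < p y ∧ p y ≤ p b))) := by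
  obtain ⟨g1, g2⟩ := hg
  have hne : a ≠ b := by rintro rfl; omega
  have href : ∀ x y, (r * swap a b).SameCycle x y → r.SameCycle x y := by
    intro x y h
    rcases sameCycle_mul_swap h with h | ⟨h, h'⟩ | ⟨h, h'⟩
    · exact h
    · exact h.trans (hab.trans h'.symm)
    · exact h.trans (hab.symm.trans h'.symm)
  have ha' : (r * swap a b) a = r b := by simp
  have hb' : (r * swap a b) b = r a := by simp
  have ho : ∀ d, d ≠ a → d ≠ b → (r * swap a b) d = r d := by
    intro d h h'; rw [Perm.mul_apply, swap_apply_of_ne_of_ne h h']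
  have hfw : ∀ x, r.SameCycle a x → ((p a < p x ∧ p x ≤ p b) ↔
      (p a < p ((r * swap a b) x) ∧ p ((r * swap a b) x) ≤ p b)) := by
    intro x hx
    have q1 := g1 a b hab
    have q2 := g1 b a hab.symm
    by_cases hxa : x = a
    · subst hxa; rw [ha']; omega
    by_cases hxb : x = b
    · subst hxb; rw [hb']; omega
    rw [ho x hxa hxb]
    have q3 := g1 x a hx.symm
    have q4 := g1 x b (hx.symm.trans hab)
    have : p x ≠ p a := fun h => hxa (hp h)
    have : p x ≠ p b := fun h => hxb (hp h)
    omega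
  have hstep : ∀ x, r.SameCycle a x → r.SameCycle a ((r * swap a b) x) := by
    intro x hx
    refine hx.trans (href _ _ ?_)
    rw [Perm.sameCycle_apply_right]
  have hS : ∀ x y, (r * swap a b).SameCycle x y → r.SameCycle a x →
      ((p a < p x ∧ p x ≤ p b) ↔ (p a < p y ∧ p y ≤ p b)) := by
    intro x y hxy hx
    have := sameCycle_forward (p := r * swap a b)
      (S := fun z => r.SameCycle a z ∧ ((p a < p x ∧ p x ≤ p b) ↔ (p a < p z ∧ p z ≤ p b)))
      (fun z hz => ⟨hstep z hz.1, hz.2.trans (hfw z hz.1)⟩) hxy ⟨hx, Iff.rfl⟩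
    exact this.2
  refine ⟨⟨?_, ?_⟩, href, hS⟩
  · intro d c hdc
    have hdc' := href _ _ hdc
    by_cases hda : d = a
    · subst hda
      have := hS _ _ hdc (Perm.SameCycle.refl _ _)
      have q := g1 b c (hab.symm.trans hdc')
      rw [ha']
      omega
    by_cases hdb : d = b
    · subst hdb
      have := hS _ _ hdc hab
      have q := g1 a c (hab.trans hdc')
      have q1 := g1 a d hab
      rw [hb']
      omega
    rw [ho d hda hdb]
    exact g1 d c hdc'
  · intro x y z w hxy hyz hzw hxz hyw
    have hxy' := g2 x y z w hxy hyz hzw (href _ _ hxz) (href _ _ hyw)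
    have h2 : (r * swap a b * swap a b).SameCycle x y := by rwa [peel_swap]
    rcases sameCycle_mul_swap h2 with h | ⟨h, h'⟩ | ⟨h, h'⟩
    · exact h
    · exfalso
      have s1 := hS _ _ h.symm (Perm.SameCycle.refl _ _)
      have s2 := hS _ _ h'.symm hab
      have s3 := hS _ _ hxz (href _ _ h.symm)
      have s4 := hS _ _ hyw (hab.trans (href _ _ h'.symm))
      omega
    · exfalso
      have s1 := hS _ _ h.symm hab
      have s2 := hS _ _ h'.symm (Perm.SameCycle.refl _ _)
      have s3 := hS _ _ hxz (hab.trans (href _ _ h.symm))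
      have s4 := hS _ _ hyw (href _ _ h'.symm)
      omega

theorem swap_wlog {p : D → ℕ} (hp : Function.Injective p) {r m : Perm D} (hm : Inv m)
    (hg : Good p r) (ht : Tight r m) {a : D} (ha : m a ≠ a) :
    Good p (r * swap a (m a)) ∧
      (∀ x y, (r * swap a (m a)).SameCycle x y → r.SameCycle x y) := by
  have hs := (ht.step hm ha).1
  rcases lt_trichotomy (p a) (p (m a)) with h | h | h
  · have := good_split hp hg hs h
    exact ⟨this.1, this.2.1⟩
  · exact absurd (hp h).symm ha
  · have := good_split hp hg hs.symm h
    rw [swap_comm] at this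
    exact ⟨this.1, this.2.1⟩

theorem good_tight {p : D → ℕ} (hp : Function.Injective p) (m : Perm D) (hm : Inv m) :
    ∀ r : Perm D, Good p r → Tight r m →
    Good p (r * m) ∧ (∀ x y, (r * m).SameCycle x y → r.SameCycle x y) := by
  refine inv_ind (P := fun m => ∀ r : Perm D, Good p r → Tight r m →
    Good p (r * m) ∧ (∀ x y, (r * m).SameCycle x y → r.SameCycle x y)) ?_ ?_ m hm
  · intro r hg ht
    rw [mul_one]; exact ⟨hg, fun _ _ h => h⟩
  · intro m a hm ha ih r hg ht
    have h1 := swap_wlog hp hm hg ht ha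
    have h2 := ih _ h1.1 (ht.step hm ha).2
    rw [← mul_peel hm] at h2
    exact ⟨h2.1, fun x y h => h1.2 x y (h2.2 x y h)⟩

theorem chord_class {p : D → ℕ} (hp : Function.Injective p) {r m : Perm D} (hm : Inv m)
    (hg : Good p r) (ht : Tight r m) {a : D} (hlt : p a < p (m a)) {x y : D}
    (hxy : (r * m).SameCycle x y) (hx : r.SameCycle a x) :
    (p a < p x ∧ p x ≤ p (m a)) ↔ (p a < p y ∧ p y ≤ p (m a)) := by
  have ha : m a ≠ a := by intro h; rw [h] at hlt; omega
  have hs := ht.step hm ha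
  have h1 := good_split hp hg hs.1 hlt
  have h2 := good_tight hp _ (peel_inv hm a) _ h1.1 hs.2
  rw [← mul_peel hm] at h2
  exact h1.2.2 x y (h2.2 x y hxy) hx

theorem chord_chord {p : D → ℕ} (hp : Function.Injective p) {r m : Perm D} (hm : Inv m)
    (hg : Good p r) (ht : Tight r m) {a c : D} (h1 : p a < p c) (h2 : p c < p (m a))
    (h3 : p (m a) < p (m c)) : False := by
  have ha : m a ≠ a := by intro h; rw [h] at h2; omega
  have hc : m c ≠ c := by intro h; rw [h] at h3; omega
  have hs := ht.step hm ha
  have hs' := ht.step hm hc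
  have hac : r.SameCycle a c := hg.2 a c (m a) (m c) h1 h2 h3 hs.1 hs'.1
  have g := good_split hp hg hs.1 (h1.trans h2)
  have e : (m * swap a (m a)) c = m c := by
    rw [peel_apply hm, if_neg]
    rintro (rfl | rfl)
    · omega
    · omega
  have k := (hs.2.step (peel_inv hm a) (a := c) (by rw [e]; exact hc)).1
  rw [e] at k
  have := g.2.2 c (m c) k hac
  omega

end Line
end WBW

namespace WBW
open Equiv
set_option linter.unusedSectionVars false
set_option linter.style.haveILetI false
set_option linter.unusedVariables false

section Route
variable {W : Type*} [Finite W]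

/-- no two edges of the graph interleave with respect to the line order given by `q` -/
def NoInter {N : Type*} (q : N → ℤ) (E : SimpleGraph N) : Prop :=
  ∀ a b c d, E.Adj a b → E.Adj c d → q a < q c → q c < q b → q b < q d → False

theorem routing (R : RotationSystem W) (hR : R.IsPlane) :
    ∃ (q : W ⊕ R.G.Dart → ℤ) (Lo Up : SimpleGraph (W ⊕ R.G.Dart)),
      Function.Injective q ∧ NoInter q Lo ∧ NoInter q Up ∧
      (∀ x y, ¬ Lo.Adj (Sum.inl x) (Sum.inl y)) ∧ (∀ x y, ¬ Up.Adj (Sum.inl x) (Sum.inl y)) ∧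
      (∀ d, (Lo ⊔ Up).Adj (Sum.inl d.fst) (Sum.inr d)) ∧
      (∀ d, (Lo ⊔ Up).Adj (Sum.inr d) (Sum.inr d.symm)) ∧
      (∀ d, (sig R d = d ∨ (Lo ⊔ Up).Adj (Sum.inr d) (Sum.inr (sig R d))) ∨
        (sig R d = d.symm ∨ (Lo ⊔ Up).Adj (Sum.inr d.symm) (Sum.inr (sig R d)))) := by
  classical
  obtain ⟨m, hm, hsub, ht, hc⟩ := exists_tree (sig R) (alp R.G) (alp_inv R.G) (alp_ne R.G)
  obtain ⟨hN, hN1, hN2, htN⟩ := tree_compl (alp_inv R.G) (alp_ne R.G) hm hsub ht hc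
    ((isPlane_iff R).1 hR)
  set th := sig R * m with hth
  set n := m * alp R.G with hn
  obtain ⟨p, hp, hl1, hl2⟩ := exists_line th
  have hg := good_line hl1 hl2
  have hsm : th * m = sig R := Equiv.ext fun x => by
    rw [hth, Perm.mul_apply, Perm.mul_apply, hm x]
  have hg2 := good_tight hp m hm th hg ht
  rw [hsm] at hg2
  -- positions
  obtain ⟨k, ⟨e⟩⟩ := Finite.exists_equiv_fin W
  let mu : W → ℕ := fun x => sInf {i | ∃ d : R.G.Dart, d.fst = x ∧ p d = i}
  have hmu : ∀ d : R.G.Dart, ∃ d0 : R.G.Dart, d0.fst = d.fst ∧ p d0 = mu d.fst := by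
    intro d
    exact Nat.sInf_mem (s := {i | ∃ d' : R.G.Dart, d'.fst = d.fst ∧ p d' = i}) ⟨p d, d, rfl, rfl⟩
  have hmule : ∀ d : R.G.Dart, mu d.fst ≤ p d := fun d => Nat.sInf_le ⟨d, rfl, rfl⟩
  let qw : W → ℤ := fun x => if (∃ d : R.G.Dart, d.fst = x) then 2 * (mu x : ℤ) - 1 else
    - ((e x : ℕ) : ℤ) - 2
  let q : W ⊕ R.G.Dart → ℤ := Sum.elim qw (fun d => 2 * (p d : ℤ))
  have hqw : ∀ d : R.G.Dart, qw d.fst = 2 * (mu d.fst : ℤ) - 1 := by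
    intro d; simp only [qw]; rw [if_pos ⟨d, rfl⟩]
  have hqd : ∀ d : R.G.Dart, q (Sum.inr d) = 2 * (p d : ℤ) := fun d => rfl
  have hql : ∀ x, q (Sum.inl x) = qw x := fun d => rfl
  have hinj : Function.Injective q := by
    rintro (x | d) (y | d') h
    · simp only [hql, qw] at h
      split_ifs at h with h1 h2 h2
      · obtain ⟨d1, rfl⟩ := h1
        obtain ⟨d2, rfl⟩ := h2
        obtain ⟨d1', e1, e1'⟩ := hmu d1
        obtain ⟨d2', e2, e2'⟩ := hmu d2
        have : d1' = d2' := hp (by omega)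
        rw [← e1, ← e2, this]
      · omega
      · omega
      · have : (e x : ℕ) = e y := by omega
        rw [e.injective (Fin.ext this)]
    · simp only [hql, qw, hqd] at h
      split_ifs at h with h1
      · omega
      · omega
    · simp only [hql, qw, hqd] at h
      split_ifs at h with h1
      · omega
      · omega
    · rw [hqd, hqd] at h
      rw [hp (show p d = p d' by omega)]
  let Lo : SimpleGraph (W ⊕ R.G.Dart) := SimpleGraph.fromRel (fun a b =>
    (∃ d : R.G.Dart, a = Sum.inl d.fst ∧ b = Sum.inr d) ∨
    (∃ d : R.G.Dart, a = Sum.inr d ∧ b = Sum.inr (m d)))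
  let Up : SimpleGraph (W ⊕ R.G.Dart) := SimpleGraph.fromRel (fun a b =>
    (∃ d : R.G.Dart, a = Sum.inr d ∧ b = Sum.inr (th d)) ∨
    (∃ d : R.G.Dart, a = Sum.inr d ∧ b = Sum.inr (n d)))
  have hLo : ∀ a b, Lo.Adj a b → q a < q b →
      (∃ d : R.G.Dart, a = Sum.inl d.fst ∧ b = Sum.inr d) ∨
      (∃ d : R.G.Dart, a = Sum.inr d ∧ b = Sum.inr (m d)) := by
    rintro a b ⟨-, h | (⟨d, rfl, rfl⟩ | ⟨d, rfl, rfl⟩)⟩ hlt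
    · exact h
    · rw [hqd, hql, hqw] at hlt
      have := hmule d
      omega
    · right; exact ⟨m d, rfl, by rw [hm d]⟩
  have hUp : ∀ a b, Up.Adj a b → q a < q b →
      ∃ d d' : R.G.Dart, a = Sum.inr d ∧ b = Sum.inr d' ∧ th.SameCycle d d' ∧
        (p d' = p d + 1 ∨ (∀ c, th.SameCycle d c → p d ≤ p c ∧ p c ≤ p d') ∨ d' = n d) := by
    have hnc : ∀ d, th.SameCycle d (n d) := by
      intro d
      rcases hsub d with h | h
      · rw [hN1 d h]; exact hc d
      · rw [hN2 d h]
    rintro a b ⟨-, (⟨d, rfl, rfl⟩ | ⟨d, rfl, rfl⟩) | (⟨d, rfl, rfl⟩ | ⟨d, rfl, rfl⟩)⟩ hlt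
    · refine ⟨d, th d, rfl, rfl, by rw [Perm.sameCycle_apply_right], ?_⟩
      rcases hl1 d with h | h
      · left; exact h
      · have := h d (Perm.SameCycle.refl _ _)
        rw [hqd, hqd] at hlt
        omega
    · exact ⟨d, n d, rfl, rfl, hnc d, Or.inr (Or.inr rfl)⟩
    · refine ⟨th d, d, rfl, rfl, by rw [Perm.sameCycle_apply_left], ?_⟩
      rcases hl1 d with h | h
      · rw [hqd, hqd] at hlt
        omega
      · right; left
        intro c hc'
        exact h c (by rwa [Perm.sameCycle_apply_left] at hc')
    · exact ⟨n d, d, rfl, rfl, (hnc d).symm, Or.inr (Or.inr (hN d).symm)⟩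
  have hclass : ∀ d d' : R.G.Dart, d.fst = d'.fst → (sig R).SameCycle d d' :=
    fun d d' h => (sig_same_iff R d d').2 h
  have hcc : ∀ (a x y : R.G.Dart), p a < p (m a) → x.fst = y.fst → th.SameCycle a x →
      ((p a < p x ∧ p x ≤ p (m a)) ↔ (p a < p y ∧ p y ≤ p (m a))) := by
    intro a x y h1 h2 h3
    exact chord_class hp hm hg ht h1 (by rw [hsm]; exact hclass x y h2) h3
  have hthm : ∀ d, th.SameCycle d (m d) := by
    intro d
    rcases hsub d with h | h
    · rw [h]
    · rw [h]; exact hc d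
  refine ⟨q, Lo, Up, hinj, ?_, ?_, ?_, ?_, ?_, ?_, ?_⟩
  · intro a b c d hab hcd h1 h2 h3
    rcases hLo a b hab (h1.trans h2) with ⟨x, rfl, rfl⟩ | ⟨x, rfl, rfl⟩ <;>
    rcases hLo c d hcd (h2.trans h3) with ⟨y, rfl, rfl⟩ | ⟨y, rfl, rfl⟩
    · rw [hql, hqw] at h1
      rw [hql, hqw] at h1 h2
      rw [hqd] at h2 h3
      rw [hqd] at h3
      obtain ⟨x0, e1, e1'⟩ := hmu x
      obtain ⟨y0, e2, e2'⟩ := hmu y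
      have hxy : x.fst ≠ y.fst := by intro h; rw [h] at h1; omega
      have hne : p y0 ≠ p x := by
        intro h
        have := hp h
        rw [this] at e2
        exact hxy e2
      have := hg2.1.2 x0 y0 x y (by omega) (by omega) (by omega) (hclass _ _ e1) (hclass _ _ e2)
      rw [sig_same_iff] at this
      exact hxy (by rw [← e1, ← e2, this])
    · rw [hql, hqw] at h1
      simp only [hqd] at h1 h2 h3
      obtain ⟨x0, e1, e1'⟩ := hmu x
      have hyx : th.SameCycle y x := hl2 y x (m y) (hthm y) (by omega) (by omega)
      have := hcc y x x0 (by omega) e1.symm hyx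
      omega
    · rw [hql, hqw] at h1 h2
      simp only [hqd] at h1 h2 h3
      obtain ⟨y0, e1, e1'⟩ := hmu y
      by_cases hy : p y0 = p (m x)
      · have hyx : th.SameCycle x y0 := by rw [hp hy]; exact hthm x
        have := hcc x y0 y (by omega) e1 hyx
        omega
      · have hyx : th.SameCycle x y0 := hl2 x y0 (m x) (hthm x) (by omega) (by omega)
        have := hcc x y0 y (by omega) e1 hyx
        omega
    · simp only [hqd] at h1 h2 h3
      exact chord_chord hp hm hg ht (a := x) (c := y) (by omega) (by omega) (by omega)
  · intro a b c d hab hcd h1 h2 h3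
    obtain ⟨x, x', rfl, rfl, hx, hx'⟩ := hUp a b hab (h1.trans h2)
    obtain ⟨y, y', rfl, rfl, hy, hy'⟩ := hUp c d hcd (h2.trans h3)
    simp only [hqd] at h1 h2 h3
    rcases hx' with hx' | hx' | hx'
    · omega
    · have := hl2 x y x' hx (by omega) (by omega)
      have := hx' y' (this.trans hy)
      omega
    · rcases hy' with hy' | hy' | hy'
      · omega
      · have := hl2 y x' y' hy (by omega) (by omega)
        have := hy' x (this.trans hx.symm)
        omega
      · subst hx' hy'
        exact chord_chord hp hN hg htN (a := x) (c := y) (by omega) (by omega) (by omega)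
  · rintro x y ⟨-, (⟨d, h, h'⟩ | ⟨d, h, h'⟩) | (⟨d, h, h'⟩ | ⟨d, h, h'⟩)⟩ <;> simp at h h'
  · rintro x y ⟨-, (⟨d, h, h'⟩ | ⟨d, h, h'⟩) | (⟨d, h, h'⟩ | ⟨d, h, h'⟩)⟩ <;> simp at h h'
  · intro d
    left
    exact ⟨by simp, Or.inl (Or.inl ⟨d, rfl, rfl⟩)⟩
  · intro d
    have hne : (Sum.inr d : W ⊕ R.G.Dart) ≠ Sum.inr d.symm := by
      intro h; exact alp_ne R.G d (Sum.inr.inj h).symm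
    rcases hsub d with h | h
    · right
      exact ⟨hne, Or.inl (Or.inr ⟨d, rfl, by rw [hN1 d h]; rfl⟩)⟩
    · left
      exact ⟨hne, Or.inl (Or.inr ⟨d, rfl, by rw [h]; rfl⟩)⟩
  · intro d
    have key : ∀ d' : R.G.Dart, m d = d' → (sig R d = d' ∨
        (Lo ⊔ Up).Adj (Sum.inr d') (Sum.inr (sig R d))) := by
      intro d' h
      by_cases h' : sig R d = d'
      · left; exact h'
      · right; right
        refine ⟨fun h2 => h' (Sum.inr.inj h2).symm, Or.inl (Or.inl ⟨d', rfl, ?_⟩)⟩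
        rw [← h, ← hsm, Perm.mul_apply]
    rcases hsub d with h | h
    · left; exact key d h
    · right; exact key d.symm h

end Route
end WBW

namespace WBW
open Equiv
set_option linter.unusedSectionVars false
set_option linter.style.haveILetI false
set_option linter.unusedVariables false

section Geo

/-- `S` is a simple arc from `u` to `v` in the plane. -/
def IsArc (S : Set (ℝ × ℝ)) (u v : ℝ × ℝ) : Prop :=
  ∃ f : Path u v, Function.Injective f ∧ Set.range f = S

def IsArc0 (S : Set (ℝ × ℝ)) (u v : ℝ × ℝ) : Prop :=
  (S = {u} ∧ u = v) ∨ IsArc S u v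

theorem IsArc.join {S S' : Set (ℝ × ℝ)} {u v w : ℝ × ℝ} (h : IsArc S u v) (h' : IsArc0 S' v w)
    (hS : S ∩ S' ⊆ {v}) : IsArc (S ∪ S') u w := by
  rcases h' with ⟨rfl, rfl⟩ | ⟨f', hf', rfl⟩
  · obtain ⟨f, hf, rfl⟩ := h
    refine ⟨f, hf, ?_⟩
    symm
    rw [Set.union_eq_left, Set.singleton_subset_iff]
    exact ⟨1, f.target⟩
  · obtain ⟨f, hf, rfl⟩ := h
    refine ⟨f.trans f', ?_, Path.trans_range f f'⟩
    have hv : ∀ t t', f t = f' t' → t = 1 ∧ t' = 0 := by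
      intro t t' h
      have h1 : f t = v := hS ⟨⟨t, rfl⟩, ⟨t', h.symm⟩⟩
      refine ⟨hf (h1.trans f.target.symm), hf' ?_⟩
      rw [← h, h1, f'.source]
    intro s t hst
    rw [Path.trans_apply, Path.trans_apply] at hst
    apply Subtype.ext
    split_ifs at hst with h1 h2 h2
    · have := congrArg Subtype.val (hf hst)
      simp only at this
      linarith
    · obtain ⟨a, b⟩ := hv _ _ hst
      have a := congrArg Subtype.val a
      have b := congrArg Subtype.val b
      simp only [Set.Icc.coe_one, Set.Icc.coe_zero] at a b
      linarith
    · obtain ⟨a, b⟩ := hv _ _ hst.symm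
      have a := congrArg Subtype.val a
      have b := congrArg Subtype.val b
      simp only [Set.Icc.coe_one, Set.Icc.coe_zero] at a b
      linarith
    · have := congrArg Subtype.val (hf' hst)
      simp only at this
      linarith

/-- a parabola over the interval between `a` and `b` -/
def Par (s a b : ℝ) : Set (ℝ × ℝ) :=
  {z | z.1 ∈ Set.uIcc a b ∧ z.2 = s * ((z.1 - a) * (b - z.1))}

theorem par_isArc (s : ℝ) {a b : ℝ} (h : a ≠ b) : IsArc (Par s a b) (a, 0) (b, 0) := by
  let g : ℝ → ℝ × ℝ := fun t => (a + t * (b - a), s * ((t * (b - a)) * (b - (a + t * (b - a)))))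
  have hg : Continuous g := by fun_prop
  refine ⟨⟨⟨fun t => g t, by fun_prop⟩, ?_, ?_⟩, ?_, ?_⟩
  · simp [g]
  · simp [g]
  · intro t t' htt
    have h1 := congrArg Prod.fst htt
    apply Subtype.ext
    have h1 : a + (t : ℝ) * (b - a) = a + (t' : ℝ) * (b - a) := h1
    have h2 : b - a ≠ 0 := sub_ne_zero.2 h.symm
    exact mul_right_cancel₀ h2 (by linarith)
  · ext z
    constructor
    · rintro ⟨t, rfl⟩
      refine ⟨?_, ?_⟩
      · change a + (t : ℝ) * (b - a) ∈ _
        have h0 := t.2.1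
        have h1 := t.2.2
        rcases le_total a b with hab | hab
        · rw [Set.uIcc_of_le hab]; constructor <;> nlinarith
        · rw [Set.uIcc_of_ge hab]; constructor <;> nlinarith
      · change s * (((t : ℝ) * (b - a)) * (b - (a + (t : ℝ) * (b - a)))) =
          s * ((a + (t : ℝ) * (b - a) - a) * (b - (a + (t : ℝ) * (b - a))))
        ring
    · rintro ⟨h1, h2⟩
      have h3 : b - a ≠ 0 := sub_ne_zero.2 h.symm
      have ht : (z.1 - a) / (b - a) ∈ Set.Icc (0 : ℝ) 1 := by
        rcases le_total a b with hab | hab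
        · rw [Set.uIcc_of_le hab] at h1
          have : 0 < b - a := lt_of_le_of_ne (by linarith) h3.symm
          exact ⟨div_nonneg (by linarith [h1.1]) this.le, (div_le_one this).2 (by linarith [h1.2])⟩
        · rw [Set.uIcc_of_ge hab] at h1
          have : b - a < 0 := lt_of_le_of_ne (by linarith) h3
          exact ⟨div_nonneg_of_nonpos (by linarith [h1.2]) this.le,
            (div_le_one_of_neg this).2 (by linarith [h1.1])⟩
      refine ⟨⟨_, ht⟩, ?_⟩
      have e : (z.1 - a) / (b - a) * (b - a) = z.1 - a := div_mul_cancel₀ _ h3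
      apply Prod.ext
      · change a + (z.1 - a) / (b - a) * (b - a) = z.1
        rw [e]; ring
      · change s * (((z.1 - a) / (b - a) * (b - a)) * (b - (a + (z.1 - a) / (b - a) * (b - a)))) = z.2
        rw [e, h2]; ring

theorem par_comm (s a b : ℝ) : Par s a b = Par s b a := by
  ext z
  simp only [Par, Set.mem_ofPred_eq, Set.uIcc_comm a b]
  have : (z.1 - a) * (b - z.1) = (z.1 - b) * (a - z.1) := by ring
  rw [this]

theorem par_nonneg {s a b : ℝ} {z : ℝ × ℝ} (h : z ∈ Par s a b) : 0 ≤ (z.1 - a) * (b - z.1) := by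
  have h1 := h.1
  rcases le_total a b with hab | hab
  · rw [Set.uIcc_of_le hab] at h1
    exact mul_nonneg (by linarith [h1.1]) (by linarith [h1.2])
  · rw [Set.uIcc_of_ge hab] at h1
    exact mul_nonneg_of_nonpos_of_nonpos (by linarith [h1.2]) (by linarith [h1.1])

theorem par_zero {s a b : ℝ} (hs : s ≠ 0) {z : ℝ × ℝ} (h : z ∈ Par s a b) (h0 : z.2 = 0) :
    z.1 = a ∨ z.1 = b := by
  have h2 := h.2
  rw [h0] at h2
  rcases mul_eq_zero.1 h2.symm with h | h
  · exact absurd h hs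
  · rcases mul_eq_zero.1 h with h | h
    · left; linarith
    · right; linarith

theorem par_opp {s s' a b c d : ℝ} (hs : 0 < s) (hs' : s' < 0) {z : ℝ × ℝ} (h : z ∈ Par s a b)
    (h' : z ∈ Par s' c d) : z.2 = 0 := by
  have h1 := par_nonneg h
  have h2 := par_nonneg h'
  have e1 := h.2
  have e2 := h'.2
  nlinarith

/-- two different parabolas meet at most once -/
theorem par_subsingleton {s s' a b c d : ℝ} (hs : s = 1 ∨ s = -1) (hs' : s' = 1 ∨ s' = -1)
    (hne : s(a, b) ≠ s(c, d)) : (Par s a b ∩ Par s' c d).Subsingleton := by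
  have hne' : ¬ (a = c ∧ b = d) ∧ ¬ (a = d ∧ b = c) := by
    constructor
    · rintro ⟨rfl, rfl⟩; exact hne rfl
    · rintro ⟨rfl, rfl⟩; exact hne Sym2.eq_swap
  have hs0 : s ≠ 0 := by rcases hs with rfl | rfl <;> norm_num
  have hs0' : s' ≠ 0 := by rcases hs' with rfl | rfl <;> norm_num
  rintro z ⟨hz, hz'⟩ w ⟨hw, hw'⟩
  by_cases hss : s = s'
  · subst hss
    have e1 : (z.1 - a) * (b - z.1) = (z.1 - c) * (d - z.1) :=
      mul_left_cancel₀ hs0 (by rw [← hz.2, ← hz'.2])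
    have e2 : (w.1 - a) * (b - w.1) = (w.1 - c) * (d - w.1) :=
      mul_left_cancel₀ hs0 (by rw [← hw.2, ← hw'.2])
    have h1 : z.1 = w.1 := by
      by_contra hzw
      have h3 : (a + b - c - d) * (z.1 - w.1) = 0 := by linarith
      rcases mul_eq_zero.1 h3 with h3 | h3
      · have h4 : d = a + b - c := by linarith
        subst h4
        have h5 : (c - a) * (c - b) = 0 := by nlinarith
        rcases mul_eq_zero.1 h5 with h5 | h5
        · exact hne'.1 ⟨by linarith, by linarith⟩
        · exact hne'.2 ⟨by linarith, by linarith⟩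
      · exact hzw (by linarith)
    apply Prod.ext h1
    rw [hz.2, hw.2, h1]
  · have hz0 : z.2 = 0 ∧ w.2 = 0 := by
      rcases hs with rfl | rfl <;> rcases hs' with rfl | rfl
      · exact absurd rfl hss
      · exact ⟨par_opp one_pos (by norm_num) hz hz', par_opp one_pos (by norm_num) hw hw'⟩
      · exact ⟨par_opp one_pos (by norm_num) hz' hz, par_opp one_pos (by norm_num) hw' hw⟩
      · exact absurd rfl hss
    have a1 := par_zero hs0 hz hz0.1
    have a2 := par_zero hs0' hz' hz0.1
    have a3 := par_zero hs0 hw hz0.2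
    have a4 := par_zero hs0' hw' hz0.2
    have h1 : z.1 = w.1 := by
      grind
    exact Prod.ext h1 (hz0.1.trans hz0.2.symm)

theorem par_nest {s a b c d : ℝ} (hs : s ≠ 0) (hab : a < b) (hcd : c < d)
    (hne : ¬ (a = c ∧ b = d)) (h1 : ¬ (a < c ∧ c < b ∧ b < d)) (h2 : ¬ (c < a ∧ a < d ∧ d < b))
    {z : ℝ × ℝ} (h : z ∈ Par s a b) (h' : z ∈ Par s c d) : z.2 = 0 := by
  have e : (z.1 - a) * (b - z.1) = (z.1 - c) * (d - z.1) :=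
    mul_left_cancel₀ hs (by rw [← h.2, ← h'.2])
  have i1 := h.1
  have i2 := h'.1
  rw [Set.uIcc_of_le hab.le] at i1
  rw [Set.uIcc_of_le hcd.le] at i2
  obtain ⟨i1, i3⟩ := i1
  obtain ⟨i2, i4⟩ := i2
  have hz := h.2
  by_contra h0
  have k0 : (z.1 - a) * (b - z.1) ≠ 0 := by intro hh; rw [hz, hh, mul_zero] at h0; exact h0 rfl
  have k1 : (z.1 - c) * (d - z.1) ≠ 0 := by rw [← e]; exact k0
  have j1 : 0 < z.1 - a := lt_of_le_of_ne (by linarith) (fun hh => k0 (by rw [← hh, zero_mul]))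
  have j2 : 0 < b - z.1 := lt_of_le_of_ne (by linarith) (fun hh => k0 (by rw [← hh, mul_zero]))
  have j3 : 0 < z.1 - c := lt_of_le_of_ne (by linarith) (fun hh => k1 (by rw [← hh, zero_mul]))
  have j4 : 0 < d - z.1 := lt_of_le_of_ne (by linarith) (fun hh => k1 (by rw [← hh, mul_zero]))
  rcases lt_trichotomy a c with ac | ac | ac <;> rcases lt_trichotomy b d with bd | bd | bd
  · exact h1 ⟨ac, by linarith, bd⟩
  · subst bd; nlinarith [mul_pos (sub_pos.2 ac) j2]
  · nlinarith [mul_pos (sub_pos.2 ac) j2, mul_pos (sub_pos.2 bd) j3]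
  · subst ac; nlinarith [mul_pos (sub_pos.2 bd) j1]
  · exact hne ⟨ac, bd⟩
  · subst ac; nlinarith [mul_pos (sub_pos.2 bd) j1]
  · nlinarith [mul_pos (sub_pos.2 ac) j4, mul_pos (sub_pos.2 bd) j1]
  · subst bd; nlinarith [mul_pos (sub_pos.2 ac) j2]
  · exact h2 ⟨ac, by linarith, bd⟩

/-- noncrossing parabolas meet only in shared endpoints -/
theorem par_meet {s s' a b c d : ℝ} (hs : s = 1 ∨ s = -1) (hs' : s' = 1 ∨ s' = -1)
    (hab : a ≠ b) (hcd : c ≠ d) (hne : s(a, b) ≠ s(c, d))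
    (h1 : s = s' → ∀ x y x' y', s(x, y) = s(a, b) → s(x', y') = s(c, d) →
      ¬ (x < x' ∧ x' < y ∧ y < y') ∧ ¬ (x' < x ∧ x < y' ∧ y' < y))
    {z : ℝ × ℝ} (h : z ∈ Par s a b) (h' : z ∈ Par s' c d) :
    z.2 = 0 ∧ (z.1 = a ∨ z.1 = b) ∧ (z.1 = c ∨ z.1 = d) := by
  have hs0 : s ≠ 0 := by rcases hs with rfl | rfl <;> norm_num
  have hs0' : s' ≠ 0 := by rcases hs' with rfl | rfl <;> norm_num
  have hz : z.2 = 0 := by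
    by_cases hss : s = s'
    · subst hss
      have h1 := h1 rfl
      rcases lt_or_gt_of_ne hab with ab | ab <;> rcases lt_or_gt_of_ne hcd with cd | cd
      · exact par_nest hs0 ab cd (by rintro ⟨rfl, rfl⟩; exact hne rfl)
          (h1 a b c d rfl rfl).1 (h1 a b c d rfl rfl).2 h h'
      · rw [par_comm s c d] at h'
        exact par_nest hs0 ab cd (by rintro ⟨rfl, rfl⟩; exact hne Sym2.eq_swap)
          (h1 a b d c rfl Sym2.eq_swap).1 (h1 a b d c rfl Sym2.eq_swap).2 h h'
      · rw [par_comm s a b] at h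
        exact par_nest hs0 ab cd (by rintro ⟨rfl, rfl⟩; exact hne Sym2.eq_swap)
          (h1 b a c d Sym2.eq_swap rfl).1 (h1 b a c d Sym2.eq_swap rfl).2 h h'
      · rw [par_comm s a b] at h
        rw [par_comm s c d] at h'
        exact par_nest hs0 ab cd (by rintro ⟨rfl, rfl⟩; exact hne rfl)
          (h1 b a d c Sym2.eq_swap Sym2.eq_swap).1 (h1 b a d c Sym2.eq_swap Sym2.eq_swap).2 h h'
    · rcases hs with rfl | rfl <;> rcases hs' with rfl | rfl
      · exact absurd rfl hss
      · exact par_opp one_pos (by norm_num) h h'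
      · exact par_opp one_pos (by norm_num) h' h
      · exact absurd rfl hss
  exact ⟨hz, par_zero hs0 h hz, par_zero hs0' h' hz⟩

end Geo
end WBW

namespace WBW
open Equiv
set_option linter.unusedSectionVars false
set_option linter.style.haveILetI false
set_option linter.unusedVariables false

section Sph

noncomputable def vec3 (z : ℝ × ℝ) : EuclideanSpace ℝ (Fin 3) := !₂[z.1, z.2, 1]

theorem vec3_ne (z : ℝ × ℝ) : vec3 z ≠ 0 := by
  intro h
  have := congrArg (fun v : EuclideanSpace ℝ (Fin 3) => v 2) h
  simp [vec3] at this

theorem vec3_cont : Continuous vec3 := by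
  unfold vec3
  apply (PiLp.continuous_toLp 2 _).comp
  refine continuous_pi ?_
  intro i
  fin_cases i
  · exact continuous_fst
  · exact continuous_snd
  · exact continuous_const

/-- an embedding of the plane in the sphere -/
noncomputable def toSph (z : ℝ × ℝ) : unitSphere :=
  ⟨(‖vec3 z‖⁻¹ : ℝ) • vec3 z, by
    unfold unitSphere
    rw [mem_sphere_zero_iff_norm, norm_smul, norm_inv, norm_norm]
    exact inv_mul_cancel₀ (norm_ne_zero_iff.2 (vec3_ne z))⟩

theorem toSph_cont : Continuous toSph := by
  apply Continuous.subtype_mk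
  exact (Continuous.inv₀ vec3_cont.norm (fun z => norm_ne_zero_iff.2 (vec3_ne z))).smul vec3_cont

theorem toSph_inj : Function.Injective toSph := by
  intro z w h
  have h := congrArg Subtype.val h
  have h : (‖vec3 z‖⁻¹ : ℝ) • vec3 z = (‖vec3 w‖⁻¹ : ℝ) • vec3 w := h
  have h2 := congrArg (fun v : EuclideanSpace ℝ (Fin 3) => v 2) h
  have h0 := congrArg (fun v : EuclideanSpace ℝ (Fin 3) => v 0) h
  have h1 := congrArg (fun v : EuclideanSpace ℝ (Fin 3) => v 1) h
  have hz := norm_ne_zero_iff.2 (vec3_ne z)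
  simp only [PiLp.smul_apply, smul_eq_mul] at h0 h1 h2
  have e0 : ∀ z, (vec3 z) 0 = z.1 := fun z => rfl
  have e1 : ∀ z, (vec3 z) 1 = z.2 := fun z => rfl
  have e2 : ∀ z, (vec3 z) 2 = 1 := fun z => rfl
  rw [e2, e2, mul_one, mul_one] at h2
  rw [e0, e0, ← h2] at h0
  rw [e1, e1, ← h2] at h1
  exact Prod.ext (mul_left_cancel₀ (inv_ne_zero hz) h0) (mul_left_cancel₀ (inv_ne_zero hz) h1)

theorem planar_drawing {V : Type*} (G : SimpleGraph V) (k : ℕ) (u : V → ℝ × ℝ)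
    (hu : Function.Injective u) (S : Sym2 V → Set (ℝ × ℝ))
    (hS : ∀ e ∈ G.edgeSet, ∃ x y, e = s(x, y) ∧ IsArc (S e) (u x) (u y) ∧
      ∀ v, u v ∈ S e → v = x ∨ v = y)
    (hc : ∀ e ∈ G.edgeSet, {q : Sym2 V × (ℝ × ℝ) | q.1 ∈ G.edgeSet ∧ q.1 ≠ e ∧ q.2 ∈ S e ∧
      q.2 ∈ S q.1 ∧ q.2 ∉ Set.range u}.Finite ∧
      {q : Sym2 V × (ℝ × ℝ) | q.1 ∈ G.edgeSet ∧ q.1 ≠ e ∧ q.2 ∈ S e ∧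
      q.2 ∈ S q.1 ∧ q.2 ∉ Set.range u}.ncard ≤ k) : IsNearlyPlanar k G := by
  classical
  have hS' : ∀ e, ∃ f : C(Set.Icc (0 : ℝ) 1, ℝ × ℝ), e ∈ G.edgeSet → Function.Injective f ∧
      Set.range f = S e ∧ ∃ x y, e = s(x, y) ∧ f ⟨0, Set.mem_Icc.mpr (by norm_num)⟩ = u x ∧
        f ⟨1, Set.mem_Icc.mpr (by norm_num)⟩ = u y ∧ ∀ v, u v ∈ S e → v = x ∨ v = y := by
    intro e
    by_cases he : e ∈ G.edgeSet
    · obtain ⟨x, y, h1, ⟨f, hf, hf'⟩, h3⟩ := hS e he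
      exact ⟨f.toContinuousMap, fun _ => ⟨hf, hf', x, y, h1, f.source, f.target, h3⟩⟩
    · exact ⟨ContinuousMap.const _ (0, 0), fun h => absurd h he⟩
  choose f hf using hS'
  have hrange : ∀ e ∈ G.edgeSet,
      Set.range ((⟨toSph, toSph_cont⟩ : C(ℝ × ℝ, unitSphere)).comp (f e)) = toSph '' S e := by
    intro e he
    rw [← (hf e he).2.1, ContinuousMap.coe_comp, Set.range_comp]
    rfl
  obtain ⟨Dr, hD1, hD2⟩ : ∃ Dr : Drawing G, Dr.vmap = (fun v => toSph (u v)) ∧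
      Dr.arc = fun e => (⟨toSph, toSph_cont⟩ : C(ℝ × ℝ, unitSphere)).comp (f e) := by
    refine ⟨⟨fun v => toSph (u v), toSph_inj.comp hu,
      fun e => (⟨toSph, toSph_cont⟩ : C(ℝ × ℝ, unitSphere)).comp (f e), ?_, ?_, ?_⟩, rfl, rfl⟩
    · intro e he
      exact toSph_inj.comp (hf e he).1
    · intro e he
      obtain ⟨h1, h2, x, y, h3, h4, h5, h6⟩ := hf e he
      rw [ContinuousMap.comp_apply, ContinuousMap.comp_apply, h4, h5]
      conv_lhs => rw [h3]
      rfl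
    · rintro e he t ht0 ht1 ⟨v, hv⟩
      obtain ⟨h1, h2, x, y, h3, h4, h5, h6⟩ := hf e he
      have hv : u v = f e t := toSph_inj hv
      rcases h6 v (by rw [← h2]; exact ⟨t, hv.symm⟩) with rfl | rfl
      · have := h1 (hv.symm.trans h4.symm)
        exact ht0 (congrArg Subtype.val this)
      · have := h1 (hv.symm.trans h5.symm)
        exact ht1 (congrArg Subtype.val this)
  refine ⟨Dr, ?_⟩
  · intro e he
    have hsub : crossingSet Dr e ⊆
        (Prod.map id toSph) '' {q : Sym2 V × (ℝ × ℝ) | q.1 ∈ G.edgeSet ∧ q.1 ≠ e ∧ q.2 ∈ S e ∧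
          q.2 ∈ S q.1 ∧ q.2 ∉ Set.range u} := by
      rintro ⟨e', z⟩ ⟨h1, h2, h3, h4, h5⟩
      simp only [hD1, hD2] at h1 h2 h3 h4 h5
      rw [hrange e he] at h3
      rw [hrange e' h1] at h4
      obtain ⟨w, hw, rfl⟩ := h3
      obtain ⟨w', hw', hww⟩ := h4
      have := toSph_inj hww
      subst this
      refine ⟨(e', w'), ⟨h1, h2, hw, hw', ?_⟩, rfl⟩
      rintro ⟨v, hv⟩
      exact h5 ⟨v, congrArg toSph hv⟩
    obtain ⟨c1, c2⟩ := hc e he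
    refine ⟨(c1.image _).subset hsub, ?_⟩
    exact (Set.ncard_le_ncard hsub (c1.image _)).trans ((Set.ncard_image_le c1).trans c2)

end Sph
end WBW

namespace WBW
open Equiv
set_option linter.unusedSectionVars false
set_option linter.style.haveILetI false
set_option linter.unusedVariables false

section RD
variable {N : Type*}

open Classical in
/-- the page of an edge -/
noncomputable def sgn (Lo : SimpleGraph N) (a b : N) : ℝ := if Lo.Adj a b then -1 else 1

theorem sgn_or (Lo : SimpleGraph N) (a b : N) : sgn Lo a b = 1 ∨ sgn Lo a b = -1 := by
  unfold sgn; split_ifs <;> simp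

/-- order agreement of two placements on a pair of nodes -/
def Agree (q : N → ℤ) (P P' : N → ℝ) (n n' : N) : Prop :=
  (P n < P' n' ↔ q n < q n') ∧ (P' n' < P n ↔ q n' < q n)

theorem Agree.eq {q : N → ℤ} (hq : Function.Injective q) {P P' : N → ℝ} {n n' : N}
    (h : Agree q P P' n n') (he : P n = P' n') : n = n' := by
  apply hq
  have h1 : ¬ (q n < q n') := by rw [← h.1, he]; exact lt_irrefl _
  have h2 : ¬ (q n' < q n) := by rw [← h.2, he]; exact lt_irrefl _
  omega

theorem route_meet {q : N → ℤ} (hq : Function.Injective q) {Lo Up : SimpleGraph N}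
    (hLo : NoInter q Lo) (hUp : NoInter q Up) {P P' : N → ℝ} {a b c d : N}
    (hab : (Lo ⊔ Up).Adj a b) (hcd : (Lo ⊔ Up).Adj c d) (hne : s(a, b) ≠ s(c, d))
    (hP : P a ≠ P b) (hP' : P' c ≠ P' d)
    (h1 : Agree q P P' a c) (h2 : Agree q P P' a d) (h3 : Agree q P P' b c)
    (h4 : Agree q P P' b d) {z : ℝ × ℝ} (hz : z ∈ Par (sgn Lo a b) (P a) (P b))
    (hz' : z ∈ Par (sgn Lo c d) (P' c) (P' d)) :
    ∃ t, (t = a ∨ t = b) ∧ (t = c ∨ t = d) ∧ z = (P t, 0) ∧ P t = P' t := by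
  have hne' : s(P a, P b) ≠ s(P' c, P' d) := by
    intro h
    apply hne
    rw [Sym2.eq_iff] at h ⊢
    rcases h with ⟨e, e'⟩ | ⟨e, e'⟩
    · exact Or.inl ⟨h1.eq hq e, h4.eq hq e'⟩
    · exact Or.inr ⟨h2.eq hq e, h3.eq hq e'⟩
  have hI : sgn Lo a b = sgn Lo c d → ∃ E : SimpleGraph N, NoInter q E ∧ E.Adj a b ∧ E.Adj c d := by
    intro h
    unfold sgn at h
    split_ifs at h with h5 h6 h6
    · exact ⟨Lo, hLo, h5, h6⟩
    · norm_num at h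
    · norm_num at h
    · exact ⟨Up, hUp, hab.resolve_left h5, hcd.resolve_left h6⟩
  have key := par_meet (sgn_or Lo a b) (sgn_or Lo c d) hP hP' hne' (by
    intro hs x y x' y' hx hx'
    obtain ⟨E, hE, e1, e2⟩ := hI hs
    have e1' := e1.symm
    have e2' := e2.symm
    rw [Sym2.eq_iff] at hx hx'
    unfold Agree at h1 h2 h3 h4
    unfold NoInter at hE
    rcases hx with ⟨rfl, rfl⟩ | ⟨rfl, rfl⟩ <;> rcases hx' with ⟨rfl, rfl⟩ | ⟨rfl, rfl⟩
    · exact ⟨fun ⟨u, v, w⟩ => hE a b c d e1 e2 (h1.1.1 u) (h3.2.1 v) (h4.1.1 w),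
        fun ⟨u, v, w⟩ => hE c d a b e2 e1 (h1.2.1 u) (h2.1.1 v) (h4.2.1 w)⟩
    · exact ⟨fun ⟨u, v, w⟩ => hE a b d c e1 e2' (h2.1.1 u) (h4.2.1 v) (h3.1.1 w),
        fun ⟨u, v, w⟩ => hE d c a b e2' e1 (h2.2.1 u) (h1.1.1 v) (h3.2.1 w)⟩
    · exact ⟨fun ⟨u, v, w⟩ => hE b a c d e1' e2 (h3.1.1 u) (h1.2.1 v) (h2.1.1 w),
        fun ⟨u, v, w⟩ => hE c d b a e2 e1' (h3.2.1 u) (h4.1.1 v) (h2.2.1 w)⟩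
    · exact ⟨fun ⟨u, v, w⟩ => hE b a d c e1' e2' (h4.1.1 u) (h2.2.1 v) (h1.1.1 w),
        fun ⟨u, v, w⟩ => hE d c b a e2' e1' (h4.2.1 u) (h3.1.1 v) (h1.2.1 w)⟩) hz hz'
  obtain ⟨k0, k1, k2⟩ := key
  rcases k1 with k1 | k1 <;> rcases k2 with k2 | k2
  · exact ⟨a, Or.inl rfl, Or.inl (h1.eq hq (k1.symm.trans k2)), Prod.ext k1 k0, by
      rw [← k1, k2, h1.eq hq (k1.symm.trans k2)]⟩
  · exact ⟨a, Or.inl rfl, Or.inr (h2.eq hq (k1.symm.trans k2)), Prod.ext k1 k0, by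
      rw [← k1, k2, h2.eq hq (k1.symm.trans k2)]⟩
  · exact ⟨b, Or.inr rfl, Or.inl (h3.eq hq (k1.symm.trans k2)), Prod.ext k1 k0, by
      rw [← k1, k2, h3.eq hq (k1.symm.trans k2)]⟩
  · exact ⟨b, Or.inr rfl, Or.inr (h4.eq hq (k1.symm.trans k2)), Prod.ext k1 k0, by
      rw [← k1, k2, h4.eq hq (k1.symm.trans k2)]⟩

/-- union of the parabolas of a list of directed edges -/
def segs (Lo : SimpleGraph N) (P : N → ℝ) (L : List (N × N)) : Set (ℝ × ℝ) :=
  {z | ∃ d ∈ L, z ∈ Par (sgn Lo d.1 d.2) (P d.1) (P d.2)}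

theorem walk_arc {q : N → ℤ} (hq : Function.Injective q) {Lo Up : SimpleGraph N}
    (hLo : NoInter q Lo) (hUp : NoInter q Up) {P : N → ℝ}
    (hP : ∀ n n', Agree q P P n n') {a b : N} (w : (Lo ⊔ Up).Walk a b) (hw : w.IsPath) :
    IsArc0 ({(P a, 0)} ∪ segs Lo P (w.darts.map (fun d => d.toProd))) (P a, 0) (P b, 0) := by
  have hPi : ∀ a b, a ≠ b → P a ≠ P b := fun a b h h' => h ((hP a b).eq hq h')
  induction w with
  | nil =>
    left
    refine ⟨?_, rfl⟩
    simp [segs]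
  | @cons a c b h p ih =>
    right
    rw [SimpleGraph.Walk.cons_isPath_iff] at hw
    have ih := ih hw.1
    have h1 := par_isArc (sgn Lo a c) (hPi a c h.ne)
    have h2 := h1.join ih ?_
    · convert h2 using 1
      ext z
      simp only [segs, SimpleGraph.Walk.darts_cons, List.map_cons, List.mem_cons,
        Set.mem_union, Set.mem_singleton_iff, Set.mem_ofPred_eq, exists_eq_or_imp]
      have hl : (P a, (0 : ℝ)) ∈ Par (sgn Lo a c) (P a) (P c) := by
        refine ⟨Set.left_mem_uIcc, ?_⟩; simp
      have hr : (P c, (0 : ℝ)) ∈ Par (sgn Lo a c) (P a) (P c) := by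
        refine ⟨Set.right_mem_uIcc, ?_⟩; simp
      constructor
      · rintro (rfl | h | h)
        · exact Or.inl hl
        · exact Or.inl h
        · exact Or.inr (Or.inr h)
      · rintro (h | rfl | h)
        · exact Or.inr (Or.inl h)
        · exact Or.inr (Or.inl hr)
        · exact Or.inr (Or.inr h)
    · rintro z ⟨hz, hz' | ⟨d, hd, hz'⟩⟩
      · exact hz'
      · rw [List.mem_map] at hd
        obtain ⟨d, hd, rfl⟩ := hd
        have hf : d.fst ∈ p.support := p.dart_fst_mem_support_of_mem_darts hd
        have hs : d.snd ∈ p.support := p.dart_snd_mem_support_of_mem_darts hd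
        obtain ⟨t, ht, ht', rfl, -⟩ := route_meet hq hLo hUp (P := P) (P' := P) h d.adj
          (by
            intro he
            rw [Sym2.eq_iff] at he
            rcases he with ⟨e, -⟩ | ⟨e, -⟩
            · rw [e] at hw; exact hw.2 hf
            · rw [e] at hw; exact hw.2 hs)
          (hPi _ _ h.ne) (hPi _ _ d.adj.ne) (hP _ _) (hP _ _) (hP _ _) (hP _ _) hz hz'
        have : t = c := by
          rcases ht with rfl | rfl
          · rcases ht' with e | e
            · rw [e] at hw; exact absurd hf hw.2
            · rw [e] at hw; exact absurd hs hw.2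
          · rfl
        rw [this]; rfl

theorem walk_arc' {q : N → ℤ} (hq : Function.Injective q) {Lo Up : SimpleGraph N}
    (hLo : NoInter q Lo) (hUp : NoInter q Up) {P : N → ℝ}
    (hP : ∀ n n', Agree q P P n n') {a b : N} (w : (Lo ⊔ Up).Walk a b) (hw : w.IsPath)
    (hab : a ≠ b) :
    IsArc (segs Lo P (w.darts.map (fun d => d.toProd))) (P a, 0) (P b, 0) := by
  rcases walk_arc hq hLo hUp hP w hw with ⟨-, h⟩ | h
  · exact absurd ((hP a b).eq hq (congrArg Prod.fst h)) hab
  · convert h using 1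
    symm
    rw [Set.union_eq_right, Set.singleton_subset_iff]
    cases w with
    | nil => exact absurd rfl hab
    | @cons _ c _ h p =>
      refine ⟨(a, c), by simp, Set.left_mem_uIcc, ?_⟩
      simp

end RD
end WBW

namespace WBW
open Equiv
set_option linter.unusedSectionVars false
set_option linter.style.haveILetI false
set_option linter.unusedVariables false

section RD2
variable {V W D : Type*}

/-- placement of the nodes on the line, dart nodes being shifted by `ep` -/
def place (q : W ⊕ D → ℤ) (ep : ℝ) (n : W ⊕ D) : ℝ :=
  (q n : ℝ) + Sum.elim (fun _ => 0) (fun _ => ep) n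

theorem place_agree {q : W ⊕ D → ℤ} {ep ep' : ℝ} (h0 : 0 < ep) (h1 : ep < 1) (h0' : 0 < ep')
    (h1' : ep' < 1) (hq : Function.Injective q) (n n' : W ⊕ D)
    (h : n = n' → (∃ w, n = Sum.inl w) ∨ ep = ep') :
    Agree q (place q ep) (place q ep') n n' := by
  have hb : ∀ (n : W ⊕ D) (e : ℝ), 0 < e → e < 1 →
      0 ≤ Sum.elim (fun _ => 0) (fun _ => e) n ∧ Sum.elim (fun _ => 0) (fun _ => e) n < 1 := by
    rintro (w | d) e h1 h2
    · simp
    · exact ⟨h1.le, h2⟩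
  have b1 := hb n ep h0 h1
  have b2 := hb n' ep' h0' h1'
  unfold Agree place
  rcases lt_trichotomy (q n) (q n') with hl | hl | hl
  · have : (q n : ℝ) + 1 ≤ q n' := by exact_mod_cast hl
    exact ⟨⟨fun _ => hl, fun _ => by linarith⟩, ⟨fun hh => by linarith, fun hh => by omega⟩⟩
  · have hn := hq hl
    subst hn
    have : (Sum.elim (fun _ => 0) (fun _ => ep) n : ℝ) = Sum.elim (fun _ => 0) (fun _ => ep') n := by
      rcases h rfl with ⟨w, rfl⟩ | rfl
      · rfl
      · rfl
    rw [this]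
    simp
  · have : (q n' : ℝ) + 1 ≤ q n := by exact_mod_cast hl
    exact ⟨⟨fun hh => by linarith, fun hh => by omega⟩, ⟨fun _ => hl, fun _ => by linarith⟩⟩

theorem place_inr_ne {q : W ⊕ D → ℤ} {ep ep' : ℝ} (h0 : 0 < ep) (h1 : ep < 1) (h0' : 0 < ep')
    (h1' : ep' < 1) (hne : ep ≠ ep') (d : D) (n : W ⊕ D) :
    place q ep (Sum.inr d) ≠ place q ep' n := by
  intro h
  rcases n with w | d'
  · simp only [place, Sum.elim_inr, Sum.elim_inl, add_zero] at h
    have a1 : (q (Sum.inr d) : ℝ) < q (Sum.inl w) := by linarith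
    have a2 : (q (Sum.inl w) : ℝ) < q (Sum.inr d) + 1 := by linarith
    have a1 : q (Sum.inr d) < q (Sum.inl w) := by exact_mod_cast a1
    have a2 : q (Sum.inl w) < q (Sum.inr d) + 1 := by exact_mod_cast a2
    omega
  · simp only [place, Sum.elim_inr] at h
    have a1 : (q (Sum.inr d) : ℝ) < q (Sum.inr d') + 1 := by linarith
    have a2 : (q (Sum.inr d') : ℝ) < q (Sum.inr d) + 1 := by linarith
    have a1 : q (Sum.inr d) < q (Sum.inr d') + 1 := by exact_mod_cast a1
    have a2 : q (Sum.inr d') < q (Sum.inr d) + 1 := by exact_mod_cast a2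
    have : q (Sum.inr d) = q (Sum.inr d') := by omega
    rw [this] at h
    exact hne (by linarith)

theorem exists_shift (T : Type*) [Finite T] : ∃ ep : T → ℝ, Function.Injective ep ∧
    ∀ t, 0 < ep t ∧ ep t < 1 := by
  obtain ⟨k, ⟨e⟩⟩ := Finite.exists_equiv_fin T
  refine ⟨fun t => ((e t : ℕ) + 1 : ℝ) / (k + 1), ?_, ?_⟩
  · intro t t' h
    have h : ((e t : ℕ) + 1 : ℝ) / (k + 1) = ((e t' : ℕ) + 1 : ℝ) / (k + 1) := h
    have hk : ((k : ℝ) + 1) ≠ 0 := by positivity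
    rw [div_left_inj' hk] at h
    have : (e t : ℕ) = e t' := by exact_mod_cast (add_right_cancel h)
    exact e.injective (Fin.ext this)
  · intro t
    have := (e t).2
    have h2 : ((e t : ℕ) : ℝ) < k := by exact_mod_cast this
    refine ⟨by positivity, ?_⟩
    rw [div_lt_one (by positivity)]
    linarith

theorem route_drawing [Finite V] (G : SimpleGraph V) (tau : V → W) (htau : Function.Injective tau)
    (q : W ⊕ D → ℤ) (hq : Function.Injective q) (Lo Up : SimpleGraph (W ⊕ D))
    (hLo : NoInter q Lo) (hUp : NoInter q Up)
    (hnl : ∀ x y, ¬ (Lo ⊔ Up).Adj (Sum.inl x) (Sum.inl y)) (M K : ℕ) (supp : Sym2 V → Set D)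
    (hpi : ∀ e ∈ G.edgeSet, ∃ x y, e = s(x, y) ∧
      ∃ w : (Lo ⊔ Up).Walk (Sum.inl (tau x)) (Sum.inl (tau y)), w.IsPath ∧ w.length ≤ M ∧
        (∀ z, Sum.inl z ∈ w.support → z = tau x ∨ z = tau y) ∧
        (∀ d, Sum.inr d ∈ w.support → d ∈ supp e))
    (hK : ∀ e ∈ G.edgeSet, {e' | e' ∈ G.edgeSet ∧ (supp e ∩ supp e').Nonempty}.ncard ≤ K) :
    IsNearlyPlanar (K * (M * M)) G := by
  classical
  obtain ⟨ep, hepi, hep⟩ := exists_shift (Sym2 V)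
  let P : Sym2 V → W ⊕ D → ℝ := fun e => place q (ep e)
  have hag : ∀ e e' n n', (n = n' → (∃ w, n = Sum.inl w) ∨ e = e') → Agree q (P e) (P e') n n' :=
    fun e e' n n' h => place_agree (hep e).1 (hep e).2 (hep e').1 (hep e').2 hq n n'
      (fun hn => (h hn).imp_right (fun h => by rw [h]))
  have hPi : ∀ e a b, a ≠ b → P e a ≠ P e b :=
    fun e a b h h' => h ((hag e e a b (fun _ => Or.inr rfl)).eq hq h')
  -- the data of the routes
  have hdata : ∀ e, ∃ (x y : V) (L : List ((W ⊕ D) × (W ⊕ D))), e ∈ G.edgeSet → e = s(x, y) ∧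
      IsArc (segs Lo (P e) L) (P e (Sum.inl (tau x)), 0) (P e (Sum.inl (tau y)), 0) ∧
      L.length ≤ M ∧ ∀ d ∈ L, (Lo ⊔ Up).Adj d.1 d.2 ∧
        ∀ n, (n = d.1 ∨ n = d.2) → (∀ z, n = Sum.inl z → z = tau x ∨ z = tau y) ∧
          (∀ z, n = Sum.inr z → z ∈ supp e) := by
    intro e
    by_cases he : e ∈ G.edgeSet
    · obtain ⟨x, y, hxy, w, hw, hl, h1, h2⟩ := hpi e he
      have hne : x ≠ y := by
        rintro rfl
        rw [hxy] at he
        exact G.loopless.irrefl _ he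
      refine ⟨x, y, w.darts.map (fun d => d.toProd), fun _ => ⟨hxy, ?_, ?_, ?_⟩⟩
      · exact walk_arc' hq hLo hUp (fun n n' => hag e e n n' (fun _ => Or.inr rfl)) w hw
          (fun h => hne (htau (Sum.inl.inj h)))
      · simpa using hl
      · intro d hd
        rw [List.mem_map] at hd
        obtain ⟨d, hd, rfl⟩ := hd
        refine ⟨d.adj, ?_⟩
        intro n hn
        have hns : n ∈ w.support := by
          rcases hn with rfl | rfl
          · exact w.dart_fst_mem_support_of_mem_darts hd
          · exact w.dart_snd_mem_support_of_mem_darts hd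
        exact ⟨fun z hz => h1 z (hz ▸ hns), fun z hz => h2 z (hz ▸ hns)⟩
    · induction e using Sym2.ind with
      | _ x y => exact ⟨x, y, [], fun h => absurd h he⟩
  choose X Y L hL using hdata
  have hpl : ∀ e v, P e (Sum.inl (tau v)) = q (Sum.inl (tau v)) := by
    intro e v; simp [P, place]
  have hsne : ∀ e e', e ≠ e' → ∀ a b c d, (Lo ⊔ Up).Adj a b →
      s(P e a, P e b) ≠ s(P e' c, P e' d) := by
    intro e e' hee a b c d hab h
    have hee' : ep e ≠ ep e' := fun h => hee (hepi h)
    have hr : ∀ z n, P e (Sum.inr z) ≠ P e' n := fun z n =>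
      place_inr_ne (hep e).1 (hep e).2 (hep e').1 (hep e').2 hee' z n
    rw [Sym2.eq_iff] at h
    rcases a with a | a
    · rcases b with b | b
      · exact hnl _ _ hab
      · rcases h with h | h
        · exact hr _ _ h.2
        · exact hr _ _ h.2
    · rcases h with h | h
      · exact hr _ _ h.1
      · exact hr _ _ h.1
  refine planar_drawing G _ (fun v => ((q (Sum.inl (tau v)) : ℝ), 0)) ?_
    (fun e => segs Lo (P e) (L e)) ?_ ?_
  · intro v v' h
    have h := congrArg Prod.fst h
    have h : (q (Sum.inl (tau v)) : ℝ) = q (Sum.inl (tau v')) := h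
    exact htau (Sum.inl.inj (hq (by exact_mod_cast h)))
  · intro e he
    obtain ⟨h1, h2, h3, h4⟩ := hL e he
    refine ⟨X e, Y e, h1, ?_, ?_⟩
    · rw [hpl, hpl] at h2; exact h2
    · rintro v ⟨d, hd, hz⟩
      have hs0 : sgn Lo d.1 d.2 ≠ 0 := by rcases sgn_or Lo d.1 d.2 with h | h <;> rw [h] <;> norm_num
      have h5 := par_zero hs0 hz rfl
      have key : ∀ n, (n = d.1 ∨ n = d.2) → (q (Sum.inl (tau v)) : ℝ) = P e n → v = X e ∨ v = Y e := by
        intro n hn h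
        rw [← hpl e v] at h
        have := (hag e e _ _ (fun _ => Or.inr rfl)).eq hq h
        rcases ((h4 d hd).2 n hn).1 (tau v) this.symm with h6 | h6
        · exact Or.inl (htau h6)
        · exact Or.inr (htau h6)
      rcases h5 with h5 | h5
      · exact key _ (Or.inl rfl) h5
      · exact key _ (Or.inr rfl) h5
  · intro e he
    set C := {c : Sym2 V × (ℝ × ℝ) | c.1 ∈ G.edgeSet ∧ c.1 ≠ e ∧ c.2 ∈ segs Lo (P e) (L e) ∧
      c.2 ∈ segs Lo (P c.1) (L c.1) ∧
      c.2 ∉ Set.range (fun v => ((q (Sum.inl (tau v)) : ℝ), (0 : ℝ)))} with hC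
    set Ke := {e' | e' ∈ G.edgeSet ∧ (supp e ∩ supp e').Nonempty} with hKe
    obtain ⟨h1, h2, h3, h4⟩ := hL e he
    have hsh : ∀ c ∈ C, c.1 ∈ Ke := by
      rintro ⟨e', z⟩ ⟨c1, c2, ⟨d, hd, hz⟩, ⟨d', hd', hz'⟩, c5⟩
      simp only at c1 c2 hd' hz' c5
      refine ⟨c1, ?_⟩
      by_contra hno
      obtain ⟨h1', h2', h3', h4'⟩ := hL e' c1
      have hn : ∀ n n', (n = d.1 ∨ n = d.2) → (n' = d'.1 ∨ n' = d'.2) → n = n' →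
          ∃ w, n = Sum.inl w := by
        rintro n n' hn hn' rfl
        rcases n with w | z
        · exact ⟨w, rfl⟩
        · exact absurd ⟨z, ((h4 d hd).2 _ hn).2 z rfl, ((h4' d' hd').2 _ hn').2 z rfl⟩ hno
      have hag' : ∀ n n', (n = d.1 ∨ n = d.2) → (n' = d'.1 ∨ n' = d'.2) →
          Agree q (P e) (P e') n n' := fun n n' hh hh' =>
        hag e e' n n' (fun hnn => Or.inl (hn n n' hh hh' hnn))
      have hnee : s(d.1, d.2) ≠ s(d'.1, d'.2) := by
        intro hs
        rw [Sym2.eq_iff] at hs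
        rcases hs with ⟨e1, e2⟩ | ⟨e1, e2⟩
        · obtain ⟨w, hw⟩ := hn d.1 d'.1 (Or.inl rfl) (Or.inl rfl) e1
          obtain ⟨w', hw'⟩ := hn d.2 d'.2 (Or.inr rfl) (Or.inr rfl) e2
          have := (h4 d hd).1
          rw [hw, hw'] at this
          exact hnl _ _ this
        · obtain ⟨w, hw⟩ := hn d.1 d'.2 (Or.inl rfl) (Or.inr rfl) e1
          obtain ⟨w', hw'⟩ := hn d.2 d'.1 (Or.inr rfl) (Or.inl rfl) e2
          have := (h4 d hd).1
          rw [hw, hw'] at this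
          exact hnl _ _ this
      obtain ⟨t, ht, ht', rfl, -⟩ := route_meet hq hLo hUp (h4 d hd).1 (h4' d' hd').1 hnee
        (hPi e _ _ (h4 d hd).1.ne) (hPi e' _ _ (h4' d' hd').1.ne)
        (hag' _ _ (Or.inl rfl) (Or.inl rfl)) (hag' _ _ (Or.inl rfl) (Or.inr rfl))
        (hag' _ _ (Or.inr rfl) (Or.inl rfl)) (hag' _ _ (Or.inr rfl) (Or.inr rfl)) hz hz'
      · obtain ⟨w, rfl⟩ := hn t t ht ht' rfl
        apply c5
        rcases ((h4 d hd).2 _ ht).1 w rfl with rfl | rfl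
        · exact ⟨X e, by simp only [hpl]⟩
        · exact ⟨Y e, by simp only [hpl]⟩
    have hij : ∀ c : Sym2 V × (ℝ × ℝ), ∃ i j : ℕ, c ∈ C → i < M ∧ j < M ∧ ∃ d d',
        (L e)[i]? = some d ∧ (L c.1)[j]? = some d' ∧
        c.2 ∈ Par (sgn Lo d.1 d.2) (P e d.1) (P e d.2) ∧
        c.2 ∈ Par (sgn Lo d'.1 d'.2) (P c.1 d'.1) (P c.1 d'.2) := by
      intro c
      by_cases hc : c ∈ C
      · obtain ⟨c1, c2, ⟨d, hd, hz⟩, ⟨d', hd', hz'⟩, c5⟩ := hc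
        obtain ⟨i, hi, hi'⟩ := List.mem_iff_getElem.1 hd
        obtain ⟨j, hj, hj'⟩ := List.mem_iff_getElem.1 hd'
        refine ⟨i, j, fun _ => ⟨hi.trans_le h3, hj.trans_le (hL c.1 c1).2.2.1, d, d', ?_, ?_, hz, hz'⟩⟩
        · rw [List.getElem?_eq_getElem hi, hi']
        · rw [List.getElem?_eq_getElem hj, hj']
      · exact ⟨0, 0, fun h => absurd h hc⟩
    choose I J hIJ using hij
    let T : Set (Sym2 V × (ℕ × ℕ)) := Ke ×ˢ ((Set.Iio M) ×ˢ (Set.Iio M))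
    have hmaps : Set.MapsTo (fun c => (c.1, (I c, J c))) C T := by
      intro c hc
      exact ⟨hsh c hc, (hIJ c hc).1, (hIJ c hc).2.1⟩
    have hTf : T.Finite := (Set.toFinite Ke).prod ((Set.finite_Iio M).prod (Set.finite_Iio M))
    have hinj : Set.InjOn (fun c => (c.1, (I c, J c))) C := by
      rintro ⟨e1, z1⟩ hc1 ⟨e2, z2⟩ hc2 h
      obtain ⟨_, _, d1, d1', a1, a2, a3, a4⟩ := hIJ _ hc1
      obtain ⟨_, _, d2, d2', b1, b2, b3, b4⟩ := hIJ _ hc2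
      simp only [Prod.mk.injEq] at h a2 a3 a4 b2 b3 b4
      obtain ⟨rfl, hI, hJ⟩ := h
      rw [hI, b1] at a1
      rw [hJ, b2] at a2
      obtain rfl := Option.some.inj a1
      obtain rfl := Option.some.inj a2
      have hd : d2 ∈ L e := List.mem_of_getElem? b1
      have := par_subsingleton (sgn_or Lo d2.1 d2.2) (sgn_or Lo d2'.1 d2'.2)
        (hsne e e1 (Ne.symm hc1.2.1) _ _ d2'.1 d2'.2 (h4 d2 hd).1) ⟨a3, a4⟩ ⟨b3, b4⟩
      rw [this]
    refine ⟨Set.Finite.of_injOn hmaps hinj hTf, ?_⟩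
    refine (Set.ncard_le_ncard_of_injOn _ hmaps hinj hTf).trans ?_
    rw [Set.ncard_prod, Set.ncard_prod]
    have hM : (Set.Iio M).ncard = M := by
      rw [Set.ncard_eq_toFinset_card', Set.toFinset_Iio, Nat.card_Iio]
    rw [hM]
    exact Nat.mul_le_mul_right _ (hK e he)

end RD2
end WBW

namespace WBW
open Equiv
set_option linter.unusedSectionVars false
set_option linter.style.haveILetI false
set_option linter.unusedVariables false

section InW
variable {N : Type*}

/-- there is a walk between `a` and `b` inside `A` -/
def InW (g : SimpleGraph N) (A : Set N) (a b : N) : Prop :=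
  ∃ w : g.Walk a b, ∀ z ∈ w.support, z ∈ A

theorem InW.symm {g : SimpleGraph N} {A : Set N} {a b : N} (h : InW g A a b) : InW g A b a := by
  obtain ⟨w, hw⟩ := h
  exact ⟨w.reverse, fun z hz => hw z (by simpa using hz)⟩

theorem InW.trans {g : SimpleGraph N} {A : Set N} {a b c : N} (h : InW g A a b)
    (h' : InW g A b c) : InW g A a c := by
  obtain ⟨w, hw⟩ := h
  obtain ⟨w', hw'⟩ := h'
  refine ⟨w.append w', fun z hz => ?_⟩
  rw [SimpleGraph.Walk.mem_support_append_iff] at hz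
  exact hz.elim (hw z) (hw' z)

theorem InW.refl {g : SimpleGraph N} {A : Set N} {a : N} (h : a ∈ A) : InW g A a a :=
  ⟨SimpleGraph.Walk.nil, fun z hz => by simp at hz; exact hz ▸ h⟩

theorem InW.adj {g : SimpleGraph N} {A : Set N} {a b : N} (h : g.Adj a b) (ha : a ∈ A)
    (hb : b ∈ A) : InW g A a b :=
  ⟨SimpleGraph.Walk.cons h SimpleGraph.Walk.nil, fun z hz => by
    simp at hz
    rcases hz with rfl | rfl <;> assumption⟩

theorem InW.mono {g : SimpleGraph N} {A B : Set N} {a b : N} (h : InW g A a b) (hAB : A ⊆ B) :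
    InW g B a b := by
  obtain ⟨w, hw⟩ := h
  exact ⟨w, fun z hz => hAB (hw z hz)⟩

theorem InW.path {g : SimpleGraph N} {A : Set N} {a b : N} (h : InW g A a b) (hA : A.Finite) :
    ∃ w : g.Walk a b, w.IsPath ∧ w.length < A.ncard ∧ ∀ z ∈ w.support, z ∈ A := by
  classical
  obtain ⟨w, hw⟩ := h
  have h1 : ∀ z ∈ w.bypass.support, z ∈ A := fun z hz =>
    hw z (SimpleGraph.Walk.support_bypass_subset_support w hz)
  refine ⟨w.bypass, w.bypass_isPath, ?_, h1⟩
  have h2 := (w.bypass_isPath).support_nodup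
  have h3 := List.toFinset_card_of_nodup h2
  rw [SimpleGraph.Walk.length_support] at h3
  have h4 : (w.bypass.support.toFinset : Set N) ⊆ A := fun z hz => h1 z (by simpa using hz)
  have h5 := Set.ncard_le_ncard h4 hA
  rw [Set.ncard_coe_finset] at h5
  omega
end InW

section Att
variable {W : Type*} [Finite W]

theorem ncard_pair_le' {T : Type*} (a b : T) : ({a, b} : Set T).ncard ≤ 2 :=
  (Set.ncard_insert_le a {b}).trans (by simp)


theorem same_edge_inw {G : SimpleGraph W} {g : SimpleGraph (W ⊕ G.Dart)} {A : Set (W ⊕ G.Dart)}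
    (hs : ∀ d, g.Adj (Sum.inr d) (Sum.inr d.symm)) {d d' : G.Dart} (h : d.edge = d'.edge)
    (h1 : Sum.inr d ∈ A) (h2 : Sum.inr d' ∈ A) : InW g A (Sum.inr d) (Sum.inr d') := by
  rcases (SimpleGraph.dart_edge_eq_iff _ _).1 h with rfl | rfl
  · exact InW.refl h1
  · exact (InW.adj (hs _) h2 h1).symm

theorem rot_inw (R : RotationSystem W) {g : SimpleGraph (W ⊕ R.G.Dart)}
    {A : Set (W ⊕ R.G.Dart)}
    (hs : ∀ d, g.Adj (Sum.inr d) (Sum.inr d.symm))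
    (ht : ∀ d, (sig R d = d ∨ g.Adj (Sum.inr d) (Sum.inr (sig R d))) ∨
        (sig R d = d.symm ∨ g.Adj (Sum.inr d.symm) (Sum.inr (sig R d))))
    {v : W} {e f : Sym2 W} (he : e ∈ incidentSet R.G v) (h : R.rot v e = f)
    (hAe : ∀ d : R.G.Dart, d.edge = e → Sum.inr d ∈ A)
    (hAf : ∀ d : R.G.Dart, d.edge = f → Sum.inr d ∈ A)
    {d d' : R.G.Dart} (hd : d.edge = e) (hd' : d'.edge = f) :
    InW g A (Sum.inr d) (Sum.inr d') := by
  set d1 := dartOf R.G v e he with hd1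
  have e1 : d1.edge = e := dartOf_edge _ _ _ _
  have e2 : (sig R d1).edge = f := by rw [sig_edge, e1, hd1, dartOf_fst, h]
  have e3 : d1.symm.edge = e := by rw [SimpleGraph.Dart.edge_symm, e1]
  refine InW.trans ?_ (same_edge_inw hs (e2.trans hd'.symm) (hAf _ e2) (hAf _ hd'))
  rcases ht d1 with (h1 | h1) | (h1 | h1)
  · rw [h1]; exact same_edge_inw hs (hd.trans e1.symm) (hAe _ hd) (hAe _ e1)
  · exact (same_edge_inw hs (hd.trans e1.symm) (hAe _ hd) (hAe _ e1)).trans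
      (InW.adj h1 (hAe _ e1) (hAf _ e2))
  · rw [h1]; exact same_edge_inw hs (hd.trans e3.symm) (hAe _ hd) (hAe _ e3)
  · exact (same_edge_inw hs (hd.trans e3.symm) (hAe _ hd) (hAe _ e3)).trans
      (InW.adj h1 (hAe _ e3) (hAf _ e2))

theorem att_inw (R : RotationSystem W) {g : SimpleGraph (W ⊕ R.G.Dart)}
    {A : Set (W ⊕ R.G.Dart)}
    (hs : ∀ d, g.Adj (Sum.inr d) (Sum.inr d.symm))
    (ht : ∀ d, (sig R d = d ∨ g.Adj (Sum.inr d) (Sum.inr (sig R d))) ∨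
        (sig R d = d.symm ∨ g.Adj (Sum.inr d.symm) (Sum.inr (sig R d))))
    {e f : Sym2 W} (h : Attached R e f)
    (hAe : ∀ d : R.G.Dart, d.edge = e → Sum.inr d ∈ A)
    (hAf : ∀ d : R.G.Dart, d.edge = f → Sum.inr d ∈ A)
    {d d' : R.G.Dart} (hd : d.edge = e) (hd' : d'.edge = f) :
    InW g A (Sum.inr d) (Sum.inr d') := by
  obtain ⟨v, he, hf, h | h⟩ := h
  · exact rot_inw R hs ht he h hAe hAf hd hd'
  · exact (rot_inw R hs ht hf h hAf hAe hd' hd).symm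

theorem list_inw (R : RotationSystem W) {g : SimpleGraph (W ⊕ R.G.Dart)}
    {A : Set (W ⊕ R.G.Dart)}
    (hs : ∀ d, g.Adj (Sum.inr d) (Sum.inr d.symm))
    (ht : ∀ d, (sig R d = d ∨ g.Adj (Sum.inr d) (Sum.inr (sig R d))) ∨
        (sig R d = d.symm ∨ g.Adj (Sum.inr d.symm) (Sum.inr (sig R d)))) :
    ∀ (L : List (Sym2 W)) (e : Sym2 W), (e :: L).IsChain (Attached R) →
    (∀ f ∈ e :: L, f ∈ R.G.edgeSet) →
    (∀ d : R.G.Dart, d.edge ∈ e :: L → Sum.inr d ∈ A) →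
    ∀ d d' : R.G.Dart, d.edge = e → d'.edge ∈ e :: L → InW g A (Sum.inr d) (Sum.inr d') := by
  intro L
  induction L with
  | nil =>
    intro e _ _ hA d d' hd hd'
    simp only [List.mem_singleton] at hd'
    exact same_edge_inw hs (hd.trans hd'.symm) (hA _ (by simp [hd])) (hA _ (by simp [hd']))
  | cons f L ih =>
    intro e hc hE hA d d' hd hd'
    rw [List.isChain_cons_cons] at hc
    rcases List.mem_cons.1 hd' with h | h
    · exact same_edge_inw hs (hd.trans h.symm) (hA _ (by simp [hd])) (hA _ (by simp [h]))
    · have hfE := hE f (by simp)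
      obtain ⟨v, hve, hvf, -⟩ := id hc.1
      have h1 : (dartOf R.G v f hvf).edge = f := dartOf_edge _ _ _ _
      refine InW.trans (att_inw R hs ht hc.1 ?_ ?_ hd h1)
        (ih f hc.2 (fun x hx => hE x (List.mem_cons_of_mem _ hx))
          (fun x hx => hA x (List.mem_cons_of_mem _ hx)) _ d' h1 h)
      · intro x hx; exact hA x (by simp [hx])
      · intro x hx; exact hA x (by simp [hx])

theorem darts_card (G : SimpleGraph W) (L : List (Sym2 W)) :
    {d : G.Dart | d.edge ∈ L}.ncard ≤ 2 * L.length := by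
  induction L with
  | nil => simp
  | cons e L ih =>
    have h1 : {d : G.Dart | d.edge ∈ e :: L} ⊆ {d | d.edge = e} ∪ {d : G.Dart | d.edge ∈ L} := by
      intro d hd
      simpa using hd
    have h2 : {d : G.Dart | d.edge = e}.ncard ≤ 2 := by
      by_cases h : ∃ d : G.Dart, d.edge = e
      · obtain ⟨d, hd⟩ := h
        have : {d : G.Dart | d.edge = e} ⊆ {d, d.symm} := by
          intro x hx
          have hx' : x.edge = d.edge := by rw [hd]; exact hx
          simpa using (SimpleGraph.dart_edge_eq_iff _ _).1 hx'
        exact (Set.ncard_le_ncard this (Set.toFinite _)).trans (ncard_pair_le' _ _)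
      · have : {d : G.Dart | d.edge = e} = ∅ := by
          ext x; simp; exact fun hx => h ⟨x, hx⟩
        simp [this]
    have h3 := (Set.ncard_le_ncard h1 (Set.toFinite _)).trans (Set.ncard_union_le _ _)
    simp only [List.length_cons]
    omega

/-- path in the routing graph along a wbw-walk -/
theorem wbw_path (R : RotationSystem W) {g : SimpleGraph (W ⊕ R.G.Dart)}
    (hf : ∀ d, g.Adj (Sum.inl d.fst) (Sum.inr d))
    (hs : ∀ d, g.Adj (Sum.inr d) (Sum.inr d.symm))
    (ht : ∀ d, (sig R d = d ∨ g.Adj (Sum.inr d) (Sum.inr (sig R d))) ∨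
        (sig R d = d.symm ∨ g.Adj (Sum.inr d.symm) (Sum.inr (sig R d))))
    {x y : W} {L : List (Sym2 W)} (h : IsWbwWalkFromTo R x y L) :
    ∃ w : g.Walk (Sum.inl x) (Sum.inl y), w.IsPath ∧ w.length ≤ 2 * L.length + 2 ∧
      (∀ z, Sum.inl z ∈ w.support → z = x ∨ z = y) ∧
      (∀ d : R.G.Dart, Sum.inr d ∈ w.support → d.edge ∈ L) := by
  obtain ⟨⟨hne, hnd, hE, hc⟩, ⟨e, he, hxe⟩, ⟨f, hf', hyf⟩⟩ := h
  set A : Set (W ⊕ R.G.Dart) := {Sum.inl x, Sum.inl y} ∪ Sum.inr '' {d : R.G.Dart | d.edge ∈ L}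
    with hA
  have hAd : ∀ d : R.G.Dart, d.edge ∈ L → Sum.inr d ∈ A :=
    fun d hd => Or.inr ⟨d, hd, rfl⟩
  have heL : e ∈ L := List.mem_of_mem_head? (by simp [he])
  have hfL : f ∈ L := List.mem_of_getLast? hf'
  have h1 : InW g A (Sum.inl x) (Sum.inl y) := by
    have hd : (dartOf R.G x e ⟨hE e heL, hxe⟩).edge = e := dartOf_edge _ _ _ _
    have hd' : (dartOf R.G y f ⟨hE f hfL, hyf⟩).edge = f := dartOf_edge _ _ _ _
    have a1 : g.Adj (Sum.inl x) _ := hf (dartOf R.G x e ⟨hE e heL, hxe⟩)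
    have a2 : g.Adj (Sum.inl y) _ := hf (dartOf R.G y f ⟨hE f hfL, hyf⟩)
    refine (InW.adj a1 (Or.inl (by simp)) (hAd _ (by rw [hd]; exact heL))).trans
      (InW.trans ?_ (InW.adj a2 (Or.inl (by simp)) (hAd _ (by rw [hd']; exact hfL))).symm)
    cases L with
    | nil => simp at hne
    | cons e' L =>
      simp only [List.head?_cons, Option.some.injEq] at he
      subst he
      exact list_inw R hs ht L e' hc hE hAd _ _ hd (by rw [hd']; exact hfL)
  obtain ⟨w, hw, hl, hsup⟩ := h1.path (Set.toFinite _)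
  refine ⟨w, hw, ?_, ?_, ?_⟩
  · have h2 : A.ncard ≤ 2 + 2 * L.length := by
      refine (Set.ncard_union_le _ _).trans (add_le_add (ncard_pair_le' _ _) ?_)
      exact (Set.ncard_image_le (Set.toFinite _)).trans (darts_card R.G L)
    omega
  · intro z hz
    rcases hsup _ hz with h | ⟨d, _, h⟩
    · simpa using h
    · simp at h
  · intro d hd
    rcases hsup _ hd with h | ⟨d', h', h⟩
    · simp at h
    · simp only [Sum.inr.injEq] at h; exact h ▸ h'
end Att
end WBW

namespace WBW
open Equiv
set_option linter.unusedSectionVars false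
set_option linter.style.haveILetI false
set_option linter.unusedVariables false

section Ball
variable {W : Type*} [Finite W]

theorem Attached.symm {R : RotationSystem W} {e f : Sym2 W} (h : Attached R e f) :
    Attached R f e := by
  obtain ⟨v, h1, h2, h3⟩ := h
  exact ⟨v, h2, h1, h3.symm⟩

/-- edges attached to a set of edges -/
def nb (R : RotationSystem W) (S : Set (Sym2 W)) : Set (Sym2 W) :=
  S ∪ {f | ∃ e ∈ S, Attached R e f}

theorem nb_card (R : RotationSystem W) (S : Set (Sym2 W)) : (nb R S).ncard ≤ S.ncard * 5 := by
  have h : ∀ e : Sym2 W, ∃ F : Fin 5 → Sym2 W, F 0 = e ∧ ∀ f, Attached R e f → ∃ i, F i = f := by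
    intro e
    induction e using Sym2.ind with
    | _ a b =>
      refine ⟨![s(a, b), R.rot a s(a, b), (R.rot a)⁻¹ s(a, b), R.rot b s(a, b),
        (R.rot b)⁻¹ s(a, b)], rfl, ?_⟩
      rintro f ⟨v, h1, h2, h3⟩
      have hv : v = a ∨ v = b := by simpa using h1.2
      rcases hv with rfl | rfl <;> rcases h3 with h3 | h3
      · exact ⟨1, h3⟩
      · exact ⟨2, by simp [← h3]⟩
      · exact ⟨3, h3⟩
      · exact ⟨4, by simp [← h3]⟩
  choose F hF0 hF using h
  have h1 : nb R S ⊆ (fun p : Sym2 W × Fin 5 => F p.1 p.2) '' (S ×ˢ Set.univ) := by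
    rintro f (hf | ⟨e, he, hf⟩)
    · exact ⟨(f, 0), ⟨hf, trivial⟩, hF0 f⟩
    · obtain ⟨i, hi⟩ := hF e f hf
      exact ⟨(e, i), ⟨he, trivial⟩, hi⟩
  refine (Set.ncard_le_ncard h1 (Set.toFinite _)).trans ((Set.ncard_image_le (Set.toFinite _)).trans ?_)
  rw [Set.ncard_prod]
  simp

theorem nb_iter_card (R : RotationSystem W) (S : Set (Sym2 W)) (k : ℕ) :
    ((nb R)^[k] S).ncard ≤ S.ncard * 5 ^ k := by
  induction k with
  | zero => simp
  | succ k ih =>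
    rw [Function.iterate_succ_apply', pow_succ]
    have := nb_card R ((nb R)^[k] S)
    nlinarith

theorem nb_iter_mono (R : RotationSystem W) (S : Set (Sym2 W)) {k l : ℕ} (h : k ≤ l) :
    (nb R)^[k] S ⊆ (nb R)^[l] S := by
  induction l, h using Nat.le_induction with
  | base => exact subset_rfl
  | succ l _ ih =>
    rw [Function.iterate_succ_apply']
    exact ih.trans (fun x hx => Or.inl hx)

theorem chain_ball (R : RotationSystem W) : ∀ (L : List (Sym2 W)) (S : Set (Sym2 W)),
    L.IsChain (Attached R) → ∀ e ∈ L, e ∈ S → ∀ f ∈ L, f ∈ (nb R)^[L.length] S := by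
  intro L
  induction L with
  | nil => intro S _ e he; simp at he
  | cons a L ih =>
    intro S hc e he heS f hf
    cases L with
    | nil =>
      simp only [List.mem_singleton] at he hf
      subst he; subst hf
      exact Or.inl heS
    | cons b L =>
      rw [List.isChain_cons_cons] at hc
      rcases List.mem_cons.1 he with rfl | he2
      · rcases List.mem_cons.1 hf with rfl | hf
        · exact nb_iter_mono R S (Nat.zero_le _) heS
        · rw [List.length_cons, Function.iterate_succ_apply]
          exact ih (nb R S) hc.2 b (by simp) (Or.inr ⟨e, heS, hc.1⟩) f hf
      · rcases List.mem_cons.1 hf with rfl | hf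
        · rw [List.length_cons, Function.iterate_succ_apply']
          exact Or.inr ⟨b, ih S hc.2 e he2 heS b (by simp), hc.1.symm⟩
        · exact nb_iter_mono R S (by simp) (ih S hc.2 e he2 heS f hf)

theorem verts_card (B : Set (Sym2 W)) : {v | ∃ e ∈ B, v ∈ e}.ncard ≤ B.ncard * 2 := by
  have h : ∀ e : Sym2 W, ∃ F : Fin 2 → W, ∀ v ∈ e, ∃ i, F i = v := by
    intro e
    induction e using Sym2.ind with
    | _ a b =>
      refine ⟨![a, b], fun v hv => ?_⟩
      rcases Sym2.mem_iff.1 hv with rfl | rfl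
      · exact ⟨0, rfl⟩
      · exact ⟨1, rfl⟩
  choose F hF using h
  have h1 : {v | ∃ e ∈ B, v ∈ e} ⊆ (fun p : Sym2 W × Fin 2 => F p.1 p.2) '' (B ×ˢ Set.univ) := by
    rintro v ⟨e, he, hv⟩
    obtain ⟨i, hi⟩ := hF e v hv
    exact ⟨(e, i), ⟨he, trivial⟩, hi⟩
  refine (Set.ncard_le_ncard h1 (Set.toFinite _)).trans ((Set.ncard_image_le (Set.toFinite _)).trans ?_)
  rw [Set.ncard_prod]
  simp

theorem wbwDist_walk {R : RotationSystem W} {x y : W} {l : ℕ} (h : wbwDist R x y ≤ l) :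
    ∃ L, IsWbwWalkFromTo R x y L ∧ L.length ≤ l + 1 := by
  have hne : {n : ℕ∞ | ∃ L, IsWbwWalkFromTo R x y L ∧ (L.length : ℕ∞) = n}.Nonempty := by
    by_contra hne
    rw [Set.not_nonempty_iff_eq_empty] at hne
    unfold wbwDist at h
    rw [hne, sInf_empty] at h
    simp at h
  obtain ⟨L, hL, hl⟩ := csInf_mem hne
  refine ⟨L, hL, ?_⟩
  have h' : (L.length : ℕ∞) ≤ l := by rw [hl]; exact h
  have := Nat.cast_le.1 h'
  omega

theorem power_walk {V : Type*} {R : RotationSystem W} {l : ℕ} {G : SimpleGraph V} {tau : V → W}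
    (h : SubgraphVia G (R.power l) tau) (e : Sym2 V) (he : e ∈ G.edgeSet) :
    ∃ x y, e = s(x, y) ∧ ∃ L, IsWbwWalkFromTo R (tau x) (tau y) L ∧ L.length ≤ l + 1 := by
  induction e using Sym2.ind with
  | _ x y =>
    have h1 := h.2 x y he
    rcases h1 with h1 | h1
    · refine ⟨x, y, rfl, [s(tau x, tau y)], ⟨⟨by simp, by simp, ?_, ?_⟩, ?_, ?_⟩, by simp⟩
      · simpa using h1
      · exact List.isChain_singleton _
      · exact ⟨_, rfl, by simp⟩
      · exact ⟨_, rfl, by simp⟩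
    · rw [SimpleGraph.fromRel_adj] at h1
      rcases h1.2 with h2 | h2
      · exact ⟨x, y, rfl, wbwDist_walk h2⟩
      · exact ⟨y, x, Sym2.eq_swap, wbwDist_walk h2⟩

theorem flat_nearly {V : Type*} [Finite V] (G : SimpleGraph V) (l : ℕ) (h : IsFlat l G) :
    IsNearlyPlanar ((((l + 1) * 5 ^ (l + 1) * 2) * ((l + 1) * 5 ^ (l + 1) * 2)) *
      ((2 * (l + 1) + 2) * (2 * (l + 1) + 2))) G := by
  classical
  obtain ⟨W, hW, R, tau, hR, hsub⟩ := h
  obtain ⟨q, Lo, Up, hq, hLo, hUp, hnl, hnu, hf, hs, ht⟩ := routing R hR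
  have hdata : ∀ e : Sym2 V, ∃ x y, ∃ L : List (Sym2 W), e ∈ G.edgeSet →
      e = s(x, y) ∧ IsWbwWalkFromTo R (tau x) (tau y) L ∧ L.length ≤ l + 1 := by
    intro e
    by_cases he : e ∈ G.edgeSet
    · obtain ⟨x, y, h1, L, h2⟩ := power_walk hsub e he
      exact ⟨x, y, L, fun _ => ⟨h1, h2⟩⟩
    · induction e using Sym2.ind with
      | _ x y => exact ⟨x, y, [], fun h => absurd h he⟩
  choose X Y L hL using hdata
  refine route_drawing G tau hsub.1 q hq Lo Up hLo hUp
    (fun x y h => h.elim (hnl x y) (hnu x y)) _ _ (fun e => {d | d.edge ∈ L e}) ?_ ?_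
  · intro e he
    obtain ⟨h1, h2, h3⟩ := hL e he
    obtain ⟨w, hw, hl, ha, hb⟩ := wbw_path R hf hs ht h2
    exact ⟨X e, Y e, h1, w, hw, by omega, ha, hb⟩
  · intro e he
    set B := (nb R)^[l + 1] {f | f ∈ L e} with hB
    set U := {v | ∃ e ∈ B, v ∈ e} with hU
    have hBc : B.ncard ≤ (l + 1) * 5 ^ (l + 1) := by
      refine (nb_iter_card R _ _).trans (Nat.mul_le_mul_right _ ?_)
      have h1 : {f | f ∈ L e} = ((L e).toFinset : Set (Sym2 W)) := by ext; simp
      rw [h1, Set.ncard_coe_finset]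
      exact (List.toFinset_card_le _).trans (hL e he).2.2
    have hUc : U.ncard ≤ (l + 1) * 5 ^ (l + 1) * 2 :=
      (verts_card B).trans (Nat.mul_le_mul_right _ hBc)
    refine le_trans ?_ (Nat.mul_le_mul hUc hUc)
    rw [← Set.ncard_prod]
    refine Set.ncard_le_ncard_of_injOn (fun e' => (tau (X e'), tau (Y e'))) ?_ ?_ (Set.toFinite _)
    · rintro e' ⟨he', d, hd, hd'⟩
      obtain ⟨h1, ⟨⟨a1, a2, a3, a4⟩, ⟨f, hf1, hf2⟩, ⟨g, hg1, hg2⟩⟩, h3⟩ := hL e' he'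
      have hall : ∀ f ∈ L e', f ∈ B := fun f hf =>
        nb_iter_mono R _ h3 (chain_ball R (L e') _ a4 d.edge hd' hd f hf)
      exact ⟨⟨f, hall f (List.mem_of_mem_head? (by simp [hf1])), hf2⟩,
        ⟨g, hall g (List.mem_of_getLast? hg1), hg2⟩⟩
    · rintro a ⟨ha, -⟩ b ⟨hb, -⟩ hab
      simp only [Prod.mk.injEq] at hab
      rw [(hL a ha).1, (hL b hb).1, hsub.1 hab.1, hsub.1 hab.2]
end Ball
end WBW

namespace WBW
open Equiv
set_option linter.unusedSectionVars false
set_option linter.style.haveILetI false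
set_option linter.unusedVariables false

section Stages
variable {D W : Type*} [Finite D] [DecidableEq D]

/-- connections inside a fibre of the label -/
def lrel (l : D → W) (s a : Perm D) : D → D → Prop := fun x y => s x = y ∨ (l x = l y ∧ a x = y)

theorem lrel_same {l : D → W} {s a : Perm D} {x y : D} (h : s.SameCycle x y) :
    Quot.mk (lrel l s a) x = Quot.mk (lrel l s a) y := by
  refine sameCycle_map (p := s) (f := Quot.mk (lrel l s a)) ?_ h
  intro x
  symm
  exact Quot.sound (Or.inl rfl)

theorem lrel_trans {l : D → W} {s a s1 a1 : Perm D}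
    (h : ∀ x y, lrel l s a x y → Quot.mk (lrel l s1 a1) x = Quot.mk (lrel l s1 a1) y)
    (hl : ∀ x y, l x = l y → Quot.mk (lrel l s a) x = Quot.mk (lrel l s a) y) (x y : D)
    (hxy : l x = l y) : Quot.mk (lrel l s1 a1) x = Quot.mk (lrel l s1 a1) y :=
  congrArg (Quot.lift (Quot.mk (lrel l s1 a1)) h) (hl x y hxy)

theorem stage1 (l : D → W) : ∀ (k : ℕ) (s a : Perm D), Inv a → {x | a x ≠ x}.ncard ≤ k →
    (∀ x, l (s x) = l x) →
    (∀ x y, l x = l y → Quot.mk (lrel l s a) x = Quot.mk (lrel l s a) y) →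
    ∃ s' a' : Perm D, Inv a' ∧ df s' a' ≤ df s a ∧ (∀ x, l (s' x) = l x) ∧
      (∀ x y, l x = l y → s'.SameCycle x y) ∧ (∀ x, l (a x) ≠ l x → a' x = a x) := by
  intro k
  induction k with
  | zero =>
    intro s a ha hk hs hl
    have h0 : ∀ x, a x = x := by
      have := (Set.ncard_eq_zero (Set.toFinite _)).1 (Nat.le_zero.1 hk)
      intro x
      by_contra hx
      have h2 : x ∈ {x | a x ≠ x} := hx
      rw [this] at h2
      exact h2
    refine ⟨s, a, ha, le_rfl, hs, ?_, fun _ _ => rfl⟩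
    intro x y hxy
    rw [← qmk_iff]
    refine congrArg (Quot.lift (Quot.mk (prel s)) ?_) (hl x y hxy)
    rintro x y (h | ⟨-, h⟩)
    · exact Quot.sound h
    · rw [← h, h0]
  | succ k ih =>
    intro s a ha hk hs hl
    by_cases hex : ∃ c, a c ≠ c ∧ l (a c) = l c
    · obtain ⟨c, hc, hlc⟩ := hex
      have hcard := peel_card ha hc
      have hk' : {x | (a * swap c (a c)) x ≠ x}.ncard ≤ k := by omega
      have hkeep : ∀ x, l (a x) ≠ l x → (a * swap c (a c)) x = a x := by
        intro x hx
        rw [peel_apply ha, if_neg]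
        rintro (rfl | rfl)
        · exact hx hlc
        · rw [ha] at hx; exact hx hlc.symm
      have hlk : ∀ x, l ((a * swap c (a c)) x) ≠ l x ↔ l (a x) ≠ l x := by
        intro x
        rw [peel_apply ha]
        split_ifs with h
        · rcases h with rfl | rfl
          · simp [hlc]
          · simp [ha _, hlc]
        · rfl
      by_cases hsame : s.SameCycle c (a c)
      · obtain ⟨s', a', h1, h2, h3, h4, h5⟩ := ih s (a * swap c (a c)) (peel_inv ha c) hk' hs (by
          refine lrel_trans ?_ hl
          rintro x y (h | ⟨hxy, h⟩)
          · exact Quot.sound (Or.inl h)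
          · by_cases hx : x = c ∨ x = a c
            · apply lrel_same
              rcases hx with rfl | rfl
              · rw [← h]; exact hsame
              · rw [← h, ha]; exact hsame.symm
            · refine Quot.sound (Or.inr ⟨hxy, ?_⟩)
              rw [peel_apply ha, if_neg hx, h])
        exact ⟨s', a', h1, h2.trans (df_delete s ha hc), h3, h4, fun x hx =>
          (h5 x ((hlk x).2 hx)).trans (hkeep x hx)⟩
      · have hms := swap_merge_same hsame
        obtain ⟨s', a', h1, h2, h3, h4, h5⟩ := ih (s * swap c (a c)) (a * swap c (a c))
          (peel_inv ha c) hk' (by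
            intro x
            rw [Perm.mul_apply, hs]
            by_cases h1 : x = c
            · subst h1; simp [hlc]
            by_cases h2 : x = a c
            · subst h2; simp [hlc]
            rw [swap_apply_of_ne_of_ne h1 h2]) (by
          refine lrel_trans ?_ hl
          rintro x y (h | ⟨hxy, h⟩)
          · exact lrel_same (sameCycle_mul_swap_of_merge hms ⟨1, by simpa using h⟩)
          · by_cases hx : x = c ∨ x = a c
            · apply lrel_same
              rcases hx with rfl | rfl
              · rw [← h]; exact hms
              · rw [← h, ha]; exact hms.symm
            · refine Quot.sound (Or.inr ⟨hxy, ?_⟩)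
              rw [peel_apply ha, if_neg hx, h])
        exact ⟨s', a', h1, h2.trans (df_contract ha hsame), h3, h4, fun x hx =>
          (h5 x ((hlk x).2 hx)).trans (hkeep x hx)⟩
    · push Not at hex
      refine ⟨s, a, ha, le_rfl, hs, ?_, fun _ _ => rfl⟩
      intro x y hxy
      rw [← qmk_iff]
      refine congrArg (Quot.lift (Quot.mk (prel s)) ?_) (hl x y hxy)
      rintro x y (h | ⟨h', h⟩)
      · exact Quot.sound h
      · by_cases hx : a x = x
        · rw [← h, hx]
        · exact absurd (by rw [h, h']) (hex x hx)

theorem stage2 (s : Perm D) (K : D → Prop) : ∀ (k : ℕ) (a : Perm D), Inv a →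
    (∀ d, K (a d) ↔ K d) → {x | a x ≠ x ∧ ¬ K x}.ncard ≤ k →
    ∃ a' : Perm D, Inv a' ∧ df s a' ≤ df s a ∧ (∀ d, K d → a' d = a d) ∧ (∀ d, ¬ K d → a' d = d) := by
  intro k
  induction k with
  | zero =>
    intro a ha hK hk
    refine ⟨a, ha, le_rfl, fun _ _ => rfl, ?_⟩
    have := (Set.ncard_eq_zero (Set.toFinite _)).1 (Nat.le_zero.1 hk)
    intro x hKx
    by_contra hx
    have h2 : x ∈ {x | a x ≠ x ∧ ¬ K x} := ⟨hx, hKx⟩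
    rw [this] at h2
    exact h2
  | succ k ih =>
    intro a ha hK hk
    by_cases hex : ∃ c, a c ≠ c ∧ ¬ K c
    · obtain ⟨c, hc, hKc⟩ := hex
      have hlt : {x | (a * swap c (a c)) x ≠ x ∧ ¬ K x} ⊂ {x | a x ≠ x ∧ ¬ K x} := by
        refine ⟨?_, ?_⟩
        · rintro x ⟨h1, h2⟩
          refine ⟨?_, h2⟩
          rw [peel_apply ha] at h1
          split_ifs at h1 with h
          · exact absurd rfl h1
          · exact h1
        · intro hsub
          have h3 : c ∈ {x | (a * swap c (a c)) x ≠ x ∧ ¬ K x} := hsub ⟨hc, hKc⟩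
          have h4 := h3.1
          rw [peel_apply ha, if_pos (Or.inl rfl)] at h4
          exact h4 rfl
      have hlt' := Set.ncard_lt_ncard hlt (Set.toFinite _)
      obtain ⟨a', h1, h2, h3, h4⟩ := ih (a * swap c (a c)) (peel_inv ha c) (by
        intro d
        rw [peel_apply ha]
        split_ifs with h
        · rfl
        · exact hK d) (by omega)
      refine ⟨a', h1, h2.trans (df_delete s ha hc), ?_, h4⟩
      intro d hd
      rw [h3 d hd, peel_apply ha, if_neg]
      rintro (rfl | rfl)
      · exact hKc hd
      · exact hKc ((hK c).1 hd)
    · push Not at hex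
      exact ⟨a, ha, le_rfl, fun _ _ => rfl, fun d hd => by
        by_contra h; exact hd (hex d h)⟩

theorem stage3 (l : D → W) (a : Perm D) (ha : Inv a) : ∀ (k : ℕ) (s : Perm D),
    {d | a d = d ∧ s d ≠ d}.ncard ≤ k → (∀ x, l (s x) = l x) →
    (∀ x y, a x ≠ x → a y ≠ y → l x = l y → s.SameCycle x y) →
    ∃ s' : Perm D, df s' a ≤ df s a ∧ (∀ x, l (s' x) = l x) ∧
      (∀ x y, a x ≠ x → a y ≠ y → l x = l y → s'.SameCycle x y) ∧ (∀ d, a d = d → s' d = d) := by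
  intro k
  induction k with
  | zero =>
    intro s hk hs hl
    refine ⟨s, le_rfl, hs, hl, ?_⟩
    have := (Set.ncard_eq_zero (Set.toFinite _)).1 (Nat.le_zero.1 hk)
    intro x hKx
    by_contra hx
    have h2 : x ∈ {d | a d = d ∧ s d ≠ d} := ⟨hKx, hx⟩
    rw [this] at h2
    exact h2
  | succ k ih =>
    intro s hk hs hl
    by_cases hex : ∃ d, a d = d ∧ s d ≠ d
    · obtain ⟨d, hd, hsd⟩ := hex
      have hne : s⁻¹ d ≠ d := by
        intro h; apply hsd; conv_lhs => rw [← h]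
        simp
      set s1 := s * swap d (s⁻¹ d) with hs1
      have h1d : s1 d = d := by simp [hs1]
      have h1p : s1 (s⁻¹ d) = s d := by simp [hs1]
      have h1o : ∀ x, x ≠ d → x ≠ s⁻¹ d → s1 x = s x := fun x h h' => by
        rw [hs1, Perm.mul_apply, swap_apply_of_ne_of_ne h h']
      have hlt : {x | a x = x ∧ s1 x ≠ x} ⊂ {x | a x = x ∧ s x ≠ x} := by
        refine ⟨?_, ?_⟩
        · rintro x ⟨h1, h2⟩
          refine ⟨h1, ?_⟩
          by_cases hxd : x = d
          · subst hxd; exact hsd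
          by_cases hxp : x = s⁻¹ d
          · subst hxp; simpa using hne.symm
          · rwa [h1o x hxd hxp] at h2
        · intro hsub
          exact (hsub (show d ∈ {x | a x = x ∧ s x ≠ x} from ⟨hd, hsd⟩)).2 h1d
      have hlt' := Set.ncard_lt_ncard hlt (Set.toFinite _)
      have hlp : l (s⁻¹ d) = l d := by
        have := hs (s⁻¹ d); simpa using this.symm
      obtain ⟨s', h1, h2, h3, h4⟩ := ih s1 (by omega) (by
        intro x
        by_cases hxd : x = d
        · subst hxd; rw [h1d]
        by_cases hxp : x = s⁻¹ d
        · subst hxp; rw [h1p, hs, hlp]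
        · rw [h1o x hxd hxp, hs]) (by
        intro x y hx hy hxy
        have hxd : x ≠ d := fun h => hx (h ▸ hd)
        have hyd : y ≠ d := fun h => hy (h ▸ hd)
        let f : D → Quot (prel s1) := fun z => if z = d then Quot.mk _ (s⁻¹ d) else Quot.mk _ z
        have hf : ∀ z, f (s z) = f z := by
          intro z
          by_cases hzd : z = d
          · subst hzd
            simp only [f, if_neg hsd, if_true]
            symm
            exact Quot.sound h1p
          by_cases hzp : z = s⁻¹ d
          · subst hzp
            simp only [f, if_neg hne]
            simp
          · have h5 : s z ≠ d := fun h => hzp (by rw [← h]; simp)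
            simp only [f, if_neg h5, if_neg hzd]
            symm
            exact Quot.sound (h1o z hzd hzp)
        have := sameCycle_map hf (hl x y hx hy hxy)
        simp only [f, if_neg hxd, if_neg hyd] at this
        exact (qmk_iff _ _ _).1 this)
      exact ⟨s', h1.trans (df_dangle ha hd hsd), h2, h3, h4⟩
    · push Not at hex
      exact ⟨s, le_rfl, hs, hl, hex⟩
end Stages
end WBW

namespace WBW
open Equiv
set_option linter.unusedSectionVars false
set_option linter.style.haveILetI false
set_option linter.unusedVariables false

section Restr
variable {D D2 : Type*} [Finite D] [Finite D2]

theorem nq_restrict {P : D → Prop} (E : {d // P d} ≃ D2) (r : D → D → Prop) (r2 : D2 → D2 → Prop)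
    (h1 : ∀ x y, r x y → x = y ∨ ∃ (hx : P x) (hy : P y),
      Quot.mk r2 (E ⟨x, hx⟩) = Quot.mk r2 (E ⟨y, hy⟩))
    (h2 : ∀ u v, r2 u v → Quot.mk r (E.symm u).1 = Quot.mk r (E.symm v).1) :
    nq r = nq r2 + Nat.card {d // ¬ P d} := by
  classical
  unfold nq
  rw [← Nat.card_sum]
  refine Nat.card_congr ⟨Quot.lift (fun d => if h : P d then Sum.inl (Quot.mk r2 (E ⟨d, h⟩))
    else Sum.inr ⟨d, h⟩) ?_, Sum.elim (Quot.lift (fun u => Quot.mk r (E.symm u).1) h2)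
    (fun d => Quot.mk r d.1), ?_, ?_⟩
  · intro x y h
    rcases h1 x y h with rfl | ⟨hx, hy, h⟩
    · rfl
    · simp only [dif_pos hx, dif_pos hy, h]
  · rintro ⟨d⟩
    by_cases h : P d
    · simp [h]
    · simp [h]
  · rintro (⟨⟨u⟩⟩ | ⟨d, hd⟩)
    · simp [(E.symm u).2]
    · simp [hd]

theorem df_restrict [DecidableEq D] [DecidableEq D2] {P : D → Prop} (E : {d // P d} ≃ D2)
    (s a : Perm D) (s2 a2 : Perm D2)
    (hs : ∀ d, ¬ P d → s d = d) (ha : ∀ d, ¬ P d → a d = d)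
    (hs1 : ∀ d (h : P d), ∃ h' : P (s d), s2 (E ⟨d, h⟩) = E ⟨s d, h'⟩)
    (ha1 : ∀ d (h : P d), ∃ h' : P (a d), a2 (E ⟨d, h⟩) = E ⟨a d, h'⟩) : df s a = df s2 a2 := by
  have hs2 : ∀ u, (E.symm (s2 u)).1 = s (E.symm u).1 := by
    intro u
    obtain ⟨h', h⟩ := hs1 _ (E.symm u).2
    simp only [Subtype.coe_eta, Equiv.apply_symm_apply] at h
    rw [h]; simp
  have ha2 : ∀ u, (E.symm (a2 u)).1 = a (E.symm u).1 := by
    intro u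
    obtain ⟨h', h⟩ := ha1 _ (E.symm u).2
    simp only [Subtype.coe_eta, Equiv.apply_symm_apply] at h
    rw [h]; simp
  have e1 : zc s = zc s2 + Nat.card {d // ¬ P d} := by
    refine nq_restrict E _ _ ?_ ?_
    · rintro x y h
      have h : s x = y := h
      by_cases hx : P x
      · obtain ⟨h', h3⟩ := hs1 x hx
        subst h
        exact Or.inr ⟨hx, h', Quot.sound h3⟩
      · exact Or.inl (by rw [← h, hs x hx])
    · rintro u v h
      have h : s2 u = v := h
      refine Quot.sound ?_
      change s _ = _
      rw [← h, hs2]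
  have e2 : zc a = zc a2 + Nat.card {d // ¬ P d} := by
    refine nq_restrict E _ _ ?_ ?_
    · rintro x y h
      have h : a x = y := h
      by_cases hx : P x
      · obtain ⟨h', h3⟩ := ha1 x hx
        subst h
        exact Or.inr ⟨hx, h', Quot.sound h3⟩
      · exact Or.inl (by rw [← h, ha x hx])
    · rintro u v h
      have h : a2 u = v := h
      refine Quot.sound ?_
      change a _ = _
      rw [← h, ha2]
  have e3 : zc (s * a) = zc (s2 * a2) + Nat.card {d // ¬ P d} := by
    refine nq_restrict E _ _ ?_ ?_
    · rintro x y h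
      have h : s (a x) = y := h
      by_cases hx : P x
      · obtain ⟨h', h3⟩ := ha1 x hx
        obtain ⟨h'', h4⟩ := hs1 _ h'
        subst h
        refine Or.inr ⟨hx, h'', Quot.sound ?_⟩
        change s2 (a2 _) = _
        rw [h3, h4]
      · exact Or.inl (by rw [← h, ha x hx, hs x hx])
    · rintro u v h
      have h : s2 (a2 u) = v := h
      refine Quot.sound ?_
      change s (a _) = _
      rw [← h, hs2, ha2]
  have e4 : nq (crel s a) = nq (crel s2 a2) + Nat.card {d // ¬ P d} := by
    refine nq_restrict E _ _ ?_ ?_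
    · rintro x y (h | h)
      · by_cases hx : P x
        · obtain ⟨h', h3⟩ := hs1 x hx
          subst h
          exact Or.inr ⟨hx, h', Quot.sound (Or.inl h3)⟩
        · exact Or.inl (by rw [← h, hs x hx])
      · by_cases hx : P x
        · obtain ⟨h', h3⟩ := ha1 x hx
          subst h
          exact Or.inr ⟨hx, h', Quot.sound (Or.inr h3)⟩
        · exact Or.inl (by rw [← h, ha x hx])
    · rintro u v (h | h)
      · refine Quot.sound (Or.inl ?_)
        rw [← h, hs2]
      · refine Quot.sound (Or.inr ?_)
        rw [← h, ha2]
  have e5 : Nat.card D = Nat.card D2 + Nat.card {d // ¬ P d} := by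
    classical
    rw [← Nat.card_congr E, ← Nat.card_sum]
    exact (Nat.card_congr (Equiv.sumCompl P)).symm
  unfold df
  rw [e1, e2, e3, e4, e5]
  push_cast
  ring
end Restr

section Build
variable {W : Type*} [Finite W]

open Classical in
/-- rotation at `w` induced by a permutation of the darts -/
noncomputable def rotFun (H : SimpleGraph W) (s : Perm H.Dart) (w : W) (e : Sym2 W) : Sym2 W :=
  if h : e ∈ incidentSet H w then (s (dartOf H w e h)).edge else e

theorem rotFun_dart (H : SimpleGraph W) (s : Perm H.Dart) (d : H.Dart) :
    rotFun H s d.fst d.edge = (s d).edge := by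
  unfold rotFun
  rw [dif_pos (dart_mem_incident d)]
  congr 2
  exact dart_ext_edge rfl (dartOf_edge _ _ _ _)

theorem rotFun_mem (H : SimpleGraph W) (s : Perm H.Dart) (hs : ∀ d, (s d).fst = d.fst) (w : W)
    (e : Sym2 W) : rotFun H s w e ∈ incidentSet H w ↔ e ∈ incidentSet H w := by
  unfold rotFun
  by_cases h : e ∈ incidentSet H w
  · rw [dif_pos h]
    simp only [h, iff_true]
    have := dart_mem_incident (s (dartOf H w e h))
    rwa [hs] at this
  · rw [dif_neg h]

theorem rotFun_inj (H : SimpleGraph W) (s : Perm H.Dart) (hs : ∀ d, (s d).fst = d.fst) (w : W) :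
    Function.Injective (rotFun H s w) := by
  intro e f h
  have hm := rotFun_mem H s hs w e
  rw [h, rotFun_mem H s hs w f] at hm
  by_cases he : e ∈ incidentSet H w
  · have hf := hm.2 he
    unfold rotFun at h
    rw [dif_pos he, dif_pos hf] at h
    have h2 : s (dartOf H w e he) = s (dartOf H w f hf) := by
      refine dart_ext_edge ?_ h
      rw [hs, hs]; rfl
    have h3 := congrArg SimpleGraph.Dart.edge (s.injective h2)
    rwa [dartOf_edge, dartOf_edge] at h3
  · have hf : f ∉ incidentSet H w := fun h => he (hm.1 h)
    unfold rotFun at h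
    rwa [dif_neg he, dif_neg hf] at h

theorem build (H : SimpleGraph W) [DecidableEq H.Dart] (s : Perm H.Dart)
    (hs : ∀ d, (s d).fst = d.fst)
    (hc : ∀ d d' : H.Dart, d.fst = d'.fst → s.SameCycle d d') (hdf : df s (alp H) ≤ 0) :
    ∃ R : RotationSystem W, R.G = H ∧ R.IsPlane := by
  classical
  let R : RotationSystem W :=
    { G := H
      rot := fun w => Equiv.ofBijective _
        (Finite.injective_iff_bijective.1 (rotFun_inj H s hs w))
      rot_cycleOn := by
        intro w
        refine ⟨Equiv.bijOn _ (fun e => rotFun_mem H s hs w e), ?_⟩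
        intro e he f hf
        have h1 := hc (dartOf H w e he) (dartOf H w f hf) rfl
        obtain ⟨n, hn⟩ := h1.exists_nat_pow_eq
        refine ⟨n, ?_⟩
        have key : ∀ n : ℕ, ((s ^ n) (dartOf H w e he)).fst = w ∧
            ((Equiv.ofBijective _ (Finite.injective_iff_bijective.1 (rotFun_inj H s hs w))) ^ n) e
              = ((s ^ n) (dartOf H w e he)).edge := by
          intro n
          induction n with
          | zero => exact ⟨rfl, (dartOf_edge H w e he).symm⟩
          | succ n ih =>
            rw [pow_succ', Perm.mul_apply, pow_succ', Perm.mul_apply, ih.2, hs]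
            refine ⟨ih.1, ?_⟩
            have := rotFun_dart H s ((s ^ n) (dartOf H w e he))
            rw [ih.1] at this
            exact this
        rw [zpow_natCast, (key n).2, hn, dartOf_edge]
      rot_fixed := by
        intro w e he
        change rotFun H s w e = e
        unfold rotFun
        rw [dif_neg he] }
  refine ⟨R, rfl, ?_⟩
  rw [isPlane_iff]
  have h1 : sig R = s := by
    refine Equiv.ext fun d => ?_
    refine dart_ext_edge ?_ ?_
    · rw [sig_fst]; exact (hs d).symm
    · rw [sig_edge]; exact rotFun_dart H s d
  have h2 := df_nonneg (sig R) (alp R.G) (alp_inv R.G)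
  have h3 : df (sig R) (alp R.G) ≤ 0 := by
    rw [h1]; exact hdf
  omega
end Build

section Main
variable {D W : Type*} [Finite D] [Nonempty D] [DecidableEq D] [Finite W]

theorem exists_plane_of_labels (l : D → W) (s a : Perm D) (ha : Inv a) (hdf : df s a ≤ 0)
    (hs : ∀ x, l (s x) = l x)
    (hl : ∀ x y, l x = l y → Quot.mk (lrel l s a) x = Quot.mk (lrel l s a) y)
    (H : SimpleGraph W) (hH : ∀ u v, H.Adj u v → ∃ d, l d = u ∧ l (a d) = v) :
    ∃ R : RotationSystem W, R.G = H ∧ R.IsPlane := by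
  classical
  obtain ⟨s1, a1, i1, df1, hs1, hc1, hk1⟩ := stage1 l _ s a ha le_rfl hs hl
  have hch : ∀ e : Sym2 W, e ∈ H.edgeSet → ∃ d, s(l d, l (a1 d)) = e := by
    intro e
    induction e using Sym2.ind with
    | _ u v =>
      intro h
      have h : H.Adj u v := h
      obtain ⟨d, h1, h2⟩ := hH u v h
      refine ⟨d, ?_⟩
      rw [hk1 d (by rw [h1, h2]; exact h.ne'), h1, h2]
  choose! c hc using hch
  set K : D → Prop := fun d => ∃ e ∈ H.edgeSet, d = c e ∨ d = a1 (c e) with hK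
  obtain ⟨a2, i2, df2, hk2, hn2⟩ := stage2 s1 K _ a1 i1 (by
    intro d
    constructor
    · rintro ⟨e, he, h | h⟩
      · exact ⟨e, he, Or.inr (by rw [← h, i1])⟩
      · exact ⟨e, he, Or.inl (a1.injective h)⟩
    · rintro ⟨e, he, h | h⟩
      · exact ⟨e, he, Or.inr (by rw [← h])⟩
      · exact ⟨e, he, Or.inl (by rw [h, i1])⟩) le_rfl
  obtain ⟨s3, df3, hs3, hc3, hn3⟩ := stage3 l a2 i2 _ s1 le_rfl hs1 (fun x y _ _ h => hc1 x y h)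
  -- labels of darts in K
  have hKl : ∀ d, K d → ∃ e ∈ H.edgeSet, s(l d, l (a2 d)) = e ∧ (d = c e ∨ d = a1 (c e)) := by
    rintro d hd
    obtain ⟨e, he, h⟩ := id hd
    refine ⟨e, he, ?_, h⟩
    rw [hk2 d hd]
    rcases h with h | h
    · rw [h, hc e he]
    · rw [h, i1, Sym2.eq_swap, hc e he]
  have hKadj : ∀ d, K d → H.Adj (l d) (l (a2 d)) := by
    intro d hd
    obtain ⟨e, he, h, -⟩ := hKl d hd
    rw [← h] at he; exact he
  have hP : ∀ d, a2 d ≠ d ↔ K d := by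
    intro d
    constructor
    · intro h; by_contra hd; exact h (hn2 d hd)
    · intro h h2
      have := (hKadj d h).ne
      rw [h2] at this; exact this rfl
  have hPa : ∀ d, a2 d ≠ d → a2 (a2 d) ≠ a2 d := fun d h h2 => h (a2.injective h2)
  have hPs : ∀ d, a2 d ≠ d → a2 (s3 d) ≠ s3 d := fun d h h2 => h (by
    have h4 := s3.injective (hn3 _ h2)
    rwa [h4] at h2)
  let f : {d // a2 d ≠ d} → H.Dart := fun d => ⟨(l d.1, l (a2 d.1)), hKadj d.1 ((hP d.1).1 d.2)⟩
  have hf : Function.Bijective f := by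
    constructor
    · rintro ⟨d, hd⟩ ⟨d', hd'⟩ h
      have h := congrArg SimpleGraph.Dart.toProd h
      simp only [f, Prod.mk.injEq] at h
      obtain ⟨e, he, h1, h2⟩ := hKl d ((hP d).1 hd)
      obtain ⟨e', he', h1', h2'⟩ := hKl d' ((hP d').1 hd')
      have hee : e = e' := by rw [← h1, ← h1', h.1, h.2]
      subst hee
      apply Subtype.ext
      change d = d'
      have hcne : l (c e) ≠ l (a1 (c e)) := by
        intro h5
        have h6 := hc e he
        rw [h5] at h6
        rw [← h6] at he
        exact H.irrefl he
      rcases h2 with rfl | rfl <;> rcases h2' with rfl | rfl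
      · rfl
      · exact absurd h.1 hcne
      · exact absurd h.1.symm hcne
      · rfl
    · rintro ⟨⟨u, v⟩, huv⟩
      have he : s(u, v) ∈ H.edgeSet := huv
      have h1 := hc _ he
      have k1 : K (c s(u, v)) := ⟨_, he, Or.inl rfl⟩
      have k2 : K (a1 (c s(u, v))) := ⟨_, he, Or.inr rfl⟩
      have e1 := hk2 _ k1
      have e2 := hk2 _ k2
      rw [i1] at e2
      rcases Sym2.eq_iff.1 h1 with ⟨h2, h3⟩ | ⟨h2, h3⟩
      · refine ⟨⟨c s(u, v), (hP _).2 k1⟩, ?_⟩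
        apply SimpleGraph.Dart.ext
        simp only [f, e1, h2, h3]
      · refine ⟨⟨a1 (c s(u, v)), (hP _).2 k2⟩, ?_⟩
        apply SimpleGraph.Dart.ext
        simp only [f, e2, h2, h3]
  let E := Equiv.ofBijective f hf
  let s4 : Perm {d // a2 d ≠ d} := s3.subtypePerm (by
    intro d
    refine ⟨fun h => ?_, hPs d⟩
    intro h2
    exact h (by rw [hn3 d h2]; exact h2))
  let s5 : Perm H.Dart := (E.symm.trans s4).trans E
  have hs5 : ∀ x, s5 (E x) = E (s4 x) := fun x => by simp [s5]
  have hfst : ∀ x, (E x).fst = l x.1 := fun x => rfl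
  have hdf5 : df s3 a2 = df s5 (alp H) := by
    refine df_restrict (P := fun d => a2 d ≠ d) E s3 a2 s5 (alp H) ?_ ?_ ?_ ?_
    · intro d hd; exact hn3 d (not_not.1 hd)
    · intro d hd; exact not_not.1 hd
    · intro d hd
      exact ⟨hPs d hd, hs5 ⟨d, hd⟩⟩
    · intro d hd
      refine ⟨hPa d hd, ?_⟩
      apply SimpleGraph.Dart.ext
      change (l (a2 d), l d) = (l (a2 d), l (a2 (a2 d)))
      rw [i2]
  refine build H s5 ?_ ?_ (by rw [← hdf5]; exact df3.trans (df2.trans (df1.trans hdf)))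
  · intro d
    obtain ⟨x, rfl⟩ := E.surjective d
    rw [hs5, hfst, hfst]
    exact hs3 x.1
  · intro d d' h
    obtain ⟨x, rfl⟩ := E.surjective d
    obtain ⟨y, rfl⟩ := E.surjective d'
    rw [hfst, hfst] at h
    obtain ⟨n, hn⟩ := (hc3 x.1 y.1 x.2 y.2 h).exists_nat_pow_eq
    refine ⟨n, ?_⟩
    have key : ∀ n : ℕ, (s5 ^ n) (E x) = E ((s4 ^ n) x) ∧ ((s4 ^ n) x).1 = (s3 ^ n) x.1 := by
      intro n
      induction n with
      | zero => exact ⟨rfl, rfl⟩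
      | succ n ih =>
        rw [pow_succ', Perm.mul_apply, pow_succ', Perm.mul_apply, pow_succ', Perm.mul_apply, ih.1,
          hs5, ← ih.2]
        exact ⟨rfl, rfl⟩
    rw [zpow_natCast, (key n).1]
    congr 1
    exact Subtype.ext ((key n).2.trans hn)
end Main
end WBW

namespace WBW
open Equiv
set_option linter.unusedSectionVars false
set_option linter.style.haveILetI false
set_option linter.unusedVariables false

section Grid

/-- darts of the grid -/
abbrev GD (N : ℕ) := Fin N × Fin N × Fin 4

/-- reversal of darts in the grid (boundary darts are dangling) -/
def galf (N : ℕ) : GD N → GD N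
  | (i, j, 0) => if h : i.1 + 1 < N then (⟨i.1 + 1, h⟩, j, 2) else (i, j, 0)
  | (i, j, 1) => if h : j.1 + 1 < N then (i, ⟨j.1 + 1, h⟩, 3) else (i, j, 1)
  | (i, j, 2) => if h : 0 < i.1 then (⟨i.1 - 1, by omega⟩, j, 0) else (i, j, 2)
  | (i, j, 3) => if h : 0 < j.1 then (i, ⟨j.1 - 1, by omega⟩, 1) else (i, j, 3)

theorem galf_inv (N : ℕ) (d : GD N) : galf N (galf N d) = d := by
  obtain ⟨⟨i, hi⟩, ⟨j, hj⟩, k⟩ := d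
  fin_cases k
  · by_cases h : i + 1 < N <;> simp [galf, h]
  · by_cases h : j + 1 < N <;> simp [galf, h]
  · by_cases h : 0 < i
    · have : i - 1 + 1 = i := by omega
      simp [galf, h, this, hi]
    · simp [galf, h]
  · by_cases h : 0 < j
    · have : j - 1 + 1 = j := by omega
      simp [galf, h, this, hj]
    · simp [galf, h]

/-- reversal as a permutation -/
def gal (N : ℕ) : Perm (GD N) := ⟨galf N, galf N, galf_inv N, galf_inv N⟩

/-- rotation in the grid -/
def gsi (N : ℕ) : Perm (GD N) :=
  ⟨fun d => (d.1, d.2.1, d.2.2 + 1), fun d => (d.1, d.2.1, d.2.2 - 1), fun d => by simp,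
    fun d => by simp⟩

theorem zc_ge {D X : Type*} [Finite D] (p : Perm D) (f : D → X) (hf : ∀ d, f (p d) = f d)
    (hs : Function.Surjective f) : Nat.card X ≤ zc p := by
  refine Nat.card_le_card_of_surjective (Quot.lift f ?_) ?_
  · intro a b h
    have h : p a = b := h
    rw [← h, hf]
  · intro x
    obtain ⟨d, rfl⟩ := hs x
    exact ⟨Quot.mk _ d, rfl⟩

theorem gsi_zc (N : ℕ) : N * N ≤ zc (gsi N) := by
  have := zc_ge (gsi N) (fun d => (d.1, d.2.1)) (fun d => rfl) (fun x => ⟨(x.1, x.2, 0), rfl⟩)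
  simpa using this

/-- the wall crossed by a dart -/
def wall (N : ℕ) : GD N → (Fin (N + 1) × Fin N) ⊕ (Fin N × Fin (N + 1))
  | (i, j, 0) => Sum.inl (i.succ, j)
  | (i, j, 1) => Sum.inr (i, j.succ)
  | (i, j, 2) => Sum.inl (i.castSucc, j)
  | (i, j, 3) => Sum.inr (i, j.castSucc)

theorem gal_zc (N : ℕ) (hN : 0 < N) : (N + 1) * N + N * (N + 1) ≤ zc (gal N) := by
  have := zc_ge (gal N) (wall N) ?_ ?_
  · simpa using this
  · rintro ⟨⟨i, hi⟩, ⟨j, hj⟩, k⟩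
    change wall N (galf N _) = _
    fin_cases k
    · by_cases h : i + 1 < N <;> simp [galf, wall, h]
    · by_cases h : j + 1 < N <;> simp [galf, wall, h]
    · by_cases h : 0 < i
      · have : i - 1 + 1 = i := by omega
        simp [galf, wall, h, this]
      · simp [galf, wall, h]
    · by_cases h : 0 < j
      · have : j - 1 + 1 = j := by omega
        simp [galf, wall, h, this]
      · simp [galf, wall, h]
  · rintro (⟨⟨i, hi⟩, j⟩ | ⟨i, ⟨j, hj⟩⟩)
    · by_cases h : i < N
      · exact ⟨(⟨i, h⟩, j, 2), rfl⟩
      · refine ⟨(⟨N - 1, by omega⟩, j, 0), ?_⟩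
        have : N - 1 + 1 = i := by omega
        simp [wall, this]
    · by_cases h : j < N
      · exact ⟨(i, ⟨j, h⟩, 3), rfl⟩
      · refine ⟨(i, ⟨N - 1, by omega⟩, 1), ?_⟩
        have : N - 1 + 1 = j := by omega
        simp [wall, this]

/-- the corner to the right of a dart -/
def corn (N : ℕ) : GD N → ℕ × ℕ
  | (i, j, 0) => (i.1 + 1, j.1)
  | (i, j, 1) => (i.1 + 1, j.1 + 1)
  | (i, j, 2) => (i.1, j.1 + 1)
  | (i, j, 3) => (i.1, j.1)

/-- interior corners, all others being identified -/
def inc (N : ℕ) (c : ℕ × ℕ) : Option (Fin (N - 1) × Fin (N - 1)) :=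
  if h : (0 < c.1 ∧ c.1 < N) ∧ (0 < c.2 ∧ c.2 < N) then
    some (⟨c.1 - 1, by omega⟩, ⟨c.2 - 1, by omega⟩) else none

theorem face_zc (N : ℕ) (hN : 0 < N) : (N - 1) * (N - 1) + 1 ≤ zc (gsi N * gal N) := by
  have := zc_ge (gsi N * gal N) (fun d => inc N (corn N d)) ?_ ?_
  · simpa using this
  · rintro ⟨⟨i, hi⟩, ⟨j, hj⟩, k⟩
    change inc N (corn N (gsi N (galf N _))) = _
    fin_cases k
    · by_cases h : i + 1 < N
      · simp [galf, h, gsi, corn]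
      · simp [galf, h, gsi, corn, inc]
    · by_cases h : j + 1 < N
      · simp [galf, h, gsi, corn]
      · simp [galf, h, gsi, corn, inc]
    · by_cases h : 0 < i
      · have : i - 1 + 1 = i := by omega
        simp [galf, h, gsi, corn, this]
      · simp [galf, h, gsi, corn, inc]
    · by_cases h : 0 < j
      · have : j - 1 + 1 = j := by omega
        simp [galf, h, gsi, corn, this]
      · simp [galf, h, gsi, corn, inc]
  · rintro (_ | ⟨⟨i, hi⟩, ⟨j, hj⟩⟩)
    · exact ⟨(⟨0, hN⟩, ⟨0, hN⟩, 3), by simp [corn, inc]⟩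
    · refine ⟨(⟨i + 1, by omega⟩, ⟨j + 1, by omega⟩, 3), ?_⟩
      have h1 : i + 1 < N := by omega
      have h2 : j + 1 < N := by omega
      simp [corn, inc, h1, h2]

theorem grid_conn (N : ℕ) (hN : 0 < N) : nq (crel (gsi N) (gal N)) ≤ 1 := by
  have h1 : ∀ i j k, Quot.mk (crel (gsi N) (gal N)) (i, j, k) =
      Quot.mk (crel (gsi N) (gal N)) (i, j, 0) := by
    intro i j k
    have hs : ∀ k, Quot.mk (crel (gsi N) (gal N)) (i, j, k) =
      Quot.mk (crel (gsi N) (gal N)) (i, j, k + 1) := fun k => Quot.sound (Or.inl rfl)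
    fin_cases k
    · rfl
    · exact (hs 0).symm
    · exact ((hs 0).trans (hs 1)).symm
    · exact hs 3
  have hi : ∀ (i : ℕ) (hi : i < N) j, Quot.mk (crel (gsi N) (gal N)) (⟨i, hi⟩, j, 0) =
      Quot.mk (crel (gsi N) (gal N)) (⟨0, hN⟩, j, 0) := by
    intro i
    induction i with
    | zero => intro hi j; rfl
    | succ i ih =>
      intro hi j
      rw [← ih (by omega) j, ← h1 ⟨i + 1, hi⟩ j 2]
      symm
      refine Quot.sound (Or.inr ?_)
      simp [gal, galf, hi]
  have hj : ∀ (j : ℕ) (hj : j < N), Quot.mk (crel (gsi N) (gal N)) (⟨0, hN⟩, ⟨j, hj⟩, 0) =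
      Quot.mk (crel (gsi N) (gal N)) (⟨0, hN⟩, ⟨0, hN⟩, 0) := by
    intro j
    induction j with
    | zero => intro hj; rfl
    | succ j ih =>
      intro hj
      rw [← ih (by omega), ← h1 ⟨0, hN⟩ ⟨j + 1, hj⟩ 3, ← h1 ⟨0, hN⟩ ⟨j, _⟩ 1]
      symm
      refine Quot.sound (Or.inr ?_)
      simp [gal, galf, hj]
  have hall : ∀ x : Quot (crel (gsi N) (gal N)), x = Quot.mk _ (⟨0, hN⟩, ⟨0, hN⟩, 0) := by
    rintro ⟨⟨i, j, k⟩⟩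
    exact (h1 i j k).trans ((hi i.1 i.2 j).trans (hj j.1 j.2))
  haveI : Subsingleton (Quot (crel (gsi N) (gal N))) := ⟨fun a b => (hall a).trans (hall b).symm⟩
  exact Finite.card_le_one_iff_subsingleton.2 this

theorem grid_df (N : ℕ) (hN : 0 < N) : df (gsi N) (gal N) ≤ 0 := by
  have h1 := gsi_zc N
  have h2 := gal_zc N hN
  have h3 := face_zc N hN
  have h4 := grid_conn N hN
  have h5 : Nat.card (GD N) = N * (N * 4) := by simp
  unfold df
  rw [h5]
  obtain ⟨M, rfl⟩ : ∃ M, N = M + 1 := ⟨N - 1, by omega⟩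
  simp only [Nat.add_sub_cancel] at h3
  zify at h1 h2 h3 h4
  push_cast
  nlinarith
end Grid
end WBW

namespace WBW
open Equiv
set_option linter.unusedSectionVars false
set_option linter.style.haveILetI false
set_option linter.unusedVariables false

section GP
variable {N : ℕ} {C : Type*}

/-- pixels -/
abbrev Pix (N : ℕ) := Fin N × Fin N

/-- adjacency of pixels (possibly reflexive at the boundary) -/
def padj (p p' : Pix N) : Prop := ∃ k k', galf N (p.1, p.2, k) = (p'.1, p'.2, k')

theorem padj_symm {p p' : Pix N} (h : padj p p') : padj p' p := by
  obtain ⟨k, k', h⟩ := h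
  exact ⟨k', k, by rw [← h, galf_inv]⟩

theorem padj_right {p p' : Pix N} (h1 : p.1.1 + 1 = p'.1.1) (h2 : p.2 = p'.2) : padj p p' := by
  refine ⟨0, 2, ?_⟩
  have h : p.1.1 + 1 < N := by rw [h1]; exact p'.1.2
  simp [galf, h1, h2]

theorem padj_up {p p' : Pix N} (h1 : p.2.1 + 1 = p'.2.1) (h2 : p.1 = p'.1) : padj p p' := by
  refine ⟨1, 3, ?_⟩
  have h : p.2.1 + 1 < N := by rw [h1]; exact p'.2.2
  simp [galf, h1, h2]

/-- adjacent pixels of the same colour -/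
def crl (col : Pix N → C) (p p' : Pix N) : Prop := padj p p' ∧ col p = col p'

theorem grid_plane (hN : 0 < N) (col : Pix N → C) (H : SimpleGraph (Quot (crl col)))
    (hH : ∀ u v, H.Adj u v → ∃ p p', padj p p' ∧ Quot.mk (crl col) p = u ∧ Quot.mk (crl col) p' = v) :
    ∃ R : RotationSystem (Quot (crl col)), R.G = H ∧ R.IsPlane := by
  classical
  haveI : Nonempty (GD N) := ⟨(⟨0, hN⟩, ⟨0, hN⟩, 0)⟩
  let l : GD N → Quot (crl col) := fun d => Quot.mk _ (d.1, d.2.1)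
  have h1 : ∀ i j k, Quot.mk (lrel l (gsi N) (gal N)) (i, j, k) =
      Quot.mk (lrel l (gsi N) (gal N)) (i, j, 0) := by
    intro i j k
    have hs : ∀ k, Quot.mk (lrel l (gsi N) (gal N)) (i, j, k) =
      Quot.mk (lrel l (gsi N) (gal N)) (i, j, k + 1) := fun k => Quot.sound (Or.inl rfl)
    fin_cases k
    · rfl
    · exact (hs 0).symm
    · exact ((hs 0).trans (hs 1)).symm
    · exact hs 3
  refine exists_plane_of_labels l (gsi N) (gal N) (galf_inv N) (grid_df N hN) (fun x => rfl) ?_ H ?_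
  · rintro ⟨i, j, k⟩ ⟨i', j', k'⟩ hl
    rw [h1, h1 i']
    refine congrArg (Quot.lift (fun p : Pix N => Quot.mk (lrel l (gsi N) (gal N)) (p.1, p.2, 0)) ?_) hl
    rintro p p' ⟨⟨k, k', h⟩, hc⟩
    change Quot.mk (lrel l (gsi N) (gal N)) (p.1, p.2, 0) =
      Quot.mk (lrel l (gsi N) (gal N)) (p'.1, p'.2, 0)
    rw [← h1 p.1 p.2 k, ← h1 p'.1 p'.2 k']
    refine Quot.sound (Or.inr ⟨?_, h⟩)
    exact Quot.sound ⟨⟨k, k', h⟩, hc⟩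
  · intro u v huv
    obtain ⟨p, p', ⟨k, k', h⟩, rfl, rfl⟩ := hH u v huv
    refine ⟨(p.1, p.2, k), rfl, ?_⟩
    change l (galf N _) = _
    rw [h]
end GP

section FP
variable {W : Type*} [Finite W]

/-- attachment graph -/
def AG (R : RotationSystem W) : SimpleGraph (Sym2 W) := SimpleGraph.fromRel (Attached R)

theorem AG_adj {R : RotationSystem W} {e f : Sym2 W} (h : (AG R).Adj e f) : Attached R e f := by
  rw [AG, SimpleGraph.fromRel_adj] at h
  exact h.2.elim id Attached.symm

theorem inc_inw (R : RotationSystem W) {z : W} {e f : Sym2 W} (he : e ∈ incidentSet R.G z)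
    (hf : f ∈ incidentSet R.G z) : InW (AG R) (incidentSet R.G z) e f := by
  obtain ⟨n, hn⟩ := (R.rot_cycleOn z).exists_pow_eq' (Set.toFinite _) he hf
  have key : ∀ n : ℕ, (R.rot z ^ n) e ∈ incidentSet R.G z ∧
      InW (AG R) (incidentSet R.G z) e ((R.rot z ^ n) e) := by
    intro n
    induction n with
    | zero => exact ⟨he, InW.refl he⟩
    | succ n ih =>
      rw [pow_succ', Perm.mul_apply]
      have hm := rot_mem R z ih.1
      refine ⟨hm, ih.2.trans ?_⟩
      by_cases h : (R.rot z ^ n) e = R.rot z ((R.rot z ^ n) e)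
      · rw [← h]; exact InW.refl ih.1
      · refine InW.adj ?_ ih.1 hm
        rw [AG, SimpleGraph.fromRel_adj]
        exact ⟨h, Or.inl ⟨z, ih.1, hm, Or.inl rfl⟩⟩
  have := (key n).2
  rwa [hn] at this

theorem path_inw (R : RotationSystem W) (A : Set (Sym2 W)) {a b : W} (w : R.G.Walk a b) :
    w.IsPath → a ≠ b → (∀ e ∈ w.edges, e ∈ A) →
    (∀ z ∈ w.support, z ≠ a → z ≠ b → incidentSet R.G z ⊆ A) →
    ∃ e f, e ∈ incidentSet R.G a ∧ f ∈ incidentSet R.G b ∧ InW (AG R) A e f := by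
  induction w with
  | nil => intro _ h; exact absurd rfl h
  | @cons a a' b h p ih =>
    intro hp hab hE hA
    rw [SimpleGraph.Walk.cons_isPath_iff] at hp
    have he : s(a, a') ∈ incidentSet R.G a := ⟨h, by simp⟩
    have he' : s(a, a') ∈ incidentSet R.G a' := ⟨h, by simp⟩
    by_cases hab' : a' = b
    · subst hab'
      exact ⟨_, _, he, he', InW.refl (hE _ (by simp))⟩
    · obtain ⟨e, f, h1, h2, h3⟩ := ih hp.1 hab' (fun e he => hE e (by simp [he]))
        (fun z hz hz1 hz2 => hA z (by simp [hz]) (fun h => hp.2 (h ▸ hz)) hz2)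
      refine ⟨_, f, he, h2, InW.trans ?_ h3⟩
      refine (inc_inw R he' h1).mono (hA a' (by simp) h.ne' hab')

theorem dist_of_inw (R : RotationSystem W) {A : Set (Sym2 W)} {a b : W} {e f : Sym2 W}
    (he : e ∈ incidentSet R.G a) (hf : f ∈ incidentSet R.G b) (h : InW (AG R) A e f)
    (hA : A ⊆ R.G.edgeSet) : wbwDist R a b ≤ (A.ncard : ℕ∞) := by
  obtain ⟨w, hw, hl, hs⟩ := h.path (Set.toFinite _)
  have h1 : wbwDist R a b ≤ (w.support.length : ℕ∞) := by
    refine sInf_le ⟨w.support, ⟨⟨?_, hw.support_nodup, fun e he => hA (hs e he), ?_⟩, ?_, ?_⟩, rfl⟩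
    · simp
    · exact w.isChain_adj_support.imp (fun _ _ h => AG_adj h)
    · refine ⟨e, ?_, he.2⟩
      cases w <;> rfl
    · refine ⟨f, ?_, hf.2⟩
      rw [List.getLast?_eq_some_getLast (by simp)]
      simp
  refine h1.trans ?_
  rw [SimpleGraph.Walk.length_support]
  exact_mod_cast hl

theorem flat_of_paths {V : Type*} {W : Type} [Finite W] (G : SimpleGraph V) (R : RotationSystem W)
    (hR : R.IsPlane) (tau : V → W) (htau : Function.Injective tau) (M K : ℕ)
    (h : ∀ e ∈ G.edgeSet, ∃ x y, e = s(x, y) ∧ ∃ w : R.G.Walk (tau x) (tau y), w.IsPath ∧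
      w.length ≤ M ∧ ∀ z ∈ w.support, z ≠ tau x → z ≠ tau y → (incidentSet R.G z).ncard ≤ K) :
    IsFlat (M + (M + 1) * K) G := by
  classical
  refine ⟨W, inferInstance, R, tau, hR, htau, ?_⟩
  have key : ∀ x y (w : R.G.Walk (tau x) (tau y)), x ≠ y → w.IsPath → w.length ≤ M →
      (∀ z ∈ w.support, z ≠ tau x → z ≠ tau y → (incidentSet R.G z).ncard ≤ K) →
      wbwDist R (tau x) (tau y) ≤ ((M + (M + 1) * K : ℕ) : ℕ∞) := by
    intro x y w hxy hw hl hK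
    let Z : Finset W := w.support.toFinset.filter (fun z => z ≠ tau x ∧ z ≠ tau y)
    let A : Set (Sym2 W) := {e | e ∈ w.edges} ∪ ⋃ z ∈ Z, incidentSet R.G z
    obtain ⟨e, f, h1, h2, h3⟩ := path_inw R A w hw (fun h => hxy (htau h)) (fun e he => Or.inl he)
      (fun z hz hz1 hz2 => by
        refine Set.subset_union_of_subset_right ?_ _
        exact Set.subset_biUnion_of_mem (u := fun z => incidentSet R.G z)
          (show z ∈ (Z : Set W) by simp [Z, hz, hz1, hz2]))
    have hA : A ⊆ R.G.edgeSet := by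
      rintro e (he | he)
      · exact w.edges_subset_edgeSet he
      · simp only [Set.mem_iUnion] at he
        obtain ⟨z, _, hz⟩ := he
        exact hz.1
    refine (dist_of_inw R h1 h2 h3 hA).trans ?_
    have hc : A.ncard ≤ M + (M + 1) * K := by
      refine (Set.ncard_union_le _ _).trans (add_le_add ?_ ?_)
      · have h1 : {f | f ∈ w.edges} = (w.edges.toFinset : Set (Sym2 W)) := by ext; simp
        rw [h1, Set.ncard_coe_finset]
        refine (List.toFinset_card_le _).trans ?_
        rwa [SimpleGraph.Walk.length_edges]
      · refine (Finset.set_ncard_biUnion_le Z _).trans ?_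
        refine (Finset.sum_le_card_nsmul Z _ K ?_).trans ?_
        · intro z hz
          simp only [Z, Finset.mem_filter, List.mem_toFinset] at hz
          exact hK z hz.1 hz.2.1 hz.2.2
        · rw [smul_eq_mul]
          refine Nat.mul_le_mul_right _ ((Finset.card_filter_le _ _).trans
            ((List.toFinset_card_le _).trans ?_))
          rw [SimpleGraph.Walk.length_support]; omega
    exact_mod_cast hc
  intro x y hxy
  refine Or.inr ?_
  rw [SimpleGraph.fromRel_adj]
  refine ⟨fun h => hxy.ne (htau h), ?_⟩
  obtain ⟨x', y', he, w, h1, h2, h3⟩ := h s(x, y) hxy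
  rcases Sym2.eq_iff.1 he with ⟨rfl, rfl⟩ | ⟨rfl, rfl⟩
  · exact Or.inl (key _ _ w hxy.ne h1 h2 h3)
  · exact Or.inr (key _ _ w hxy.ne' h1 h2 h3)
end FP
end WBW

namespace WBW
open Equiv
set_option linter.unusedSectionVars false
set_option linter.style.haveILetI false
set_option linter.unusedVariables false

section Col

/-- connectedness of a set of pixels -/
def PConn {N : ℕ} (S : Set (Pix N)) : Prop :=
  ∀ Q : Pix N → Prop, (∀ a ∈ S, ∀ b ∈ S, padj a b → Q a → Q b) → ∀ a ∈ S, ∀ b ∈ S, Q a → Q b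

theorem alt_count {α : Type*} (Q : α → Prop) [DecidablePred Q] : ∀ L : List α,
    L.IsChain (fun a b => ¬ (Q a ∧ Q b)) → L.length ≤ 2 * (L.filter (fun a => ¬ Q a)).length + 1 ∧
      (∀ a l, L = a :: l → ¬ Q a → L.length ≤ 2 * (L.filter (fun a => ¬ Q a)).length) := by
  intro L
  induction L with
  | nil => intro _; simp
  | cons a L ih =>
    intro hc
    cases L with
    | nil =>
      by_cases ha : Q a <;> simp [ha]
    | cons b L =>
      rw [List.isChain_cons_cons] at hc
      obtain ⟨h1, h2⟩ := ih hc.2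
      by_cases ha : Q a
      · have hb : ¬ Q b := fun hb => hc.1 ⟨ha, hb⟩
        have h3 := h2 b L rfl hb
        rw [List.filter_cons_of_neg (by simpa using ha)]
        simp only [List.length_cons] at h3 ⊢
        refine ⟨by omega, ?_⟩
        intro a' l h; simp only [List.cons.injEq] at h; rw [← h.1]; exact fun h => absurd ha h
      · rw [List.filter_cons_of_pos (by simpa using ha)]
        simp only [List.length_cons] at h1 ⊢
        exact ⟨by omega, fun _ _ _ _ => by omega⟩

theorem flat_of_colouring {V : Type} [Finite V] (G : SimpleGraph V) (x : ℕ) {P : Type} [Finite P]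
    (iota : V → P) (hiota : Function.Injective iota) (N : ℕ) (hN : 0 < N)
    (col : Pix N → P ⊕ (Sym2 V ⊕ Pix N)) (Pe : Sym2 V → Set P) (S : Sym2 V → Set (Pix N))
    (h1 : ∀ p, PConn {a | col a = Sum.inl p})
    (h3 : ∀ e ∈ G.edgeSet, ∀ a ∈ S e, col a = Sum.inr (Sum.inl e) ∨ ∃ p ∈ Pe e, col a = Sum.inl p)
    (h4 : ∀ e ∈ G.edgeSet, (Pe e).ncard ≤ x + 2)
    (h5 : ∀ e ∈ G.edgeSet, ∀ v, iota v ∈ Pe e → v ∈ e)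
    (h6 : ∀ e ∈ G.edgeSet, ∀ v ∈ e, ∃ a ∈ S e, col a = Sum.inl (iota v))
    (h6' : ∀ v, ∃ a, col a = Sum.inl (iota v))
    (h7 : ∀ p ∉ Set.range iota, {e | e ∈ G.edgeSet ∧ p ∈ Pe e}.ncard ≤ x + 1)
    (hS : ∀ e ∈ G.edgeSet, PConn (S e)) :
    IsFlat ((2 * x + 4) + (2 * x + 4 + 1) * ((x + 1) * (2 * x + 4))) G := by
  classical
  have hsame : ∀ p a b, col a = Sum.inl p → col b = Sum.inl p →
      Quot.mk (crl col) a = Quot.mk (crl col) b := by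
    intro p a b ha hb
    refine h1 p (fun c => Quot.mk (crl col) a = Quot.mk (crl col) c) ?_ a ha b hb rfl
    intro c hc d hd hcd h
    rw [h]
    exact Quot.sound ⟨hcd, Eq.trans hc (Eq.symm hd)⟩
  let colW : Quot (crl col) → P ⊕ (Sym2 V ⊕ Pix N) := Quot.lift col (fun _ _ h => h.2)
  choose px hpx using h6'
  let tau : V → Quot (crl col) := fun v => Quot.mk _ (px v)
  have hct : ∀ v, colW (tau v) = Sum.inl (iota v) := hpx
  have htau : Function.Injective tau := by
    intro u v h
    have h2 := congrArg colW h
    rw [hct, hct] at h2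
    exact hiota (Sum.inl_injective h2)
  have hWinl : ∀ p u v, colW u = Sum.inl p → colW v = Sum.inl p → u = v := by
    rintro p ⟨a⟩ ⟨b⟩ ha hb
    exact hsame p a b ha hb
  let QG : SimpleGraph (Quot (crl col)) := SimpleGraph.fromRel
    (fun u v => ∃ p p', padj p p' ∧ Quot.mk (crl col) p = u ∧ Quot.mk (crl col) p' = v)
  have hQG : ∀ u v, QG.Adj u v →
      ∃ p p', padj p p' ∧ Quot.mk (crl col) p = u ∧ Quot.mk (crl col) p' = v := by
    intro u v h
    rw [SimpleGraph.fromRel_adj] at h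
    rcases h.2 with h | ⟨p, p', h1, h2, h3⟩
    · exact h
    · exact ⟨p', p, padj_symm h1, h3, h2⟩
  have hQcol : ∀ u v, QG.Adj u v → colW u ≠ colW v := by
    intro u v h hc
    obtain ⟨p, p', h1, rfl, rfl⟩ := hQG u v h
    exact h.ne (Quot.sound ⟨h1, hc⟩)
  have hpaths : ∀ e : G.edgeSet, ∃ (y z : V) (w : QG.Walk (tau y) (tau z)), e.1 = s(y, z) ∧
      w.IsPath ∧ w.length ≤ 2 * x + 4 ∧ ∀ u ∈ w.support, u ∈ Quot.mk (crl col) '' S e.1 := by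
    rintro ⟨e, he⟩
    induction e using Sym2.ind with
    | _ y z =>
      obtain ⟨a, ha, hay⟩ := h6 _ he y (by simp)
      obtain ⟨b, hb, hbz⟩ := h6 _ he z (by simp)
      have hin : InW QG (Quot.mk (crl col) '' S s(y, z)) (tau y) (tau z) := by
        have e1 : tau y = Quot.mk (crl col) a := hsame _ _ _ (hpx y) hay
        have e2 : tau z = Quot.mk (crl col) b := hsame _ _ _ (hpx z) hbz
        rw [e1, e2]
        refine hS _ he (fun c => InW QG (Quot.mk (crl col) '' S s(y, z))
          (Quot.mk (crl col) a) (Quot.mk (crl col) c)) ?_ a ha b hb (InW.refl ⟨a, ha, rfl⟩)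
        intro c hc d hd hcd h
        refine h.trans ?_
        by_cases hne : Quot.mk (crl col) c = Quot.mk (crl col) d
        · rw [hne]; exact InW.refl ⟨d, hd, rfl⟩
        · refine InW.adj ?_ ⟨c, hc, rfl⟩ ⟨d, hd, rfl⟩
          rw [SimpleGraph.fromRel_adj]
          exact ⟨hne, Or.inl ⟨c, d, hcd, rfl, rfl⟩⟩
      obtain ⟨w, hw, -, hsup⟩ := hin.path (Set.toFinite _)
      refine ⟨y, z, w, rfl, hw, ?_, hsup⟩
      have hcnt := (alt_count (fun u => colW u = Sum.inr (Sum.inl s(y, z))) w.support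
        (w.isChain_adj_support.imp (fun u v h hh => hQcol u v h (hh.1.trans hh.2.symm)))).1
      have hf : (w.support.filter (fun u => ¬ colW u = Sum.inr (Sum.inl s(y, z)))).length ≤ x + 2 := by
        rw [← List.toFinset_card_of_nodup (hw.support_nodup.filter _), ← Set.ncard_coe_finset]
        refine le_trans ?_ (h4 _ he)
        have hp : ∀ u, u ∈ w.support → ¬ colW u = Sum.inr (Sum.inl s(y, z)) →
            ∃ p ∈ Pe s(y, z), colW u = Sum.inl p := by
          intro u hu hu2
          obtain ⟨c, hc, rfl⟩ := hsup u hu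
          exact (h3 _ he c hc).resolve_left hu2
        haveI : Nonempty P := ⟨iota y⟩
        choose! f hf1 hf2 using hp
        refine Set.ncard_le_ncard_of_injOn f ?_ ?_ (Set.toFinite _)
        · intro u hu
          simp only [decide_not, List.coe_toFinset, List.mem_filter, Set.mem_ofPred_eq] at hu
          exact hf1 u hu.1 (by simpa using hu.2)
        · intro u hu v hv huv
          simp only [decide_not, List.coe_toFinset, List.mem_filter, Set.mem_ofPred_eq] at hu hv
          have a1 := hf2 u hu.1 (by simpa using hu.2)
          have a2 := hf2 v hv.1 (by simpa using hv.2)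
          rw [huv] at a1
          exact hWinl _ _ _ a1 a2
      rw [SimpleGraph.Walk.length_support] at hcnt
      omega
  choose Y Z w hYZ hw hwl hws using hpaths
  let H : SimpleGraph (Quot (crl col)) := SimpleGraph.fromRel
    (fun u v => ∃ e : G.edgeSet, s(u, v) ∈ (w e).edges)
  have hH : ∀ u v, H.Adj u v → ∃ e : G.edgeSet, s(u, v) ∈ (w e).edges := by
    intro u v h
    rw [SimpleGraph.fromRel_adj] at h
    rcases h.2 with h | ⟨e, he⟩
    · exact h
    · exact ⟨e, by rwa [Sym2.eq_swap]⟩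
  have hHe : ∀ f ∈ H.edgeSet, ∃ e : G.edgeSet, f ∈ (w e).edges := by
    intro f
    induction f using Sym2.ind with
    | _ u v => exact hH u v
  have hHw : ∀ e : G.edgeSet, ∀ f ∈ (w e).edges, f ∈ H.edgeSet := by
    intro e f
    induction f using Sym2.ind with
    | _ u v =>
      intro hf
      change H.Adj u v
      rw [SimpleGraph.fromRel_adj]
      have : QG.Adj u v := (w e).edges_subset_edgeSet hf
      exact ⟨this.ne, Or.inl ⟨e, hf⟩⟩
  obtain ⟨R, hRH, hpl⟩ := grid_plane hN col H (fun u v h => by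
    obtain ⟨e, he⟩ := hH u v h
    exact hQG u v ((w e).edges_subset_edgeSet he))
  refine flat_of_paths G R hpl tau htau (2 * x + 4) ((x + 1) * (2 * x + 4)) ?_
  intro e he
  have htr : ∀ f ∈ (w ⟨e, he⟩).edges, f ∈ R.G.edgeSet := by rw [hRH]; exact hHw _
  refine ⟨Y ⟨e, he⟩, Z ⟨e, he⟩, hYZ ⟨e, he⟩, (w ⟨e, he⟩).transfer R.G htr,
    (hw ⟨e, he⟩).transfer htr, ?_, ?_⟩
  · rw [SimpleGraph.Walk.length_transfer]; exact hwl _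
  · intro z hz hzy hzz
    rw [SimpleGraph.Walk.support_transfer] at hz
    -- the edges whose route meets z
    set Ez : Set (Sym2 V) := {f | f ∈ G.edgeSet ∧ (colW z = Sum.inr (Sum.inl f) ∨
      ∃ p ∈ Pe f, colW z = Sum.inl p)} with hEz
    have hEzc : Ez.ncard ≤ x + 1 := by
      obtain ⟨c, hc, hcz⟩ := hws _ z hz
      have hcz' : col c = colW z := by rw [← hcz]
      rcases h3 e he c hc with h | ⟨p, hp, h⟩
      · have : Ez ⊆ {e} := by
          rintro f ⟨hf, h' | ⟨p, -, h'⟩⟩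
          · rw [← hcz', h] at h'
            simp only [Sum.inr.injEq, Sum.inl.injEq] at h'
            exact h'.symm
          · rw [← hcz', h] at h'; simp at h'
        refine (Set.ncard_le_ncard this (Set.toFinite _)).trans ?_
        simp
      · have hpr : p ∉ Set.range iota := by
          rintro ⟨v, rfl⟩
          have hv := h5 e he v hp
          have hzv : z = tau v := hWinl _ _ _ (hcz'.symm.trans h) (hct v)
          have h9 := hYZ ⟨e, he⟩
          simp only at h9
          rw [h9] at hv
          rcases Sym2.mem_iff.1 hv with h8 | h8
          · exact hzy (by rw [hzv, h8])
          · exact hzz (by rw [hzv, h8])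
        refine le_trans (Set.ncard_le_ncard ?_ (Set.toFinite _)) (h7 p hpr)
        rintro f ⟨hf, h' | ⟨p', hp', h'⟩⟩
        · rw [← hcz', h] at h'; simp at h'
        · rw [← hcz', h] at h'
          have := Sum.inl_injective h'
          subst this
          exact ⟨hf, hp'⟩
    have hsub : incidentSet R.G z ⊆ ⋃ f ∈ (Set.toFinite Ez).toFinset,
        {g | ∃ hf : f ∈ G.edgeSet, g ∈ (w ⟨f, hf⟩).edges} := by
      rintro g ⟨hg1, hg2⟩
      rw [hRH] at hg1
      obtain ⟨⟨f, hf⟩, hgf⟩ := hHe g hg1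
      have hzf : z ∈ (w ⟨f, hf⟩).support := SimpleGraph.Walk.mem_support_of_mem_edges hgf hg2
      obtain ⟨c, hc, hcz⟩ := hws _ z hzf
      have hcz' : col c = colW z := by rw [← hcz]
      simp only [Set.mem_iUnion]
      refine ⟨f, ?_, hf, hgf⟩
      rw [Set.Finite.mem_toFinset]
      refine ⟨hf, ?_⟩
      rw [← hcz']
      exact h3 f hf c hc
    refine (Set.ncard_le_ncard hsub (Set.toFinite _)).trans
      ((Finset.set_ncard_biUnion_le _ _).trans ?_)
    refine (Finset.sum_le_card_nsmul _ _ (2 * x + 4) ?_).trans ?_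
    · intro f hf
      rw [Set.Finite.mem_toFinset] at hf
      have h8 : {g | ∃ hf : f ∈ G.edgeSet, g ∈ (w ⟨f, hf⟩).edges} =
          ((w ⟨f, hf.1⟩).edges.toFinset : Set _) := by
        ext g; simp [hf.1]
      rw [h8, Set.ncard_coe_finset]
      refine (List.toFinset_card_le _).trans ?_
      rw [SimpleGraph.Walk.length_edges]; exact hwl _
    · rw [smul_eq_mul, ← Set.ncard_eq_toFinset_card]
      exact Nat.mul_le_mul_right _ hEzc
end Col
end WBW

namespace WBW
open Equiv
set_option linter.unusedSectionVars false
set_option linter.style.haveILetI false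
set_option linter.unusedVariables false

section Plan

/-- the closed pixel -/
def pixel {N : ℕ} (a : Pix N) : Set (ℝ × ℝ) :=
  {z | (a.1.1 : ℝ) ≤ N * z.1 ∧ N * z.1 ≤ a.1.1 + 1 ∧ (a.2.1 : ℝ) ≤ N * z.2 ∧ N * z.2 ≤ a.2.1 + 1}

theorem pixel_closed {N : ℕ} (a : Pix N) : IsClosed (pixel a) := by
  have h1 : IsClosed {z : ℝ × ℝ | (a.1.1 : ℝ) ≤ N * z.1} := isClosed_le (by fun_prop) (by fun_prop)
  have h2 : IsClosed {z : ℝ × ℝ | N * z.1 ≤ (a.1.1 : ℝ) + 1} := isClosed_le (by fun_prop) (by fun_prop)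
  have h3 : IsClosed {z : ℝ × ℝ | (a.2.1 : ℝ) ≤ N * z.2} := isClosed_le (by fun_prop) (by fun_prop)
  have h4 : IsClosed {z : ℝ × ℝ | N * z.2 ≤ (a.2.1 : ℝ) + 1} := isClosed_le (by fun_prop) (by fun_prop)
  exact h1.inter (h2.inter (h3.inter h4))

/-- the closed unit square -/
def usq : Set (ℝ × ℝ) := Set.Icc 0 1 ×ˢ Set.Icc 0 1

theorem fin_cover {N : ℕ} (hN : 0 < N) (t : ℝ) (h0 : 0 ≤ t) (h1 : t ≤ 1) :
    ∃ i : Fin N, (i.1 : ℝ) ≤ N * t ∧ N * t ≤ i.1 + 1 := by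
  have hN' : (0 : ℝ) < N := by exact_mod_cast hN
  by_cases h : t = 1
  · refine ⟨⟨N - 1, by omega⟩, ?_⟩
    subst h
    have : ((N - 1 : ℕ) : ℝ) = N - 1 := by rw [Nat.cast_sub hN]; simp
    simp only [this]
    constructor <;> linarith
  · have hlt : t < 1 := lt_of_le_of_ne h1 h
    have hnn : 0 ≤ N * t := by positivity
    refine ⟨⟨⌊N * t⌋₊, ?_⟩, Nat.floor_le hnn, (Nat.lt_floor_add_one _).le⟩
    rw [Nat.floor_lt hnn]
    nlinarith

theorem pixel_cover {N : ℕ} (hN : 0 < N) (z : ℝ × ℝ) (hz : z ∈ usq) : ∃ a : Pix N, z ∈ pixel a := by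
  obtain ⟨i, hi1, hi2⟩ := fin_cover hN z.1 hz.1.1 hz.1.2
  obtain ⟨j, hj1, hj2⟩ := fin_cover hN z.2 hz.2.1 hz.2.2
  exact ⟨(i, j), hi1, hi2, hj1, hj2⟩

theorem pixel_dist {N : ℕ} (hN : 0 < N) (a : Pix N) (z w : ℝ × ℝ) (hz : z ∈ pixel a) (hw : w ∈ pixel a) :
    dist z w ≤ 1 / N := by
  have hN' : (0 : ℝ) < N := by exact_mod_cast hN
  obtain ⟨a1, a2, a3, a4⟩ := hz
  obtain ⟨b1, b2, b3, b4⟩ := hw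
  rw [Prod.dist_eq, max_le_iff, Real.dist_eq, Real.dist_eq, le_div_iff₀ hN', le_div_iff₀ hN']
  constructor
  · rw [← abs_of_pos hN', ← abs_mul, abs_le]; constructor <;> linarith
  · rw [← abs_of_pos hN', ← abs_mul, abs_le]; constructor <;> linarith

theorem near_h {N : ℕ} (i i' : Fin N) (t : ℝ) (h1 : (i.1 : ℝ) ≤ t) (h2 : t ≤ i.1 + 1)
    (h3 : (i'.1 : ℝ) ≤ t) (h4 : t ≤ i'.1 + 1) : i = i' ∨ i.1 + 1 = i'.1 ∨ i'.1 + 1 = i.1 := by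
  have e1 : (i.1 : ℝ) ≤ ((i'.1 + 1 : ℕ) : ℝ) := by push_cast; linarith
  have e2 : (i'.1 : ℝ) ≤ ((i.1 + 1 : ℕ) : ℝ) := by push_cast; linarith
  have e1' := Nat.cast_le.1 e1
  have e2' := Nat.cast_le.1 e2
  rcases lt_trichotomy i.1 i'.1 with h | h | h
  · right; left; omega
  · left; exact Fin.ext h
  · right; right; omega

theorem pconn_of_conn {N : ℕ} (hN : 0 < N) (C : Set (ℝ × ℝ)) (hC : IsPreconnected C) (hsub : C ⊆ usq) :
    PConn {a : Pix N | (pixel a ∩ C).Nonempty} := by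
  intro Q hQ a ha b hb hQa
  by_contra hQb
  have hQ' : ∀ a ∈ {a : Pix N | (pixel a ∩ C).Nonempty}, ∀ b ∈ {a : Pix N | (pixel a ∩ C).Nonempty},
      padj a b → (Q a ↔ Q b) := fun a ha b hb h =>
    ⟨hQ a ha b hb h, hQ b hb a ha (padj_symm h)⟩
  rw [isPreconnected_closed_iff] at hC
  obtain ⟨z, hz, hz1, hz2⟩ := hC (⋃ a ∈ {a | Q a}, pixel a) (⋃ a ∈ {a | ¬ Q a}, pixel a)
    (Set.Finite.isClosed_biUnion (Set.toFinite _) fun a _ => pixel_closed a)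
    (Set.Finite.isClosed_biUnion (Set.toFinite _) fun a _ => pixel_closed a)
    (by
      intro z hz
      obtain ⟨a, ha⟩ := pixel_cover hN z (hsub hz)
      by_cases h : Q a
      · left; exact Set.mem_biUnion (x := a) h ha
      · right; exact Set.mem_biUnion (x := a) h ha)
    (by
      obtain ⟨z, hz, hz'⟩ := ha
      exact ⟨z, hz', Set.mem_biUnion (x := a) hQa hz⟩)
    (by
      obtain ⟨z, hz, hz'⟩ := hb
      exact ⟨z, hz', Set.mem_biUnion (x := b) hQb hz⟩)
  obtain ⟨p, hp, hpz⟩ := Set.mem_iUnion₂.1 hz1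
  obtain ⟨q, hq, hqz⟩ := Set.mem_iUnion₂.1 hz2
  have hm : z ∈ pixel ((p.1, q.2) : Pix N) := ⟨hpz.1, hpz.2.1, hqz.2.2.1, hqz.2.2.2⟩
  have hpS : p ∈ {a : Pix N | (pixel a ∩ C).Nonempty} := ⟨z, hpz, hz⟩
  have hqS : q ∈ {a : Pix N | (pixel a ∩ C).Nonempty} := ⟨z, hqz, hz⟩
  have hmS : ((p.1, q.2) : Pix N) ∈ {a : Pix N | (pixel a ∩ C).Nonempty} := ⟨z, hm, hz⟩
  have s1 : Q p ↔ Q ((p.1, q.2) : Pix N) := by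
    rcases near_h p.2 q.2 (N * z.2) hpz.2.2.1 hpz.2.2.2 hqz.2.2.1 hqz.2.2.2 with h | h | h
    · rw [← h]
    · exact hQ' _ hpS _ hmS (padj_up h rfl)
    · exact (hQ' _ hmS _ hpS (padj_up h rfl)).symm
  have s2 : Q ((p.1, q.2) : Pix N) ↔ Q q := by
    rcases near_h p.1 q.1 (N * z.1) hpz.1 hpz.2.1 hqz.1 hqz.2.1 with h | h | h
    · rw [h]
    · exact hQ' _ hmS _ hqS (padj_right h rfl)
    · exact (hQ' _ hqS _ hmS (padj_right h rfl)).symm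
  exact hq (s2.1 (s1.1 hp))

open Filter Topology in
theorem compact_margin (K L : Set (ℝ × ℝ)) (hK : IsCompact K) (hL : IsCompact L) (hd : Disjoint K L) :
    ∀ᶠ d in 𝓝[>] (0 : ℝ), ∀ z ∈ K, ∀ w ∈ L, d < dist z w := by
  obtain ⟨r, hr, h⟩ := Metric.exists_pos_forall_lt_edist hK hL.isClosed hd
  have : Set.Ioo (0 : ℝ) r ∈ 𝓝[>] (0 : ℝ) := Ioo_mem_nhdsGT (by exact_mod_cast hr)
  filter_upwards [this] with d hdd z hz w hw
  have := h z hz w hw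
  rw [edist_nndist] at this
  have h2 : r < nndist z w := by exact_mod_cast this
  have h3 : (r : ℝ) < dist z w := by rw [← coe_nndist]; exact_mod_cast h2
  linarith [hdd.2]

open Filter Topology in
theorem flat_of_planar {V : Type} [Finite V] (G : SimpleGraph V) (x : ℕ)
    (P : Set (ℝ × ℝ)) (hP : P.Finite) (hPs : P ⊆ usq) (io : V → ℝ × ℝ) (hinj : Function.Injective io)
    (hio : ∀ v, io v ∈ P) (Γ : Sym2 V → Set (ℝ × ℝ)) (hc : ∀ e ∈ G.edgeSet, IsCompact (Γ e))
    (hcn : ∀ e ∈ G.edgeSet, IsPreconnected (Γ e)) (hs : ∀ e ∈ G.edgeSet, Γ e ⊆ usq)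
    (hcross : ∀ e ∈ G.edgeSet, ∀ e' ∈ G.edgeSet, e ≠ e' → Γ e ∩ Γ e' ⊆ P)
    (h4 : ∀ e ∈ G.edgeSet, (P ∩ Γ e).ncard ≤ x + 2)
    (h5 : ∀ e ∈ G.edgeSet, ∀ v, io v ∈ Γ e → v ∈ e)
    (h6 : ∀ e ∈ G.edgeSet, ∀ v ∈ e, io v ∈ Γ e)
    (h7 : ∀ p ∈ P, p ∉ Set.range io → {e | e ∈ G.edgeSet ∧ p ∈ Γ e}.ncard ≤ x + 1) :
    IsFlat ((2 * x + 4) + (2 * x + 4 + 1) * ((x + 1) * (2 * x + 4))) G := by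
  classical
  have hPf : Finite P := hP
  -- choice of radius
  have r1 : ∀ᶠ r in 𝓝[>] (0 : ℝ), ∀ p p' : P, p ≠ p' → 3 * r < dist p.1 p'.1 := by
    rw [eventually_all]; intro p
    rw [eventually_all]; intro p'
    by_cases h : p = p'
    · simp [h]
    have hd : 0 < dist p.1 p'.1 := dist_pos.2 (fun h' => h (Subtype.ext h'))
    have : Set.Ioo (0 : ℝ) (dist p.1 p'.1 / 3) ∈ 𝓝[>] (0 : ℝ) := Ioo_mem_nhdsGT (by positivity)
    filter_upwards [this] with d hdd _
    linarith [hdd.2]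
  have r2 : ∀ᶠ r in 𝓝[>] (0 : ℝ), ∀ (p : P) (e : G.edgeSet), p.1 ∉ Γ e.1 → ∀ z ∈ Γ e.1, 2 * r < dist p.1 z := by
    rw [eventually_all]; intro p
    rw [eventually_all]; intro e
    by_cases h : p.1 ∈ Γ e.1
    · simp [h]
    have := compact_margin {p.1} (Γ e.1) isCompact_singleton (hc e.1 e.2) (by simpa using h)
    have t2 : Tendsto (fun r : ℝ => 2 * r) (𝓝[>] 0) (𝓝[>] 0) := by
      refine tendsto_nhdsWithin_iff.2 ⟨?_, ?_⟩
      · have : Tendsto (fun r : ℝ => 2 * r) (𝓝 0) (𝓝 (2 * 0)) := (continuous_const.mul continuous_id).tendsto 0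
        rw [mul_zero] at this
        exact this.mono_left nhdsWithin_le_nhds
      · filter_upwards [self_mem_nhdsWithin] with r hr
        have : (0 : ℝ) < r := hr
        show (0 : ℝ) < 2 * r
        linarith
    filter_upwards [t2.eventually this] with r hr _ z hz
    exact hr _ rfl z hz
  have r0 : ∀ᶠ r in 𝓝[>] (0 : ℝ), 0 < r := self_mem_nhdsWithin
  obtain ⟨r, hr1, hr2, hr0⟩ := (r1.and (r2.and r0)).exists
  let K : Sym2 V → Set (ℝ × ℝ) := fun e => Γ e \ ⋃ p ∈ P, Metric.ball p r
  have hKc : ∀ e ∈ G.edgeSet, IsCompact (K e) := fun e he =>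
    (hc e he).diff (isOpen_biUnion fun p _ => Metric.isOpen_ball)
  have d1 : ∀ᶠ d in 𝓝[>] (0 : ℝ), ∀ e e' : G.edgeSet, e ≠ e' → ∀ z ∈ K e.1, ∀ w ∈ K e'.1, d < dist z w := by
    rw [eventually_all]; intro e
    rw [eventually_all]; intro e'
    by_cases h : e = e'
    · simp [h]
    have hne : e.1 ≠ e'.1 := fun h' => h (Subtype.ext h')
    have := compact_margin (K e.1) (K e'.1) (hKc _ e.2) (hKc _ e'.2) (by
      rw [Set.disjoint_left]
      intro z hz hz'
      have := hcross _ e.2 _ e'.2 hne ⟨hz.1, hz'.1⟩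
      exact hz.2 (Set.mem_biUnion this (Metric.mem_ball_self hr0)))
    filter_upwards [this] with d hd _
    exact hd
  obtain ⟨d, hd1, hd0⟩ := (d1.and r0).exists
  obtain ⟨n, hn⟩ := exists_nat_one_div_lt (lt_min hr0 hd0)
  let N := n + 1
  have hN : 0 < N := Nat.succ_pos n
  have hNr : 1 / (N : ℝ) < r := by
    have := lt_of_lt_of_le hn (min_le_left _ _); simpa [N] using this
  have hNd : 1 / (N : ℝ) < d := by
    have := lt_of_lt_of_le hn (min_le_right _ _); simpa [N] using this
  let tb : Pix N → P → Prop := fun a p => (pixel a ∩ (Metric.closedBall p.1 r ∩ usq)).Nonempty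
  let te : Pix N → G.edgeSet → Prop := fun a e => (pixel a ∩ Γ e.1).Nonempty
  have tb_uniq : ∀ a p p', tb a p → tb a p' → p = p' := by
    rintro a p p' ⟨z, hz, hz', _⟩ ⟨w, hw, hw', _⟩
    by_contra hne
    have h1 := hr1 p p' hne
    have h2 := pixel_dist hN a z w hz hw
    rw [Metric.mem_closedBall] at hz' hw'
    have h3 := dist_triangle p.1 z p'.1
    have h4 := dist_triangle z w p'.1
    rw [dist_comm p.1 z] at h3
    linarith
  have te_uniq : ∀ a e e', (¬ ∃ p, tb a p) → te a e → te a e' → e = e' := by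
    rintro a e e' hnb ⟨z, hz, hz'⟩ ⟨w, hw, hw'⟩
    by_contra hne
    have hk : ∀ (e : G.edgeSet) (z : ℝ × ℝ), z ∈ pixel a → z ∈ Γ e.1 → z ∈ K e.1 := by
      intro e z hz hz'
      refine ⟨hz', fun hmem => ?_⟩
      obtain ⟨p, hp, hpz⟩ := Set.mem_iUnion₂.1 hmem
      exact hnb ⟨⟨p, hp⟩, z, hz, Metric.ball_subset_closedBall hpz, hs _ e.2 hz'⟩
    have h1 := hd1 e e' hne z (hk e z hz hz') w (hk e' w hw hw')
    have h2 := pixel_dist hN a z w hz hw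
    linarith
  have tbe : ∀ a p e, tb a p → te a e → p.1 ∈ Γ e.1 := by
    rintro a p e ⟨z, hz, hz', _⟩ ⟨w, hw, hw'⟩
    by_contra hne
    have h1 := hr2 p e hne w hw'
    have h2 := pixel_dist hN a z w hz hw
    rw [Metric.mem_closedBall] at hz'
    have h3 := dist_triangle p.1 z w
    rw [dist_comm p.1 z] at h3
    linarith
  let col : Pix N → P ⊕ (Sym2 V ⊕ Pix N) := fun a =>
    if h : ∃ p, tb a p then Sum.inl h.choose
    else if h' : ∃ e, te a e then Sum.inr (Sum.inl h'.choose.1) else Sum.inr (Sum.inr a)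
  have col_b : ∀ a p, tb a p → col a = Sum.inl p := by
    intro a p h
    have h' : ∃ p, tb a p := ⟨p, h⟩
    simp only [col, dif_pos h']
    rw [tb_uniq a _ p h'.choose_spec h]
  have col_b' : ∀ a p, col a = Sum.inl p → tb a p := by
    intro a p h
    by_cases h' : ∃ p, tb a p
    · obtain ⟨q, hq⟩ := h'
      have := col_b a q hq
      rw [h] at this
      rw [Sum.inl.inj this]; exact hq
    · simp only [col, dif_neg h'] at h
      split_ifs at h
  have col_e : ∀ a e, (¬ ∃ p, tb a p) → te a e → col a = Sum.inr (Sum.inl e.1) := by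
    intro a e hn h
    have h' : ∃ e, te a e := ⟨e, h⟩
    simp only [col, dif_neg hn, dif_pos h']
    rw [te_uniq a _ e hn h'.choose_spec h]
  have selfp : ∀ (p : P) (a : Pix N), p.1 ∈ pixel a → tb a p := fun p a h =>
    ⟨p.1, h, Metric.mem_closedBall_self hr0.le, hPs p.2⟩
  refine flat_of_colouring G x (P := P) (fun v => ⟨io v, hio v⟩) (fun a b h => hinj (congrArg Subtype.val h))
    N hN col (fun e => {p | p.1 ∈ Γ e}) (fun e => {a | (pixel a ∩ Γ e).Nonempty}) ?_ ?_ ?_ ?_ ?_ ?_ ?_ ?_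
  · intro p
    have : {a | col a = Sum.inl p} = {a : Pix N | (pixel a ∩ (Metric.closedBall p.1 r ∩ usq)).Nonempty} := by
      ext a; exact ⟨col_b' a p, col_b a p⟩
    rw [this]
    refine pconn_of_conn hN _ ?_ Set.inter_subset_right
    exact ((convex_closedBall p.1 r).inter ((convex_Icc 0 1).prod (convex_Icc 0 1))).isPreconnected
  · intro e he a ha
    by_cases h : ∃ p, tb a p
    · obtain ⟨p, hp⟩ := h
      exact Or.inr ⟨p, tbe a p ⟨e, he⟩ hp ha, col_b a p hp⟩
    · exact Or.inl (col_e a ⟨e, he⟩ h ha)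
  · intro e he
    refine le_trans (le_of_eq ?_) (h4 e he)
    rw [← Set.ncard_image_of_injective _ Subtype.val_injective]
    congr 1
    ext z; constructor
    · rintro ⟨p, hp, rfl⟩; exact ⟨p.2, hp⟩
    · rintro ⟨hz, hz'⟩; exact ⟨⟨z, hz⟩, hz', rfl⟩
  · intro e he v hv
    exact h5 e he v hv
  · intro e he v hv
    obtain ⟨a, ha⟩ := pixel_cover hN (io v) (hPs (hio v))
    exact ⟨a, ⟨io v, ha, h6 e he v hv⟩, col_b a _ (selfp ⟨io v, hio v⟩ a ha)⟩
  · intro v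
    obtain ⟨a, ha⟩ := pixel_cover hN (io v) (hPs (hio v))
    exact ⟨a, col_b a _ (selfp ⟨io v, hio v⟩ a ha)⟩
  · intro p hp
    exact h7 p.1 p.2 (fun ⟨v, hv⟩ => hp ⟨v, Subtype.ext hv⟩)
  · intro e he
    exact pconn_of_conn hN _ (hcn e he) (hs e he)

end Plan
end WBW

namespace WBW
open Equiv
set_option linter.unusedSectionVars false
set_option linter.style.haveILetI false
set_option linter.unusedVariables false

section Sph

/-- three dimensional Euclidean space -/
abbrev E3 := EuclideanSpace ℝ (Fin 3)

/-- the sphere as a type -/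
abbrev Sp := Metric.sphere (0 : E3) 1

instance factE3 : Fact (Module.finrank ℝ E3 = 2 + 1) := ⟨by simp⟩

theorem sp_diff (q : Sp) (F : Set Sp) (hF : F.Finite) (hq : q ∈ F) : IsPreconnected Fᶜ := by
  let st := stereographic' 2 q
  have hsrc : st.source = {q}ᶜ := stereographic'_source q
  have htgt : st.target = Set.univ := stereographic'_target q
  have hco : Continuous st.symm := by
    have := st.continuousOn_symm
    rw [htgt] at this
    exact continuousOn_univ.1 this
  have hrank : 1 < Module.rank ℝ (EuclideanSpace ℝ (Fin 2)) := by
    rw [← Module.finrank_eq_rank, finrank_euclideanSpace]; simp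
  have hc : IsPreconnected ((st '' (F \ {q}))ᶜ) :=
    (((hF.subset Set.sdiff_subset).image st).countable.isConnected_compl_of_one_lt_rank hrank).isPreconnected
  have := hc.image st.symm hco.continuousOn
  refine (?_ : Fᶜ = _) ▸ this
  have hns : ∀ z, z ≠ q → z ∈ st.source := fun z hz => by rw [hsrc]; exact hz
  ext z; constructor
  · intro hz
    have hzs : z ∈ st.source := hns z (fun h => hz (h ▸ hq))
    refine ⟨st z, ?_, st.left_inv hzs⟩
    rintro ⟨w, hw, hwz⟩
    have := st.injOn (hns w hw.2) hzs hwz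
    exact hz (this ▸ hw.1)
  · rintro ⟨w, hw, rfl⟩ hz
    have h1 : st.symm w ∈ st.source := st.map_target (by rw [htgt]; trivial)
    refine hw ⟨st.symm w, ⟨hz, ?_⟩, st.right_inv (by rw [htgt]; trivial)⟩
    rw [hsrc] at h1; exact h1

theorem arc_interior (f : C(Set.Icc (0 : ℝ) 1, Sp)) (hf : Function.Injective f) :
    ¬ (interior (Set.range f)).Nonempty := by
  intro hne
  set U := interior (Set.range f) with hU
  have hUo : IsOpen U := isOpen_interior
  have hUr : U ⊆ Set.range f := interior_subset
  obtain ⟨y, hy⟩ := hne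
  obtain ⟨s, rfl⟩ := hUr hy
  have hpre : IsOpen (f ⁻¹' U) := hUo.preimage f.continuous
  obtain ⟨ε, hε, hball⟩ := Metric.isOpen_iff.1 hpre s hy
  set m := min ε 1 with hm
  have hm0 : 0 < m := lt_min hε one_pos
  have hm1 : m ≤ 1 := min_le_right _ _
  have hme : m ≤ ε := min_le_left _ _
  have key : ∃ a t b : Set.Icc (0 : ℝ) 1, a < t ∧ b ∉ Set.Icc a t ∧ Set.Ioo a t ⊆ f ⁻¹' U := by
    by_cases hs : (s : ℝ) ≤ 1 / 2
    · refine ⟨s, ⟨s + m / 4, by linarith [s.2.1], by linarith⟩, ⟨1, by norm_num, le_rfl⟩, ?_, ?_, ?_⟩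
      · rw [← Subtype.coe_lt_coe]; simp only; linarith
      · intro h
        have := Subtype.coe_le_coe.2 h.2
        simp only at this; linarith
      · intro z hz
        apply hball
        have h1 := Subtype.coe_lt_coe.2 hz.1
        have h2 := Subtype.coe_lt_coe.2 hz.2
        simp only at h2
        rw [Metric.mem_ball, Subtype.dist_eq, Real.dist_eq, abs_lt]
        constructor <;> linarith
    · push Not at hs
      refine ⟨⟨s - m / 4, by linarith, by linarith [s.2.2]⟩, s, ⟨0, le_rfl, by norm_num⟩, ?_, ?_, ?_⟩
      · rw [← Subtype.coe_lt_coe]; simp only; linarith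
      · intro h
        have := Subtype.coe_le_coe.2 h.1
        simp only at this; linarith
      · intro z hz
        apply hball
        have h1 := Subtype.coe_lt_coe.2 hz.1
        have h2 := Subtype.coe_lt_coe.2 hz.2
        simp only at h1
        rw [Metric.mem_ball, Subtype.dist_eq, Real.dist_eq, abs_lt]
        constructor <;> linarith
  obtain ⟨a, t, b, hat, hb, hsub⟩ := key
  have hO : IsOpen (f '' Set.Ioo a t) := by
    have h1 : IsClosed (f '' (Set.Ioo a t)ᶜ) :=
      (isOpen_Ioo.isClosed_compl.isCompact.image f.continuous).isClosed
    have h2 : f '' Set.Ioo a t = U ∩ (f '' (Set.Ioo a t)ᶜ)ᶜ := by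
      ext z; constructor
      · rintro ⟨w, hw, rfl⟩
        refine ⟨hsub hw, ?_⟩
        rintro ⟨w', hw', h⟩
        exact hw' (hf h ▸ hw)
      · rintro ⟨hz, hz'⟩
        obtain ⟨w, rfl⟩ := hUr hz
        refine ⟨w, ?_, rfl⟩
        by_contra h
        exact hz' ⟨w, h, rfl⟩
    rw [h2]
    exact hUo.inter h1.isOpen_compl
  have hI : IsOpen (f '' Set.Icc a t)ᶜ := ((isCompact_Icc).image f.continuous).isClosed.isOpen_compl
  have hp := sp_diff (f a) {f a, f t} (Set.toFinite _) (by simp)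
  obtain ⟨c, hc1, hc2⟩ := exists_between hat
  obtain ⟨z, hz, hz1, hz2⟩ := hp _ _ hO hI
    (by
      intro z hz
      by_cases h : z ∈ f '' Set.Icc a t
      · left
        obtain ⟨w, hw, rfl⟩ := h
        simp only [Set.mem_compl_iff, Set.mem_insert_iff, Set.mem_singleton_iff, not_or] at hz
        refine ⟨w, ⟨lt_of_le_of_ne hw.1 ?_, lt_of_le_of_ne hw.2 ?_⟩, rfl⟩
        · rintro rfl; exact hz.1 rfl
        · rintro rfl; exact hz.2 rfl
      · right; exact h)
    ⟨f c, by
      simp only [Set.mem_compl_iff, Set.mem_insert_iff, Set.mem_singleton_iff, not_or, hf.eq_iff]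
      exact ⟨hc1.ne', hc2.ne⟩, c, ⟨hc1, hc2⟩, rfl⟩
    ⟨f b, by
      simp only [Set.mem_compl_iff, Set.mem_insert_iff, Set.mem_singleton_iff, not_or, hf.eq_iff]
      constructor
      · rintro rfl; exact hb ⟨le_rfl, hat.le⟩
      · rintro rfl; exact hb ⟨hat.le, le_rfl⟩, by
      rintro ⟨w, hw, h⟩
      exact hb (hf h ▸ hw)⟩
  exact hz2 (Set.image_mono Set.Ioo_subset_Icc_self hz1)

theorem pt_interior (p : Sp) : ¬ (interior {p}).Nonempty := by
  intro h
  have h1 : interior {p} = {p} := by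
    obtain ⟨y, hy⟩ := h
    refine Set.Subset.antisymm interior_subset ?_
    have := interior_subset hy
    rw [Set.mem_singleton_iff] at this
    rw [Set.singleton_subset_iff]; exact this ▸ hy
  have ho : IsOpen ({p} : Set Sp) := by rw [← h1]; exact isOpen_interior
  have hrank : 1 < Module.rank ℝ E3 := by
    rw [← Module.finrank_eq_rank, finrank_euclideanSpace]; simp
  haveI : PreconnectedSpace Sp :=
    isPreconnected_iff_preconnectedSpace.1 (isPreconnected_sphere hrank 0 1)
  have hu := IsClopen.eq_univ ⟨isClosed_singleton, ho⟩ (Set.singleton_nonempty p)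
  have h2 : -p ∈ ({p} : Set Sp) := by rw [hu]; trivial
  rw [Set.mem_singleton_iff] at h2
  have h3 : -(p : E3) = p := congrArg Subtype.val h2
  have h4 : (p : E3) = 0 := by
    ext i
    have : -((p : E3) i) = (p : E3) i := congrArg (fun w : E3 => w i) h3
    show (p : E3) i = 0
    linarith
  have h5 := p.2
  rw [h4] at h5
  simp at h5

theorem exists_missing {I J : Type*} [Finite I] [Finite J] (f : I → C(Set.Icc (0 : ℝ) 1, Sp))
    (hf : ∀ i, Function.Injective (f i)) (g : J → Sp) :
    ∃ q : Sp, (∀ i, q ∉ Set.range (f i)) ∧ ∀ j, q ≠ g j := by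
  by_contra hcon
  push Not at hcon
  haveI : Nonempty Sp := (NormedSpace.sphere_nonempty.2 zero_le_one).to_subtype
  let A : I ⊕ J → Set Sp := Sum.elim (fun i => Set.range (f i)) (fun j => {g j})
  have hA : ∀ k, IsClosed (A k) := by
    rintro (i | j)
    · exact (isCompact_range (f i).continuous).isClosed
    · exact isClosed_singleton
  have hU : ⋃ k, A k = Set.univ := by
    rw [Set.eq_univ_iff_forall]
    intro q
    rw [Set.mem_iUnion]
    by_cases h : ∀ i, q ∉ Set.range (f i)
    · obtain ⟨j, hj⟩ := hcon q h
      exact ⟨Sum.inr j, hj⟩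
    · push Not at h
      obtain ⟨i, hi⟩ := h
      exact ⟨Sum.inl i, hi⟩
  obtain ⟨k, hk⟩ := nonempty_interior_of_iUnion_of_closed hA hU
  rcases k with i | j
  · exact arc_interior (f i) (hf i) hk
  · exact pt_interior _ hk

theorem exists_chart (q : Sp) : ∃ F : Sp → ℝ × ℝ, ContinuousOn F {q}ᶜ ∧ Set.InjOn F {q}ᶜ ∧ ∀ z, F z ∈ usq := by
  let st := stereographic' 2 q
  have hsrc : st.source = {q}ᶜ := stereographic'_source q
  let ph : ℝ → ℝ := fun t => Real.arctan t / Real.pi + 1 / 2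
  have phc : Continuous ph := (Real.continuous_arctan.div_const _).add continuous_const
  have phi : Function.Injective ph := by
    intro s t h
    have h1 : Real.arctan s / Real.pi = Real.arctan t / Real.pi := by
      simp only [ph] at h; linarith
    have h2 : Real.arctan s = Real.arctan t := by
      field_simp at h1; exact h1
    exact Real.arctan_injective h2
  have phm : ∀ t, ph t ∈ Set.Icc (0 : ℝ) 1 := by
    intro t
    have hp := Real.pi_pos
    have h1 : Real.arctan t / Real.pi ≤ 1 / 2 := by
      rw [div_le_iff₀ hp]; linarith [Real.arctan_lt_pi_div_two t]
    have h2 : -(1 / 2) ≤ Real.arctan t / Real.pi := by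
      rw [le_div_iff₀ hp]; linarith [Real.neg_pi_div_two_lt_arctan t]
    constructor <;> simp only [ph] <;> linarith
  have hst : ContinuousOn st {q}ᶜ := hsrc ▸ st.continuousOn
  have hin : Set.InjOn st {q}ᶜ := hsrc ▸ st.injOn
  refine ⟨fun z => (ph (st z 0), ph (st z 1)), ?_, ?_, fun z => ⟨phm _, phm _⟩⟩
  · have hc : Continuous (fun w : EuclideanSpace ℝ (Fin 2) => (ph (w 0), ph (w 1))) := by fun_prop
    exact hc.comp_continuousOn hst
  · intro z hz w hw h
    apply hin hz hw
    have h0 := phi (congrArg Prod.fst h)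
    have h1 := phi (congrArg Prod.snd h)
    ext i
    fin_cases i
    · exact h0
    · exact h1

end Sph
end WBW

namespace WBW
open Equiv
set_option linter.unusedSectionVars false
set_option linter.style.haveILetI false
set_option linter.unusedVariables false

theorem vert_on_arc {V : Type} {G : SimpleGraph V} (D : Drawing G) (e : Sym2 V) (he : e ∈ G.edgeSet) (v : V) :
    D.vmap v ∈ Set.range (D.arc e) ↔ v ∈ e := by
  have hends := D.arc_ends e he
  have hm : v ∈ e ↔ D.vmap v ∈ Sym2.map D.vmap e := by
    rw [Sym2.mem_map]
    constructor
    · intro h; exact ⟨v, h, rfl⟩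
    · rintro ⟨w, hw, h⟩; exact D.vmap_inj h ▸ hw
  rw [hm, hends, Sym2.mem_iff]
  constructor
  · rintro ⟨t, ht⟩
    by_cases h0 : (t : ℝ) = 0
    · left; rw [← ht]; congr 1; exact Subtype.ext h0
    by_cases h1 : (t : ℝ) = 1
    · right; rw [← ht]; congr 1; exact Subtype.ext h1
    exact absurd ⟨v, ht.symm⟩ (D.interior_avoids e he t h0 h1)
  · rintro (h | h)
    · exact ⟨_, h.symm⟩
    · exact ⟨_, h.symm⟩

theorem nearly_flat {V : Type} [Finite V] (G : SimpleGraph V) (x : ℕ) (h : IsNearlyPlanar x G) :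
    IsFlat ((2 * x + 4) + (2 * x + 4 + 1) * ((x + 1) * (2 * x + 4))) G := by
  classical
  obtain ⟨D, hD⟩ := h
  have hmiss : ∃ q : unitSphere, (∀ e ∈ G.edgeSet, q ∉ Set.range (D.arc e)) ∧ ∀ v, q ≠ D.vmap v := by
    obtain ⟨q, h1, h2⟩ := exists_missing (I := G.edgeSet) (J := V) (fun e => D.arc e.1)
      (fun e => D.arc_inj e.1 e.2) D.vmap
    exact ⟨q, fun e he => h1 ⟨e, he⟩, h2⟩
  obtain ⟨q, hq1, hq2⟩ := hmiss
  have hch : ∃ F : unitSphere → ℝ × ℝ, ContinuousOn F {q}ᶜ ∧ Set.InjOn F {q}ᶜ ∧ ∀ z, F z ∈ usq :=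
    exists_chart q
  obtain ⟨F, hFc, hFi, hFm⟩ := hch
  have arcq : ∀ e ∈ G.edgeSet, Set.range (D.arc e) ⊆ {q}ᶜ := by
    intro e he z hz h
    rw [Set.mem_singleton_iff] at h
    exact hq1 e he (h ▸ hz)
  have verq : ∀ v, D.vmap v ∈ ({q}ᶜ : Set unitSphere) := fun v h => hq2 v h.symm
  let X : Set unitSphere := Set.range D.vmap ∪ ⋃ e ∈ G.edgeSet, Prod.snd '' crossingSet D e
  have hXf : X.Finite := by
    refine (Set.finite_range _).union (Set.Finite.biUnion (Set.toFinite _) fun e he => ?_)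
    exact (hD e he).1.image _
  have hXq : X ⊆ {q}ᶜ := by
    rintro z (⟨v, rfl⟩ | hz)
    · exact verq v
    · obtain ⟨e, he, c, hc, rfl⟩ := Set.mem_iUnion₂.1 hz
      exact arcq e he hc.2.2.1
  have himg : ∀ e ∈ G.edgeSet, ∀ z ∈ ({q}ᶜ : Set unitSphere), F z ∈ F '' Set.range (D.arc e) →
      z ∈ Set.range (D.arc e) := by
    rintro e he z hz ⟨w, hw, h⟩
    exact hFi (arcq e he hw) hz h ▸ hw
  refine flat_of_planar G x (F '' X) (hXf.image F) (by rintro _ ⟨z, _, rfl⟩; exact hFm z)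
    (fun v => F (D.vmap v)) (fun v w h => D.vmap_inj (hFi (verq v) (verq w) h))
    (fun v => ⟨_, Or.inl ⟨v, rfl⟩, rfl⟩) (fun e => F '' Set.range (D.arc e)) ?_ ?_ ?_ ?_ ?_ ?_ ?_ ?_
  · intro e he
    exact (isCompact_range (D.arc e).continuous).image_of_continuousOn (hFc.mono (arcq e he))
  · intro e he
    exact (isPreconnected_range (D.arc e).continuous).image _ (hFc.mono (arcq e he))
  · rintro e he _ ⟨z, _, rfl⟩; exact hFm z
  · rintro e he e' he' hne _ ⟨⟨z, hz, rfl⟩, hz'⟩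
    have hz2 := himg e' he' z (arcq e he hz) hz'
    refine ⟨z, ?_, rfl⟩
    by_cases hv : z ∈ Set.range D.vmap
    · exact Or.inl hv
    · exact Or.inr (Set.mem_biUnion he ⟨(e', z), ⟨he', hne.symm, hz, hz2, hv⟩, rfl⟩)
  · intro e he
    have hfin : (D.vmap '' {v | v ∈ e} ∪ Prod.snd '' crossingSet D e).Finite :=
      (Set.toFinite _).union ((hD e he).1.image _)
    have hsub : F '' X ∩ F '' Set.range (D.arc e) ⊆
        F '' (D.vmap '' {v | v ∈ e} ∪ Prod.snd '' crossingSet D e) := by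
      rintro _ ⟨⟨z, hz, rfl⟩, hz'⟩
      have hze := himg e he z (hXq hz) hz'
      refine ⟨z, ?_, rfl⟩
      rcases hz with ⟨v, rfl⟩ | hz
      · exact Or.inl ⟨v, (vert_on_arc D e he v).1 hze, rfl⟩
      · obtain ⟨e', he', c, hc, rfl⟩ := Set.mem_iUnion₂.1 hz
        right
        by_cases hee : e' = e
        · subst hee; exact ⟨c, hc, rfl⟩
        · exact ⟨(e', c.2), ⟨he', hee, hze, hc.2.2.1, hc.2.2.2.2⟩, rfl⟩
    have h1 := Set.ncard_le_ncard hsub (hfin.image F)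
    have h2 := Set.ncard_image_le (f := F) hfin
    have h3 := Set.ncard_union_le (D.vmap '' {v | v ∈ e}) (Prod.snd '' crossingSet D e)
    have h4 := Set.ncard_image_le (f := Prod.snd) (hD e he).1
    have h5 := Set.ncard_image_le (f := D.vmap) (Set.toFinite {v | v ∈ e})
    have h6 : {v | v ∈ e}.ncard ≤ 2 := by
      induction e using Sym2.ind with
      | _ a b =>
        have : {v | v ∈ s(a, b)} = {a, b} := by ext v; simp
        rw [this]; exact (Set.ncard_insert_le a {b}).trans (by rw [Set.ncard_singleton])
    have h7 := (hD e he).2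
    omega
  · intro e he v hv
    exact (vert_on_arc D e he v).1 (himg e he _ (verq v) hv)
  · intro e he v hv
    exact ⟨_, (vert_on_arc D e he v).2 hv, rfl⟩
  · rintro _ ⟨z, hz, rfl⟩ hn
    have hv : z ∉ Set.range D.vmap := by
      rintro ⟨v, rfl⟩; exact hn ⟨v, rfl⟩
    by_cases hemp : ∃ e, e ∈ G.edgeSet ∧ F z ∈ F '' Set.range (D.arc e)
    · obtain ⟨e, he, hze⟩ := hemp
      have hze' := himg e he z (hXq hz) hze
      have hsub : {e | e ∈ G.edgeSet ∧ F z ∈ F '' Set.range (D.arc e)} ⊆ {e} ∪ Prod.fst '' crossingSet D e := by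
        rintro e' ⟨he', hz'⟩
        have hz2 := himg e' he' z (hXq hz) hz'
        by_cases hee : e' = e
        · exact Or.inl hee
        · exact Or.inr ⟨(e', z), ⟨he', hee, hze', hz2, hv⟩, rfl⟩
      have h1 := Set.ncard_le_ncard hsub (Set.toFinite _)
      have h2 := Set.ncard_union_le {e} (Prod.fst '' crossingSet D e)
      have h4 := Set.ncard_image_le (f := Prod.fst) (hD e he).1
      have h7 := (hD e he).2
      rw [Set.ncard_singleton] at h2
      omega
    · have : {e | e ∈ G.edgeSet ∧ F z ∈ F '' Set.range (D.arc e)} = ∅ := by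
        ext e
        simp only [Set.mem_empty_iff_false, iff_false]
        exact fun h => hemp ⟨e, h⟩
      rw [this]; simp

end WBW

/-- Theorem 1: the classes of `λ`-flat graphs and `ξ`-nearly planar
graphs are parametrically equivalent: there are functions `g, h : ℕ → ℕ` such that
every `ξ`-nearly planar graph is `g ξ`-flat and every `λ`-flat graph is
`h λ`-nearly planar. -/
theorem flat_nearlyPlanar_parametrically_equivalent :
    ∃ g h : ℕ → ℕ,
      (∀ (V : Type) (G : SimpleGraph V), Finite V →
        ∀ x : ℕ, WBW.IsNearlyPlanar x G → WBW.IsFlat (g x) G) ∧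
      (∀ (V : Type) (G : SimpleGraph V), Finite V →
        ∀ l : ℕ, WBW.IsFlat l G → WBW.IsNearlyPlanar (h l) G) := by
  refine ⟨fun x => (2 * x + 4) + (2 * x + 4 + 1) * ((x + 1) * (2 * x + 4)),
    fun l => (((l + 1) * 5 ^ (l + 1) * 2) * ((l + 1) * 5 ^ (l + 1) * 2)) *
      ((2 * (l + 1) + 2) * (2 * (l + 1) + 2)), ?_, ?_⟩
  · intro V G hV x h
    exact WBW.nearly_flat G x h
  · intro V G hV l h
    exact WBW.flat_nearly G l h
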